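/- arXiv:1504.00255 — 2 statements merged into one kernel-verified Lean document; each statement's English description precedes it below -/
import Mathlib

section
/- Let n ≥ 2. For every g ∈ Sp(n+1) there exist h ∈ N = {diag(A,q₁,q₂) : A ∈ Sp(n−1), q₁,q₂ ∈ Sp(1)}, k ∈ K = {diag(B,q) : B ∈ Sp(n), q ∈ Sp(1)}, and a matrix A ∈ 𝓕 whose last column equals (‖v₀(g)‖, |vₙ(g)|, |vₙ₊₁(g)|)ᵗ, such that h g k⁻¹ = diag(I_{n−2}, A), where I_{n−2} is the (n−2)×(n−2) identity matrix and A is viewed as a quaternionic matrix with real entries. -/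
open scoped Quaternion

noncomputable section

/-- `Sp m` is the group of `m × m` quaternionic matrices `g` with `g* g = 1`. -/
abbrev Sp (m : ℕ) : Type := ↥(unitary (Matrix (Fin m) (Fin m) ℍ[ℝ]))

/-- The subgroup `K = {diag(B, q) : B ∈ Sp(n), q ∈ Sp(1)}` of `Sp (n+1)`. -/
def Kset (n : ℕ) : Set (Sp (n + 1)) :=
  {x | ∀ i j : Fin (n + 1),
    (((i : ℕ) < n ∧ (j : ℕ) = n) ∨ ((i : ℕ) = n ∧ (j : ℕ) < n)) → x.val i j = 0}

/-- The subgroup `N = {diag(A, q₁, q₂) : A ∈ Sp(n−1), q₁, q₂ ∈ Sp(1)}` of `Sp (n+1)`. -/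
def Nset (n : ℕ) : Set (Sp (n + 1)) :=
  {x | ∀ i j : Fin (n + 1),
    ¬(((i : ℕ) < n - 1 ∧ (j : ℕ) < n - 1) ∨ (i = j ∧ n - 1 ≤ (i : ℕ))) → x.val i j = 0}

/-- `v g i` is the `i`-th entry of the last column of `g ∈ Sp (n+1)`. -/
def v {n : ℕ} (g : Sp (n + 1)) (i : Fin (n + 1)) : ℍ[ℝ] :=
  g.val i (Fin.last n)

/-- The Euclidean norm of the vector `v₀(g) ∈ ℍ^{n-1}` of the first `n − 1` entries of the
last column of `g`. -/
def normV0 {n : ℕ} (g : Sp (n + 1)) : ℝ :=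
  Real.sqrt (∑ i : Fin (n - 1), ‖v g (Fin.castLE (by omega) i)‖ ^ 2)

/-- `𝓕 = {A ∈ SO(3) : A₁₂ = 0 and A₂₂, A₁₃, A₂₃, A₃₃ ≥ 0}` (1-based indices). -/
def Fset : Set (Matrix (Fin 3) (Fin 3) ℝ) :=
  {A | A.transpose * A = 1 ∧ A.det = 1 ∧ A 0 1 = 0 ∧
    0 ≤ A 1 1 ∧ 0 ≤ A 0 2 ∧ 0 ≤ A 1 2 ∧ 0 ≤ A 2 2}

/-- The quaternionic `(n+1) × (n+1)` matrix `diag(I_{n−2}, A)` obtained from a real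
`3 × 3` matrix `A`. -/
def embedIA (n : ℕ) (A : Matrix (Fin 3) (Fin 3) ℝ) :
    Matrix (Fin (n + 1)) (Fin (n + 1)) ℍ[ℝ] := fun i j =>
  if h : n - 2 ≤ (i : ℕ) ∧ n - 2 ≤ (j : ℕ) then
    ((A ⟨(i : ℕ) - (n - 2), by have := i.isLt; omega⟩
        ⟨(j : ℕ) - (n - 2), by have := j.isLt; omega⟩ : ℝ) : ℍ[ℝ])
  else if i = j then 1 else 0

lemma aux_coe (r : ℝ) : (r : ℍ[ℝ]) = algebraMap ℝ ℍ[ℝ] r := rfl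

lemma aux_map_unitary {m : ℕ} (M : Matrix (Fin m) (Fin m) ℝ) (hM : M.transpose * M = 1) :
    M.map (algebraMap ℝ ℍ[ℝ]) ∈ unitary (Matrix (Fin m) (Fin m) ℍ[ℝ]) := by
  have hM' : M * M.transpose = 1 := mul_eq_one_comm.mp hM
  have hs : star (M.map (algebraMap ℝ ℍ[ℝ])) = M.transpose.map (algebraMap ℝ ℍ[ℝ]) := by
    ext1 i j
    rw [Matrix.star_apply, Matrix.map_apply, Matrix.map_apply, ← aux_coe, ← aux_coe,
      Quaternion.star_coe, Matrix.transpose_apply]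
  rw [Unitary.mem_iff, hs, ← Matrix.map_mul, ← Matrix.map_mul, hM, hM',
    Matrix.map_one _ (map_zero _) (map_one _)]
  simp

lemma aux_phase (x : ℍ[ℝ]) : ∃ q : ℍ[ℝ], star q * q = 1 ∧ q * star q = 1 ∧
    q * x = ((‖x‖ : ℝ) : ℍ[ℝ]) := by
  by_cases hx : x = 0
  · exact ⟨1, by simp, by simp, by simp [hx]⟩
  · have hn : ‖x‖ ≠ 0 := norm_ne_zero_iff.mpr hx
    have h1 : star x * x = ((‖x‖ * ‖x‖ : ℝ) : ℍ[ℝ]) := by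
      rw [Quaternion.star_mul_self, Quaternion.normSq_eq_norm_mul_self]
    have h2 : x * star x = ((‖x‖ * ‖x‖ : ℝ) : ℍ[ℝ]) := by
      rw [Quaternion.self_mul_star, Quaternion.normSq_eq_norm_mul_self]
    refine ⟨(‖x‖⁻¹ : ℝ) • star x, ?_, ?_, ?_⟩
    · rw [Quaternion.star_smul, star_star, smul_mul_smul_comm, h2, ← Quaternion.coe_smul]
      simp only [smul_eq_mul]
      rw [← Quaternion.coe_one]; congr 1; field_simp
    · rw [Quaternion.star_smul, star_star, smul_mul_smul_comm, h1, ← Quaternion.coe_smul]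
      simp only [smul_eq_mul]
      rw [← Quaternion.coe_one]; congr 1; field_simp
    · rw [smul_mul_assoc, h1, ← Quaternion.coe_smul]
      congr 1; simp only [smul_eq_mul]; field_simp

/-- Householder reflection. -/
lemma aux_house {m : ℕ} (x y : Fin m → ℝ) (hxy : ∑ i, x i ^ 2 = ∑ i, y i ^ 2) :
    ∃ H : Matrix (Fin m) (Fin m) ℝ, H.transpose * H = 1 ∧ H.mulVec x = y ∧
      ∀ i j, i ≠ j → (x i = y i ∨ x j = y j) → H i j = 0 := by
  set w : Fin m → ℝ := x - y with hw
  set s : ℝ := w ⬝ᵥ w with hs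
  by_cases h0 : s = 0
  · have : w = 0 := dotProduct_self_eq_zero.mp h0
    refine ⟨1, by simp, ?_, ?_⟩
    · rw [Matrix.one_mulVec]; exact sub_eq_zero.mp this
    · intro i j hij _; exact Matrix.one_apply_ne hij
  · have hx : w ⬝ᵥ x = s / 2 := by
      have hxy' : x ⬝ᵥ x = y ⬝ᵥ y := by
        simpa [dotProduct, pow_two] using hxy
      simp only [hs, hw, sub_dotProduct, dotProduct_sub]
      rw [dotProduct_comm x y]; linarith
    refine ⟨1 - (2 / s) • Matrix.vecMulVec w w, ?_, ?_, ?_⟩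
    · have ht : (1 - (2 / s) • Matrix.vecMulVec w w).transpose
          = 1 - (2 / s) • Matrix.vecMulVec w w := by
        ext i j
        simp [Matrix.vecMulVec_apply, Matrix.one_apply, eq_comm, mul_comm (w i)]
      have hv : Matrix.vecMulVec w w * Matrix.vecMulVec w w = s • Matrix.vecMulVec w w := by
        ext i j
        simp only [Matrix.mul_apply, Matrix.vecMulVec_apply, Matrix.smul_apply, smul_eq_mul, hs,
          dotProduct, Finset.sum_mul]
        exact Finset.sum_congr rfl fun k _ => by ring
      rw [ht, mul_sub, sub_mul, sub_mul, smul_mul_smul_comm, hv, smul_smul]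
      simp only [mul_one, one_mul]
      have : 2 / s * (2 / s) * s = 2 / s + 2 / s := by field_simp; ring
      rw [this, add_smul]; abel
    · rw [Matrix.sub_mulVec, Matrix.one_mulVec, Matrix.smul_mulVec]
      ext i
      have : (Matrix.vecMulVec w w).mulVec x i = w i * (w ⬝ᵥ x) := by
        simp only [Matrix.mulVec, dotProduct, Matrix.vecMulVec_apply, Finset.mul_sum]
        exact Finset.sum_congr rfl fun k _ => by ring
      simp only [Pi.sub_apply, Pi.smul_apply, this, hx, smul_eq_mul]
      have : 2 / s * (w i * (s / 2)) = w i := by field_simp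
      rw [this, hw]; simp
    · intro i j hij h
      have : w i * w j = 0 := by
        rcases h with h | h <;> simp [hw, h]
      simp [Matrix.one_apply_ne hij, Matrix.vecMulVec_apply, this]

lemma aux_F (r b c : ℝ) (hr : 0 ≤ r) (hb : 0 ≤ b) (hc : 0 ≤ c) (h : r ^ 2 + b ^ 2 + c ^ 2 = 1) :
    ∃ A ∈ Fset, A 0 2 = r ∧ A 1 2 = b ∧ A 2 2 = c := by
  have key : ∃ p q : ℝ, 0 ≤ p ∧ p ^ 2 + q ^ 2 = 1 ∧ p * b + q * c = 0 := by
    by_cases h0 : b ^ 2 + c ^ 2 = 0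
    · have hb0 : b = 0 := by nlinarith [sq_nonneg b, sq_nonneg c]
      have hc0 : c = 0 := by nlinarith [sq_nonneg b, sq_nonneg c]
      exact ⟨1, 0, by simp, by simp, by simp [hb0]⟩
    · have hp : 0 < b ^ 2 + c ^ 2 := lt_of_le_of_ne (by positivity) (Ne.symm h0)
      have hs := Real.sqrt_pos.mpr hp
      have hsq := Real.sq_sqrt hp.le
      refine ⟨c / √(b ^ 2 + c ^ 2), - b / √(b ^ 2 + c ^ 2), by positivity, ?_, ?_⟩
      · rw [div_pow, div_pow, hsq]; field_simp; ring
      · field_simp; ring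
  obtain ⟨p, q, hp, hpq, ho⟩ := key
  -- second column (0,p,q), third (r,b,c), first = second × third
  refine ⟨!![p * c - q * b, 0, r; q * r, p, b; - p * r, q, c], ⟨?_, ?_, ?_⟩, ?_⟩
  · have e : (p * c - q * b) ^ 2 = b ^ 2 + c ^ 2 := by
      linear_combination (b ^ 2 + c ^ 2) * hpq - (p * b + q * c) * ho
    ext i j
    fin_cases i <;> fin_cases j <;>
      simp [Matrix.mul_apply, Fin.sum_univ_three]
    · linear_combination e + r ^ 2 * hpq + h
    · ring
    · ring
    · ring
    · linear_combination hpq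
    · linear_combination ho
    · ring
    · linear_combination ho
    · linear_combination h
  · rw [Matrix.det_fin_three]
    simp
    linear_combination (b ^ 2 + c ^ 2 + r ^ 2) * hpq - (p * b + q * c) * ho + h
  · simp [hp, hr, hb, hc]
  · simp

lemma aux_embed (m : ℕ) (A : Matrix (Fin 3) (Fin 3) ℝ) (hA : A.transpose * A = 1) :
    embedIA (m + 2) A ∈ unitary (Matrix (Fin (m + 3)) (Fin (m + 3)) ℍ[ℝ]) := by
  have : embedIA (m + 2) A = ((Matrix.fromBlocks 1 0 0 A : Matrix (Fin m ⊕ Fin 3) (Fin m ⊕ Fin 3) ℝ).submatrix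
      finSumFinEquiv.symm finSumFinEquiv.symm).map (algebraMap ℝ ℍ[ℝ]) := by
    ext1 i j
    obtain ⟨i, rfl⟩ := (finSumFinEquiv (m := m) (n := 3)).surjective i
    obtain ⟨j, rfl⟩ := (finSumFinEquiv (m := m) (n := 3)).surjective j
    rcases i with i | i <;> rcases j with j | j
    · have := i.isLt
      simp only [embedIA, Matrix.map_apply, Matrix.submatrix_apply, Equiv.symm_apply_apply, Matrix.fromBlocks_apply₁₁]
      rw [dif_neg (by simp)]
      simp [Matrix.one_apply]
    · have := i.isLt
      simp only [embedIA, Matrix.map_apply, Matrix.submatrix_apply, Equiv.symm_apply_apply, Matrix.fromBlocks_apply₁₂]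
      rw [dif_neg (by simp)]
      rw [if_neg (by simp [Fin.ext_iff]; omega)]; simp
    · have := j.isLt
      simp only [embedIA, Matrix.map_apply, Matrix.submatrix_apply, Equiv.symm_apply_apply, Matrix.fromBlocks_apply₂₁]
      rw [dif_neg (by simp)]
      rw [if_neg (by simp [Fin.ext_iff]; omega)]; simp
    · simp only [embedIA, Matrix.map_apply, Matrix.submatrix_apply, Equiv.symm_apply_apply, Matrix.fromBlocks_apply₂₂]
      rw [dif_pos (by simp)]
      simp
  rw [this]
  apply aux_map_unitary
  rw [Matrix.transpose_submatrix, Matrix.submatrix_mul_equiv, Matrix.fromBlocks_transpose, Matrix.fromBlocks_multiply]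
  simp [hA]

/-- Every `g ∈ Sp(n+1)` can be moved by the `N × K` action to `diag(I_{n−2}, A)` with
`A ∈ 𝓕` whose last column is `(‖v₀(g)‖, |vₙ(g)|, |vₙ₊₁(g)|)ᵗ`. -/
theorem statement1 (n : ℕ) (hn : 2 ≤ n) (g : Sp (n + 1)) :
    ∃ h ∈ Nset n, ∃ k ∈ Kset n, ∃ A ∈ Fset,
      A 0 2 = normV0 g ∧ A 1 2 = ‖v g ⟨n - 1, by omega⟩‖ ∧ A 2 2 = ‖v g (Fin.last n)‖ ∧
      (h * g * k⁻¹).val = embedIA n A := by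
  obtain ⟨m, rfl⟩ : ∃ m, n = m + 2 := ⟨n - 2, by omega⟩
  set b := ‖v g ⟨m + 2 - 1, by omega⟩‖ with hb
  set c := ‖v g (Fin.last (m + 2))‖ with hc
  set r := normV0 g with hr
  have hr0 : 0 ≤ r := Real.sqrt_nonneg _
  have hr2 : r ^ 2 = ∑ i : Fin (m + 1), ‖v g i.castSucc.castSucc‖ ^ 2 := by
    rw [hr, normV0, Real.sq_sqrt (Finset.sum_nonneg fun i _ => by positivity)]
    rfl
  have hsum : ∑ i, ‖v g i‖ ^ 2 = r ^ 2 + b ^ 2 + c ^ 2 := by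
    rw [Fin.sum_univ_castSucc, Fin.sum_univ_castSucc, hr2]
    rfl
  have hone : ∑ i, ‖v g i‖ ^ 2 = 1 := by
    have h1 := congrFun (congrFun (Unitary.mem_iff.mp g.2).1 (Fin.last _)) (Fin.last _)
    rw [Matrix.mul_apply] at h1
    simp only [Matrix.star_apply, Matrix.one_apply_eq, Quaternion.star_mul_self,
      Quaternion.normSq_eq_norm_mul_self] at h1
    have h2 := congrArg (fun q : ℍ[ℝ] => q.re) h1
    simp only [aux_coe, ← map_sum] at h2
    rw [← aux_coe] at h2
    simp only [Quaternion.re_coe, Quaternion.re_one] at h2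
    rw [← h2]
    exact Finset.sum_congr rfl fun i _ => pow_two _
  obtain ⟨A, hAF, hA0, hA1, hA2⟩ := aux_F r b c hr0 (norm_nonneg _) (norm_nonneg _)
    (by rw [← hsum, hone])
  choose q hq1 hq2 hq3 using fun i => aux_phase (v g i)
  set y : Fin (m + 3) → ℝ := fun i =>
    if (i : ℕ) < m then 0 else if (i : ℕ) = m then r else if (i : ℕ) = m + 1 then b else c with hy
  have hyE : ∀ i, embedIA (m + 2) A i (Fin.last _) = ((y i : ℝ) : ℍ[ℝ]) := by
    intro i
    have hi := i.isLt
    by_cases h1 : (i : ℕ) < m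
    · have h2 : i ≠ Fin.last _ := by
        rw [Ne, Fin.ext_iff, Fin.val_last]; omega
      simp only [embedIA, hy, if_pos h1, if_neg h2]
      rw [dif_neg (by omega)]
      simp
    · simp only [embedIA, hy, if_neg h1]
      rw [dif_pos (by simp; omega)]
      congr 1
      obtain ⟨i, hi'⟩ := i
      have e3 : i = m ∨ i = m + 1 ∨ i = m + 2 := by
        simp only at hi h1; omega
      rcases e3 with rfl | rfl | rfl <;> simp [← hA0, ← hA1, ← hA2] <;> rfl
  have hysum : ∑ i, ‖v g i‖ ^ 2 = ∑ i, y i ^ 2 := by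
    rw [hsum, Fin.sum_univ_castSucc, Fin.sum_univ_castSucc, Fin.sum_univ_castSucc]
    simp [hy]
  obtain ⟨H, hH1, hH2, hH3⟩ := aux_house (fun i => ‖v g i‖) y hysum
  have hfix : ∀ i : Fin (m + 3), m + 1 ≤ (i : ℕ) → ‖v g i‖ = y i := by
    intro i hi
    obtain ⟨i, hi'⟩ := i
    have e3 : i = m + 1 ∨ i = m + 2 := by
      simp only at hi; omega
    rcases e3 with rfl | rfl <;> simp [hy] <;> rfl
  have hD : Matrix.diagonal q ∈ unitary (Matrix (Fin (m + 3)) (Fin (m + 3)) ℍ[ℝ]) := by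
    rw [Unitary.mem_iff, Matrix.star_eq_conjTranspose, Matrix.diagonal_conjTranspose,
      Matrix.diagonal_mul_diagonal, Matrix.diagonal_mul_diagonal]
    simp [hq1, hq2]
  set h : Sp (m + 3) := ⟨_, aux_map_unitary H hH1⟩ * ⟨_, hD⟩ with hh
  have hval : ∀ i j, h.val i j = (H i j : ℍ[ℝ]) * q j := by
    intro i j
    simp [hh, Matrix.mul_diagonal]
  set E : Sp (m + 3) := ⟨_, aux_embed m A hAF.1⟩ with hE
  have hcol : ∀ i, (h * g).val i (Fin.last _) = E.val i (Fin.last _) := by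
    intro i
    have : (h * g).val i (Fin.last _) = ∑ j, h.val i j * v g j := by
      simp [Matrix.mul_apply, v]
    rw [this]
    simp only [hval, mul_assoc, hq3]
    show _ = embedIA (m + 2) A i (Fin.last _)
    rw [hyE, ← hH2]
    simp only [Matrix.mulVec, dotProduct, aux_coe, map_sum, map_mul]
  refine ⟨h, ?_, E⁻¹ * (h * g), ?_, A, hAF, hA0, hA1, hA2, ?_⟩
  · intro i j hij
    rw [hval]
    have hne : i ≠ j := by
      rintro rfl
      apply hij
      by_cases hi : (i : ℕ) < m + 2 - 1
      · exact Or.inl ⟨hi, hi⟩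
      · exact Or.inr ⟨rfl, by omega⟩
    have : H i j = 0 := by
      apply hH3 i j hne
      by_cases hi : (i : ℕ) < m + 2 - 1
      · right; apply hfix
        by_contra hj
        exact hij (Or.inl ⟨hi, by omega⟩)
      · left; apply hfix; omega
    simp [this]
  · set u := E⁻¹ * (h * g) with hu
    have hu1 : ∀ i, u.val i (Fin.last _) =
        (1 : Matrix (Fin (m + 3)) (Fin (m + 3)) ℍ[ℝ]) i (Fin.last _) := by
      intro i
      have e1 : u.val = star E.val * (h * g).val := rfl
      rw [e1, Matrix.mul_apply]
      simp only [hcol]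
      rw [← Matrix.mul_apply, (Unitary.mem_iff.mp E.2).1]
    have hu2 : ∀ i, (star u.val) i (Fin.last _) =
        (1 : Matrix (Fin (m + 3)) (Fin (m + 3)) ℍ[ℝ]) i (Fin.last _) := by
      intro i
      rw [← (Unitary.mem_iff.mp u.2).1, Matrix.mul_apply]
      simp only [hu1]
      rw [← Matrix.mul_apply, mul_one]
    rintro i j (⟨hi, hj⟩ | ⟨hi, hj⟩)
    · have : j = Fin.last _ := Fin.ext hj
      rw [this, hu1, Matrix.one_apply_ne]
      rintro rfl; simp at hi
    · have : i = Fin.last _ := Fin.ext hi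
      have h3 := hu2 j
      rw [Matrix.star_apply, Matrix.one_apply_ne (by rintro rfl; simp at hj)] at h3
      rw [this]; exact star_eq_zero.mp h3
  · have : h * g * (E⁻¹ * (h * g))⁻¹ = E := by group
    rw [this]
end
end

section
/- Let M₂ = Sp(3)/H be the left coset space of Sp(3) by the closed subgroup H = {diag(q₁, 1, q₂) : q₁, q₂ ∈ Sp(1)}, equipped with the quotient topology. Then π₂(M₂) is trivial and π₄(M₂) is isomorphic to ℤ. -/
open scoped Quaternion Topology

noncomputable section

/-- `Sp 3`, the group of `3 × 3` quaternionic matrices `g` with `g* g = 1`, topologized as a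
subspace of the `3 × 3` quaternionic matrices. -/
abbrev Sp3 : Type := ↥(unitary (Matrix (Fin 3) (Fin 3) ℍ[ℝ]))

/-- The left-coset relation on `Sp 3` induced by the subgroup
`H = {diag(q₁, 1, q₂) : q₁, q₂ ∈ Sp(1)}`: `g ∼ g'` iff `g' = g h` for some `h ∈ H`. -/
def HRel (g g' : Sp3) : Prop :=
  ∃ h : Sp3, (∃ q₁ q₂ : ℍ[ℝ], ‖q₁‖ = 1 ∧ ‖q₂‖ = 1 ∧
    h.val = Matrix.diagonal ![q₁, 1, q₂]) ∧ g' = g * h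

/-- `M₂ = Sp(3)/Sp(1)²`, with the quotient topology. -/
abbrev M₂ : Type := Quot HRel

open scoped unitInterval

section HG

variable {N X : Type*} [TopologicalSpace X] {x : X}

/-- Class of a generalized loop given as a bare function. -/
def piMk (f : (I^N) → X) (hc : Continuous f) (hb : ∀ y ∈ Cube.boundary N, f y = x) :
    HomotopyGroup N X x :=
  Quotient.mk (GenLoop.Homotopic.setoid N x) ⟨⟨f, hc⟩, hb⟩

theorem piMk_surj (c : HomotopyGroup N X x) : ∃ f hc hb, c = piMk (x := x) (N := N) f hc hb := by
  induction c using Quotient.inductionOn with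
  | _ p => exact ⟨p, p.1.2, p.2, rfl⟩

theorem piMk_eq {f g : (I^N) → X} {hf hg hf' hg'} (H : I × (I^N) → X) (hc : Continuous H)
    (h0 : ∀ y, H (0, y) = f y) (h1 : ∀ y, H (1, y) = g y)
    (hb : ∀ t, ∀ y ∈ Cube.boundary N, H (t, y) = x) :
    piMk (x := x) f hf hf' = piMk g hg hg' := by
  apply Quotient.sound
  refine ⟨⟨⟨⟨H, hc⟩, h0, h1⟩, ?_⟩⟩
  intro t y hy
  change H (t, y) = f y
  rw [hb t y hy, hf' y hy]

theorem piMk_exact {f g : (I^N) → X} {hf hg hf' hg'} 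
    (h : piMk (x := x) f hf hf' = piMk g hg hg') : ∃ H : I × (I^N) → X, Continuous H ∧
    (∀ y, H (0, y) = f y) ∧ (∀ y, H (1, y) = g y) ∧
    (∀ t, ∀ y ∈ Cube.boundary N, H (t, y) = x) := by
  obtain ⟨H⟩ := Quotient.exact h
  refine ⟨H, H.continuous, H.map_zero_left, H.map_one_left, ?_⟩
  intro t y hy
  exact (H.eq_fst t hy).trans (hf' y hy)

variable [DecidableEq N]

theorem piMk_one [Nonempty N] : (1 : HomotopyGroup N X x) =
    piMk (fun _ => x) continuous_const (fun _ _ => rfl) := rfl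

theorem piMk_inv [Nonempty N] (i : N) {f : (I^N) → X} {hf hf' hg hg'}  :
    (piMk (x := x) f hf hf')⁻¹ = piMk (fun t ↦ f fun j ↦ if j = i then σ (t i) else t j) hg hg' := by
  unfold piMk
  rw [HomotopyGroup.inv_spec (i := i)]
  rfl

theorem piMk_mul [Nonempty N] (i : N) {f g : (I^N) → X} {hf hf' hg hg' hh hh'}  :
    (piMk (x := x) f hf hf') * piMk g hg hg' =
      piMk (fun t ↦ if (t i : ℝ) ≤ 1 / 2
      then g (Function.update t i <| Set.projIcc 0 1 zero_le_one (2 * t i))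
      else f (Function.update t i <| Set.projIcc 0 1 zero_le_one (2 * t i - 1))) hh hh' := by
  unfold piMk
  exact (HomotopyGroup.mul_spec (i := i))

theorem piMk_mul' [Nonempty N] (i : N) {f g : (I^N) → X} (hf hf' hg hg')  : ∃ hh hh', 
    (piMk (x := x) f hf hf') * piMk g hg hg' =
      piMk (fun t ↦ if (t i : ℝ) ≤ 1 / 2
      then g (Function.update t i <| Set.projIcc 0 1 zero_le_one (2 * t i))
      else f (Function.update t i <| Set.projIcc 0 1 zero_le_one (2 * t i - 1))) hh hh' := by
  refine ⟨(GenLoop.transAt i ⟨⟨g, hg⟩, hg'⟩ ⟨⟨f, hf⟩, hf'⟩).1.2, (GenLoop.transAt i ⟨⟨g, hg⟩, hg'⟩ ⟨⟨f, hf⟩, hf'⟩).2, ?_⟩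
  exact piMk_mul i

/-- Induced map on homotopy groups. -/
def piMap {Y : Type*} [TopologicalSpace Y] {y : Y} [Nonempty N] (φ : X → Y) (hφ : Continuous φ) (hx : φ x = y) :
    HomotopyGroup N X x →* HomotopyGroup N Y y :=
  MonoidHom.mk' (Quotient.map (fun p : GenLoop N X x => (⟨⟨fun t => φ (p t), hφ.comp p.1.2⟩, fun t ht => by
      change φ (p t) = y
      rw [GenLoop.boundary p t ht, hx]⟩ : GenLoop N Y y))
    (by
      rintro p q ⟨H⟩
      refine ⟨⟨⟨⟨fun z => φ (H z), hφ.comp H.continuous⟩, ?_, ?_⟩, ?_⟩⟩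
      · intro t; exact congrArg φ (H.map_zero_left t)
      · intro t; exact congrArg φ (H.map_one_left t)
      · intro t z hz; exact congrArg φ (H.eq_fst t hz))) (by
    intro a b
    obtain ⟨f, hf, hf', rfl⟩ := piMk_surj a
    obtain ⟨g, hg, hg', rfl⟩ := piMk_surj b
    let i : N := Classical.arbitrary N
    obtain ⟨h1, h2, h3⟩ := piMk_mul' i hf hf' hg hg'
    rw [h3]
    have k1 : ∀ z ∈ Cube.boundary N, φ (f z) = y := fun z hz => by rw [hf' z hz, hx]
    have k2 : ∀ z ∈ Cube.boundary N, φ (g z) = y := fun z hz => by rw [hg' z hz, hx]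
    obtain ⟨h1', h2', h3'⟩ := piMk_mul' i (hφ.comp hf) k1 (hφ.comp hg) k2
    refine Eq.trans ?_ h3'.symm
    unfold piMk
    simp only [Quotient.map_mk]
    congr 2
    congr 1
    funext t
    change φ (ite _ _ _) = _
    split_ifs <;> rfl)

theorem piMap_mk {Y : Type*} [TopologicalSpace Y] {y : Y} [Nonempty N] (φ : X → Y) (hφ : Continuous φ) (hx : φ x = y)
    {f : (I^N) → X} {hf hf'} : piMap φ hφ hx (piMk f hf hf') = piMk (fun t => φ (f t)) (hφ.comp hf)
      (fun t ht => by rw [hf' t ht, hx]) := rfl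

end HG

section CL
set_option linter.unusedSectionVars false

/-- Punctured vector space `ℝ × E`. -/
abbrev WW (E : Type*) [NormedAddCommGroup E] : Type _ := {y : ℝ × E // y ≠ 0}

/-- The base point. -/
def wb (E : Type*) [NormedAddCommGroup E] : WW E := ⟨(1, 0), by simp⟩

variable {E : Type*} [NormedAddCommGroup E] [NormedSpace ℝ E]

/-- The (closed) negative ray. -/
def Neg0 (y : ℝ × E) : Prop := y.2 = 0 ∧ y.1 ≤ 0

/-- auxiliary weight of the collapse map -/
def kapM (R : ℝ) (y : ℝ × E) : ℝ := max 0 (-y.1 - R * ‖y.2‖) / (|y.1| + R * ‖y.2‖)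

/-- The collapse map: everything away from a cone around the negative ray goes to the base point. -/
def kap (R : ℝ) (y : ℝ × E) : ℝ × E := (1 - 2 * kapM R y, kapM R y • y.2)

theorem kap_den {R : ℝ} (hR : 0 < R) {y : ℝ × E} (hy : y ≠ 0) : 0 < |y.1| + R * ‖y.2‖ := by
  by_cases h : y.1 = 0
  · have : y.2 ≠ 0 := fun h2 => hy (Prod.ext h h2)
    have := norm_pos_iff.mpr this
    positivity
  · have := abs_pos.mpr h
    positivity

theorem kap_snd_zero {R : ℝ} {y : ℝ × E} (hy : y ≠ 0) (h : y.2 = 0) :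
    kap R y = (SignType.sign y.1 : ℝ) • ((1, 0) : ℝ × E) := by
  have h1 : y.1 ≠ 0 := fun h1 => hy (Prod.ext h1 h)
  unfold kap kapM
  rw [h]
  rcases lt_or_gt_of_ne h1 with h1 | h1
  · have : max 0 (-y.1) = -y.1 := max_eq_right (by linarith)
    simp only [norm_zero, mul_zero, sub_zero, add_zero, this, abs_of_neg h1]
    rw [div_self (by linarith)]
    simp [sign_neg h1]
    norm_num
  · have : max 0 (-y.1) = 0 := max_eq_left (by linarith)
    simp only [norm_zero, mul_zero, sub_zero, add_zero, this, abs_of_pos h1]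
    simp [sign_pos h1]

theorem kap_eq_base {R : ℝ} {y : ℝ × E} (h : -y.1 ≤ R * ‖y.2‖) : kap R y = (1, 0) := by
  unfold kap kapM
  rw [max_eq_left (by linarith)]
  simp

theorem kap_ne_zero {R : ℝ} {y : ℝ × E} (hy : y ≠ 0) : kap R y ≠ 0 := by
  by_cases h : y.2 = 0
  · rw [kap_snd_zero hy h]
    have h1 : y.1 ≠ 0 := fun h1 => hy (Prod.ext h1 h)
    rcases lt_or_gt_of_ne h1 with h1 | h1
    · simp [sign_neg h1]
    · simp [sign_pos h1]
  · intro hk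
    unfold kap at hk
    have h1 := congrArg Prod.fst hk
    have h2 := congrArg Prod.snd hk
    simp only [Prod.fst_zero, Prod.snd_zero, smul_eq_zero, h, or_false] at h1 h2
    rw [h2] at h1
    norm_num at h1

theorem kap_line_ne_zero {R : ℝ} {y : ℝ × E} (hR : 0 < R) (hy : y ≠ 0) (t : ℝ) (h0 : 0 ≤ t) (h1 : t ≤ 1) :
    (1 - t) • y + t • kap R y ≠ 0 := by
  by_cases h : y.2 = 0
  · rw [kap_snd_zero hy h]
    have h1 : y.1 ≠ 0 := fun h1 => hy (Prod.ext h1 h)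
    intro hk
    have := congrArg Prod.fst hk
    simp at this
    rcases lt_or_gt_of_ne h1 with h1 | h1
    · simp [sign_neg h1] at this
      have e1 : 0 ≤ (1 - t) * (-y.1) := mul_nonneg (by linarith) (by linarith)
      have e2 : t = 0 := by linarith
      rw [e2] at this
      simp at this
      linarith
    · simp [sign_pos h1] at this
      have e1 : 0 ≤ (1 - t) * (y.1) := mul_nonneg (by linarith) (by linarith)
      have e2 : t = 0 := by linarith
      rw [e2] at this
      simp at this
      linarith
  · rcases eq_or_lt_of_le h1 with rfl | h1
    · simpa using kap_ne_zero hy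
    intro hk
    have := congrArg Prod.snd hk
    simp only [kap, Prod.snd_add, Prod.smul_snd, Prod.snd_zero, smul_smul, ← add_smul] at this
    have hm : 0 ≤ kapM R y := div_nonneg (le_max_left _ _) (kap_den hR hy).le
    rcases smul_eq_zero.mp this with h3 | h3
    · nlinarith [mul_nonneg h0 hm]
    · exact h h3

theorem continuous_kap {Z : Type*} [TopologicalSpace Z] {r : Z → ℝ} {f : Z → ℝ × E}
    (hr : Continuous r) (hf : Continuous f) (hr0 : ∀ z, 0 < r z) (hf0 : ∀ z, f z ≠ 0) :
    Continuous fun z => kap (r z) (f z) := by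
  have : Continuous fun z => kapM (r z) (f z) := by
    unfold kapM
    apply Continuous.div
    · fun_prop
    · fun_prop
    · intro z; exact (kap_den (hr0 z) (hf0 z)).ne'
  unfold kap
  fun_prop

variable {N : Type*}

/-- Admissible maps from the cube. -/
structure Adm (f : (I^N) → ℝ × E) : Prop where
  cont : Continuous f
  ne : ∀ x, f x ≠ 0
  bd : ∀ x ∈ Cube.boundary N, ¬ Neg0 (f x)

/-- `R` is large enough for `f`. -/
def RGood (f : (I^N) → ℝ × E) (R : ℝ) : Prop :=
  0 < R ∧ ∀ x ∈ Cube.boundary N, -(f x).1 ≤ R * ‖(f x).2‖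

theorem exists_R {Z : Type*} [TopologicalSpace Z] {K : Set Z} (hK : IsCompact K)
    {f : Z → ℝ × E} (hf : Continuous f) (h : ∀ z ∈ K, ¬ Neg0 (f z)) :
    ∃ R, 0 < R ∧ ∀ z ∈ K, -(f z).1 ≤ R * ‖(f z).2‖ := by
  rcases K.eq_empty_or_nonempty with rfl | hne
  · exact ⟨1, one_pos, by simp⟩
  have hc : Continuous fun z => ‖(f z).2‖ + max (f z).1 0 := by fun_prop
  obtain ⟨z0, hz0, hmin⟩ := hK.exists_isMinOn hne hc.continuousOn
  have hc2 : Continuous fun z => |(f z).1| := by fun_prop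
  obtain ⟨z1, hz1, hmax⟩ := hK.exists_isMaxOn hne hc2.continuousOn
  set ε := ‖(f z0).2‖ + max (f z0).1 0 with hε
  have hpos : 0 < ε := by
    by_contra hcon
    have a1 := norm_nonneg (f z0).2
    have a2 := le_max_right (f z0).1 0
    have a3 := le_max_left (f z0).1 0
    refine h z0 hz0 ⟨norm_eq_zero.mp (by linarith), by linarith⟩
  refine ⟨(|(f z1).1| + 1) / ε, by positivity, fun z hz => ?_⟩
  have b1 : ε ≤ ‖(f z).2‖ + max (f z).1 0 := hmin hz
  have b2 : |(f z).1| ≤ |(f z1).1| := hmax hz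
  by_cases h0 : 0 ≤ (f z).1
  · have : 0 ≤ (|(f z1).1| + 1) / ε * ‖(f z).2‖ := by positivity
    linarith
  · rw [max_eq_right (by linarith), add_zero] at b1
    rw [div_mul_eq_mul_div, le_div_iff₀ hpos]
    have b3 := neg_abs_le (f z).1
    nlinarith [abs_nonneg (f z1).1, norm_nonneg (f z).2, abs_nonneg (f z).1]

theorem isCompact_boundary [Finite N] : IsCompact (Cube.boundary N) := by
  apply IsClosed.isCompact
  have : Cube.boundary N = ⋃ i, ({y | y i = 0} ∪ {y | y i = 1}) := by
    ext y; simp [Cube.boundary]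
  rw [this]
  apply isClosed_iUnion_of_finite
  intro i
  apply IsClosed.union
  · exact isClosed_eq (continuous_apply i) continuous_const
  · exact isClosed_eq (continuous_apply i) continuous_const

theorem Adm.exists_RGood [Finite N] {f : (I^N) → ℝ × E} (h : Adm f) : ∃ R, RGood f R :=
  exists_R isCompact_boundary h.cont h.bd

/-- The collapsed loop. -/
def kapLoop (R : ℝ) (f : (I^N) → ℝ × E) (h : Adm f) (x : I^N) : WW E :=
  ⟨kap R (f x), kap_ne_zero (h.ne x)⟩

theorem continuous_kapLoop {R : ℝ} {f : (I^N) → ℝ × E} {h : Adm f} (hR : 0 < R) :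
    Continuous (kapLoop R f h) :=
  Continuous.subtype_mk (continuous_kap continuous_const h.cont (fun _ => hR) h.ne) _

theorem kapLoop_bd {R : ℝ} {f : (I^N) → ℝ × E} {h : Adm f} (hR : RGood f R) :
    ∀ x ∈ Cube.boundary N, kapLoop R f h x = wb E := by
  intro x hx
  exact Subtype.ext (kap_eq_base (hR.2 x hx))

open Classical in
/-- The class in `π_N (ℝ × E \ 0)` of an admissible map. -/
def cl [Finite N] [Nonempty N] [DecidableEq N] (f : (I^N) → ℝ × E) : HomotopyGroup N (WW E) (wb E) :=
  if h : Adm f then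
    piMk (kapLoop h.exists_RGood.choose f h) (continuous_kapLoop h.exists_RGood.choose_spec.1)
      (kapLoop_bd h.exists_RGood.choose_spec)
  else 1

variable [Finite N] [Nonempty N] [DecidableEq N]

theorem cl_eq {f : (I^N) → ℝ × E} (h : Adm f) {R : ℝ} (hR : RGood f R) :
    cl f = piMk (kapLoop R f h) (continuous_kapLoop hR.1) (kapLoop_bd hR) := by
  unfold cl
  rw [dif_pos h]
  set R' := h.exists_RGood.choose
  have hR' : RGood f R' := h.exists_RGood.choose_spec
  have hpos : ∀ t : I, 0 < (1 - (t : ℝ)) * R' + t * R := by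
    intro t
    rcases eq_or_lt_of_le t.2.1 with h0 | h0
    · rw [← h0]; simpa using hR'.1
    · have := mul_pos h0 hR.1
      have := mul_nonneg (sub_nonneg.mpr t.2.2) hR'.1.le
      linarith
  refine piMk_eq (fun z => ⟨kap ((1 - (z.1 : ℝ)) * R' + z.1 * R) (f z.2), kap_ne_zero (h.ne _)⟩) ?_ ?_ ?_ ?_
  · apply Continuous.subtype_mk
    refine continuous_kap (by fun_prop) (h.cont.comp continuous_snd) ?_ ?_
    · intro z; exact hpos z.1
    · intro z; exact h.ne _
  · intro y; apply Subtype.ext; simp [kapLoop, R']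
  · intro y; apply Subtype.ext; simp [kapLoop]
  · intro t y hy
    apply Subtype.ext
    apply kap_eq_base
    have a1 := hR.2 y hy
    have a2 := hR'.2 y hy
    have := t.2.1
    have := t.2.2
    simp only
    nlinarith [mul_le_mul_of_nonneg_left a1 t.2.1, mul_le_mul_of_nonneg_left a2 (sub_nonneg.mpr t.2.2)]

theorem cl_homotopy (H : I × (I^N) → ℝ × E) (hc : Continuous H) (hne : ∀ z, H z ≠ 0)
    (hb : ∀ t, ∀ y ∈ Cube.boundary N, ¬ Neg0 (H (t, y))) :
    cl (fun y => H (0, y)) = cl (fun y => H (1, y)) := by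
  obtain ⟨R, hR0, hR⟩ := exists_R (K := Set.univ ×ˢ Cube.boundary N)
    (isCompact_univ.prod isCompact_boundary) hc (by rintro ⟨t, y⟩ ⟨-, hy⟩; exact hb t y hy)
  have hA : ∀ t, Adm (fun y => H (t, y)) := fun t =>
    ⟨by fun_prop, fun y => hne _, fun y hy => hb t y hy⟩
  have hRG : ∀ t, RGood (fun y => H (t, y)) R := fun t => ⟨hR0, fun y hy => hR (t, y) ⟨trivial, hy⟩⟩
  rw [cl_eq (hA 0) (hRG 0), cl_eq (hA 1) (hRG 1)]
  refine piMk_eq (fun z => ⟨kap R (H z), kap_ne_zero (hne _)⟩) ?_ ?_ ?_ ?_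
  · apply Continuous.subtype_mk
    exact continuous_kap continuous_const hc (fun _ => hR0) hne
  · intro y; rfl
  · intro y; rfl
  · intro t y hy
    apply Subtype.ext
    exact kap_eq_base (hR (t, y) ⟨trivial, hy⟩)

/-- homotopy lemma in a more convenient form -/
theorem cl_homotopy' {f g : (I^N) → ℝ × E} (H : ℝ → (I^N) → ℝ × E)
    (hc : Continuous fun z : I × (I^N) => H z.1 z.2) (h0 : ∀ y, H 0 y = f y) (h1 : ∀ y, H 1 y = g y)
    (hne : ∀ t ∈ I, ∀ y, H t y ≠ 0)
    (hb : ∀ t ∈ I, ∀ y ∈ Cube.boundary N, ¬ Neg0 (H t y)) : cl f = cl g := by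
  have := cl_homotopy (fun z : I × (I^N) => H z.1 z.2) hc (fun z => hne _ z.1.2 _)
    (fun t y hy => hb _ t.2 _ hy)
  simp only [Set.Icc.coe_zero, Set.Icc.coe_one] at this
  rw [show f = H 0 from (funext h0).symm, show g = H 1 from (funext h1).symm]
  exact this

theorem cl_of_loop {f : (I^N) → WW E} (hf hf') :
    piMk (x := wb E) f hf hf' = cl (fun y => (f y : ℝ × E)) := by
  have hA : Adm (fun y => (f y : ℝ × E)) := ⟨by fun_prop, fun y => (f y).2, fun y hy => by
    rw [hf' y hy]; simp [Neg0, wb]⟩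
  have hG : RGood (fun y => (f y : ℝ × E)) 1 := ⟨one_pos, fun y hy => by
    simp only [hf' y hy]; simp [wb]⟩
  rw [cl_eq hA hG]
  refine piMk_eq (fun z => ⟨(1 - (z.1 : ℝ)) • (f z.2 : ℝ × E) + (z.1 : ℝ) • kap 1 (f z.2 : ℝ × E),
    kap_line_ne_zero one_pos (f z.2).2 _ z.1.2.1 z.1.2.2⟩) ?_ ?_ ?_ ?_
  · apply Continuous.subtype_mk
    have := continuous_kap (E := E) (Z := I × (I^N)) (r := fun _ => 1) (f := fun z => (f z.2 : ℝ × E)) 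
      continuous_const (by fun_prop) (fun _ => one_pos) (fun z => (f z.2).2)
    fun_prop
  · intro y; apply Subtype.ext; simp
  · intro y; apply Subtype.ext; simp [kapLoop]
  · intro t y hy
    apply Subtype.ext
    simp only
    rw [hf' y hy, kap_eq_base (by simp [wb])]
    simp [wb]

theorem cl_one {f : (I^N) → ℝ × E} (hc : Continuous f) (h : ∀ y, ¬ Neg0 (f y)) : cl f = 1 := by
  obtain ⟨R, hR0, hR⟩ := exists_R (K := Set.univ) isCompact_univ hc (fun y _ => h y)
  have hA : Adm f := ⟨hc, fun y hy => h y (by rw [hy]; simp [Neg0]), fun y _ => h y⟩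
  rw [cl_eq hA ⟨hR0, fun y _ => hR y trivial⟩, piMk_one]
  congr 1
  funext y
  exact Subtype.ext (kap_eq_base (hR y trivial))

theorem cl_reflect (i : N) {f : (I^N) → ℝ × E} (hf : Adm f) :
    cl (fun t ↦ f fun j ↦ if j = i then σ (t i) else t j) = (cl f)⁻¹ := by
  obtain ⟨R, hR⟩ := hf.exists_RGood
  have hcon : Continuous fun (t : I^N) (j : N) => if j = i then σ (t i) else t j := by
    refine continuous_pi fun j => ?_
    split_ifs <;> fun_prop
  have hbd : ∀ t ∈ Cube.boundary N, (fun j => if j = i then σ (t i) else t j) ∈ Cube.boundary N := by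
    rintro t ⟨j, hj⟩
    refine ⟨j, ?_⟩
    by_cases hji : j = i
    · subst hji; simpa [or_comm] using hj
    · simpa [hji] using hj
  have hA : Adm (fun t ↦ f fun j ↦ if j = i then σ (t i) else t j) :=
    ⟨hf.cont.comp hcon, fun t => hf.ne _, fun t ht => hf.bd _ (hbd t ht)⟩
  have hG : RGood (fun t ↦ f fun j ↦ if j = i then σ (t i) else t j) R := ⟨hR.1, fun t ht => hR.2 _ (hbd t ht)⟩
  rw [cl_eq hf hR, cl_eq hA hG, piMk_inv i]
  rfl

end CL

section SPLIT
set_option linter.unusedSectionVars false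

/-- projection to the unit interval -/
def prI (r : ℝ) : I := Set.projIcc 0 1 zero_le_one r

theorem continuous_prI : Continuous prI := continuous_projIcc (h := zero_le_one)

theorem prI_coe {r : ℝ} (h0 : 0 ≤ r) (h1 : r ≤ 1) : (prI r : ℝ) = r := by
  unfold prI
  rw [Set.projIcc_of_mem zero_le_one ⟨h0, h1⟩]

theorem prI_of_coe (t : I) : prI t = t := by
  unfold prI; simp

theorem prI_zero : prI 0 = 0 := Subtype.ext (prI_coe le_rfl zero_le_one)
theorem prI_one : prI 1 = 1 := Subtype.ext (prI_coe zero_le_one le_rfl)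

variable {E : Type*} [NormedAddCommGroup E] [NormedSpace ℝ E]
variable {N : Type*} [Finite N] [Nonempty N] [DecidableEq N]

theorem update_boundary {t : I^N} (i : N) {r : I} (hr : r = 0 ∨ r = 1) :
    Function.update t i r ∈ Cube.boundary N := ⟨i, by simpa using hr⟩

theorem update_boundary' {t : I^N} (ht : t ∈ Cube.boundary N) (i : N) {r : I} (h0 : t i = 0 → r = 0 ∨ r = 1)
    (h1 : t i = 1 → r = 0 ∨ r = 1) :
    Function.update t i r ∈ Cube.boundary N := by
  obtain ⟨j, hj⟩ := ht
  by_cases hji : j = i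
  · subst hji
    apply update_boundary
    tauto
  · exact ⟨j, by simpa [hji] using hj⟩

theorem cl_split (i : N) {s : ℝ} (hs0 : 0 < s) (hs1 : s < 1) {f : (I^N) → ℝ × E} (hf : Adm f)
    (hfs : ∀ t, (t i : ℝ) = s → ¬ Neg0 (f t)) :
    cl f = cl (fun t => f (Function.update t i (prI (s + (1 - s) * t i)))) *
      cl (fun t => f (Function.update t i (prI (s * t i)))) := by
  have hcp := continuous_prI
  set f1 := fun t => f (Function.update t i (prI (s * t i))) with hf1
  set f2 := fun t => f (Function.update t i (prI (s + (1 - s) * t i))) with hf2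
  have hcs : IsClosed {t : I^N | (t i : ℝ) = s} := isClosed_eq (by fun_prop) continuous_const
  obtain ⟨R, hR0, hR⟩ := exists_R (K := Cube.boundary N ∪ {t | (t i : ℝ) = s})
    (isCompact_boundary.union hcs.isCompact) hf.cont (by
      rintro t (ht | ht)
      · exact hf.bd t ht
      · exact hfs t ht)
  have key1 : ∀ t ∈ Cube.boundary N, Function.update t i (prI (s * t i)) ∈ Cube.boundary N ∪ {t | (t i : ℝ) = s} := by
    intro t ht
    by_cases h1 : t i = 1
    · right
      simp only [h1, Set.mem_ofPred_eq, Function.update_self, Set.Icc.coe_one, mul_one]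
      exact prI_coe hs0.le hs1.le
    · left
      apply update_boundary' ht
      · intro h; simp [h, prI_zero]
      · intro h; exact absurd h h1
  have key2 : ∀ t ∈ Cube.boundary N, Function.update t i (prI (s + (1 - s) * t i)) ∈ Cube.boundary N ∪ {t | (t i : ℝ) = s} := by
    intro t ht
    by_cases h1 : t i = 0
    · right
      simp only [h1, Set.mem_ofPred_eq, Function.update_self, Set.Icc.coe_zero, mul_zero, add_zero]
      exact prI_coe hs0.le hs1.le
    · left
      apply update_boundary' ht
      · intro h; exact absurd h h1
      · intro h; simp [h, prI_one]
  have hneg : ∀ t ∈ Cube.boundary N ∪ {t : I^N | (t i : ℝ) = s}, ¬ Neg0 (f t) := by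
    rintro t (ht | ht)
    · exact hf.bd t ht
    · exact hfs t ht
  have hA1 : Adm f1 := ⟨hf.cont.comp (by fun_prop), fun _ => hf.ne _, fun t ht => hneg _ (key1 t ht)⟩
  have hA2 : Adm f2 := ⟨hf.cont.comp (by fun_prop), fun _ => hf.ne _, fun t ht => hneg _ (key2 t ht)⟩
  have hG : RGood f R := ⟨hR0, fun t ht => hR t (Or.inl ht)⟩
  have hG1 : RGood f1 R := ⟨hR0, fun t ht => hR _ (key1 t ht)⟩
  have hG2 : RGood f2 R := ⟨hR0, fun t ht => hR _ (key2 t ht)⟩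
  rw [cl_eq hf hG, cl_eq hA1 hG1, cl_eq hA2 hG2]
  obtain ⟨c1, c2, c3⟩ := piMk_mul' i (continuous_kapLoop (h := hA2) hG2.1) (kapLoop_bd hG2)
    (continuous_kapLoop (h := hA1) hG1.1) (kapLoop_bd hG1)
  rw [c3]
  symm
  -- reparametrisation
  let θ : ℝ → ℝ := fun r => min (2 * s * r) s + max 0 ((1 - s) * (2 * r - 1))
  have hθ : Continuous θ := by fun_prop
  have hθ1 : ∀ r, r ≤ 1/2 → θ r = 2 * s * r := by
    intro r hr
    simp only [θ]
    rw [min_eq_left (by nlinarith), max_eq_left (by nlinarith), add_zero]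
  have hθ2 : ∀ r, 1/2 ≤ r → θ r = s + (1 - s) * (2 * r - 1) := by
    intro r hr
    simp only [θ]
    rw [min_eq_right (by nlinarith), max_eq_right]
    apply mul_nonneg <;> linarith
  refine piMk_eq (fun z => kapLoop R f hf (Function.update z.2 i (prI ((1 - (z.1 : ℝ)) * θ (z.2 i) + z.1 * z.2 i)))) ?_ ?_ ?_ ?_
  · exact (continuous_kapLoop hR0).comp (by fun_prop)
  · intro t
    simp only [Set.Icc.coe_zero, sub_zero, one_mul, zero_mul, add_zero]
    have ht0 := (t i).2.1
    have ht1 := (t i).2.2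
    split_ifs with h
    · rw [hθ1 _ h]
      apply Subtype.ext
      simp only [kapLoop, hf1, Function.update_idem, Function.update_self]
      congr 4
      change _ = s * ((prI (2 * t i) : I) : ℝ)
      rw [prI_coe (by linarith) (by linarith)]
      ring
    · rw [hθ2 _ (by linarith)]
      apply Subtype.ext
      simp only [kapLoop, hf2, Function.update_idem, Function.update_self]
      congr 5
      change _ = (1 - s) * ((prI (2 * t i - 1) : I) : ℝ)
      rw [prI_coe (by linarith) (by linarith)]
  · intro t
    simp [prI_of_coe]
  · intro τ t ht
    apply kapLoop_bd hG
    apply update_boundary' ht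
    · intro h
      left
      simp only [h, Set.Icc.coe_zero, hθ1 0 (by norm_num), mul_zero, add_zero, prI_zero]
    · intro h
      right
      simp only [h, Set.Icc.coe_one, hθ2 1 (by norm_num)]
      rw [← prI_one]
      congr 1
      ring

end SPLIT

section SMOOTH
open scoped ContDiff

variable {K : Type*} [TopologicalSpace K] [CompactSpace K]
variable {D : Type*} [NormedAddCommGroup D] [NormedSpace ℝ D]
variable {V : Type*} [NormedAddCommGroup V] [NormedSpace ℝ V]

/-- The algebra of restrictions of smooth functions -/
def smoothAlg (ι : C(K, D)) : Subalgebra ℝ C(K, ℝ) where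
  carrier := {f | ∃ P : D → ℝ, ContDiff ℝ ∞ P ∧ ∀ x, f x = P (ι x)}
  mul_mem' := by
    rintro f g ⟨P, hP, h⟩ ⟨Q, hQ, h'⟩
    exact ⟨fun y => P y * Q y, hP.mul hQ, fun x => by simp [h, h']⟩
  add_mem' := by
    rintro f g ⟨P, hP, h⟩ ⟨Q, hQ, h'⟩
    exact ⟨fun y => P y + Q y, hP.add hQ, fun x => by simp [h, h']⟩
  algebraMap_mem' := by
    intro r
    exact ⟨fun _ => r, contDiff_const, fun x => by simp⟩

theorem smooth_approx_real (ι : C(K, D)) (hι : Function.Injective ι) {f : K → ℝ} (hf : Continuous f)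
    {ε : ℝ} (hε : 0 < ε) : ∃ P : D → ℝ, ContDiff ℝ ∞ P ∧ ∀ x, ‖P (ι x) - f x‖ < ε := by
  obtain ⟨⟨g, P, hP, hg⟩, h⟩ := ContinuousMap.exists_mem_subalgebra_near_continuous_of_separatesPoints
    (smoothAlg ι) (by
      intro x y hxy
      obtain ⟨l, hl⟩ := SeparatingDual.exists_separating_of_ne (R := ℝ) (hι.ne hxy)
      refine ⟨fun z => l (ι z), ⟨⟨fun z => l (ι z), by fun_prop⟩, ⟨l, l.contDiff, fun z => rfl⟩, rfl⟩, hl⟩) f hf ε hε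
  refine ⟨P, hP, fun x => ?_⟩
  rw [← hg]
  exact h x

theorem smooth_approx [FiniteDimensional ℝ V] (ι : C(K, D)) (hι : Function.Injective ι) {f : K → V} (hf : Continuous f)
    {ε : ℝ} (hε : 0 < ε) : ∃ P : D → V, ContDiff ℝ ∞ P ∧ ∀ x, ‖P (ι x) - f x‖ < ε := by
  let n := Module.finrank ℝ V
  let e : V ≃L[ℝ] (Fin n → ℝ) := ContinuousLinearEquiv.ofFinrankEq (by simp [n])
  let C := ‖(e.symm : (Fin n → ℝ) →L[ℝ] V)‖ + 1
  have hC : 0 < C := by positivity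
  choose P hP h using fun i => smooth_approx_real ι hι (f := fun x => e (f x) i)
    (by fun_prop) (div_pos hε hC)
  refine ⟨fun y => e.symm (fun i => P i y), e.symm.contDiff.comp (contDiff_pi.2 hP), fun x => ?_⟩
  have h1 : ‖(fun i => P i (ι x)) - e (f x)‖ < ε / C := by
    rw [pi_norm_lt_iff (div_pos hε hC)]
    intro i
    exact h i x
  calc ‖e.symm (fun i => P i (ι x)) - f x‖ = ‖e.symm ((fun i => P i (ι x)) - e (f x))‖ := by simp
    _ ≤ ‖(e.symm : (Fin n → ℝ) →L[ℝ] V)‖ * ‖(fun i => P i (ι x)) - e (f x)‖ :=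
      (e.symm : (Fin n → ℝ) →L[ℝ] V).le_opNorm _
    _ ≤ C * ‖(fun i => P i (ι x)) - e (f x)‖ := by gcongr; simp [C]
    _ < C * (ε / C) := by gcongr
    _ = ε := by field_simp

/-- General position: avoid a ray -/
theorem general_position [FiniteDimensional ℝ D] [FiniteDimensional ℝ V]
    (hdim : Module.finrank ℝ D + 1 < Module.finrank ℝ V)
    (ι : C(K, D)) (hι : Function.Injective ι) {f : K → V} (hf : Continuous f) {b : V} (hb : b ≠ 0)
    {ε : ℝ} (hε : 0 < ε) : ∃ f' : K → V, Continuous f' ∧ (∀ x, ‖f' x - f x‖ < ε) ∧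
      (∀ x, f x = b → f' x = b) ∧ ∀ x, ∀ t : ℝ, 0 ≤ t → f' x ≠ -(t • b) := by
  have hb' := norm_pos_iff.2 hb
  -- near b we are safe
  set η := min ε (‖b‖ / 2) with hη
  have hη0 : 0 < η := lt_min hε (by positivity)
  obtain ⟨P, hP, hPf⟩ := smooth_approx ι hι hf (half_pos hη0)
  let G : D × ℝ → V := fun z => -(z.2 • b) - P z.1
  have hG : ContDiff ℝ 1 G := by
    have := hP.of_le (m := 1) (by exact_mod_cast le_top)
    fun_prop
  have hd := hG.dense_compl_range_of_finrank_lt_finrank (by simpa using hdim)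
  obtain ⟨c, hc, hc'⟩ := hd.exists_dist_lt 0 (half_pos hη0)
  rw [dist_comm, dist_zero_right] at hc'
  have hav : ∀ x, ∀ t : ℝ, P (ι x) + c ≠ -(t • b) := by
    intro x t h
    apply hc
    refine ⟨(ι x, t), ?_⟩
    simp only [G]
    rw [← h]; abel
  have hnear : ∀ x, ‖P (ι x) + c - f x‖ < η := by
    intro x
    calc ‖P (ι x) + c - f x‖ = ‖(P (ι x) - f x) + c‖ := by congr 1; abel
      _ ≤ ‖P (ι x) - f x‖ + ‖c‖ := norm_add_le _ _
      _ < η := by linarith [hPf x]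
  let χ : K → ℝ := fun x => min 1 ((2 / ‖b‖) * ‖f x - b‖)
  have hχc : Continuous χ := by fun_prop
  have hχ0 : ∀ x, 0 ≤ χ x := fun x => le_min zero_le_one (by positivity)
  have hχ1 : ∀ x, χ x ≤ 1 := fun x => min_le_left _ _
  have hPc : Continuous P := hP.continuous
  have hform : ∀ x, (f x + χ x • (P (ι x) + c - f x)) - f x = χ x • (P (ι x) + c - f x) := by
    intro x; abel
  have hsm : ∀ x, ‖χ x • (P (ι x) + c - f x)‖ < η := by
    intro x
    rw [norm_smul, Real.norm_of_nonneg (hχ0 x)]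
    calc χ x * ‖P (ι x) + c - f x‖ ≤ 1 * ‖P (ι x) + c - f x‖ := by gcongr; exact hχ1 x
      _ < η := by rw [one_mul]; exact hnear x
  refine ⟨fun x => f x + χ x • (P (ι x) + c - f x), by fun_prop, fun x => ?_, fun x hx => ?_, fun x t ht h => ?_⟩
  · rw [hform]
    exact (hsm x).trans_le (min_le_left _ _)
  · simp [χ, hx]
  · by_cases h1 : χ x = 1
    · simp only [h1, one_smul] at h
      apply hav x t
      rw [← h]; abel
    · have hlt : (2 / ‖b‖) * ‖f x - b‖ < 1 := by
        by_contra hcon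
        exact h1 (min_eq_left (not_lt.1 hcon))
      have hlt' : ‖f x - b‖ < ‖b‖ / 2 := by
        rw [div_mul_eq_mul_div, div_lt_one hb'] at hlt
        linarith
      have h2 : b + t • b = -((f x - b) + χ x • (P (ι x) + c - f x)) := by
        have : t • b = -(f x + χ x • (P (ι x) + c - f x)) := by
          rw [show f x + χ x • (P (ι x) + c - f x) = -(t • b) from h]; simp
        rw [this]; abel
      have h3 : ‖b + t • b‖ = (1 + t) * ‖b‖ := by
        have : b + t • b = (1 + t) • b := by rw [add_smul, one_smul]
        rw [this, norm_smul, Real.norm_of_nonneg (by linarith)]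
      have h4 := norm_add_le (f x - b) (χ x • (P (ι x) + c - f x))
      rw [← norm_neg, ← h2, h3] at h4
      have h5 := hsm x
      have h6 : η ≤ ‖b‖ / 2 := min_le_right _ _
      nlinarith
end SMOOTH

section LINEAR
set_option linter.unusedSectionVars false
open Matrix

variable {N : Type*} [Fintype N] [Nonempty N] [DecidableEq N]

/-- centered coordinates -/
def ctr (x : I^N) : N → ℝ := fun i => (x i : ℝ) - 1 / 2

theorem continuous_ctr : Continuous (ctr : (I^N) → N → ℝ) := by
  unfold ctr; fun_prop

theorem ctr_ne {x : I^N} (hx : x ∈ Cube.boundary N) : ctr x ≠ 0 := by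
  obtain ⟨i, hi⟩ := hx
  intro h
  have := congrFun h i
  rcases hi with hi | hi <;> simp [ctr, hi] at this
  norm_num at this

/-- the linear model maps -/
def linF (B : Matrix N N ℝ) (x : I^N) : ℝ × (N → ℝ) := (-1, B *ᵥ ctr x)

theorem linF_bd {B : Matrix N N ℝ} (hB : B.det ≠ 0) {x : I^N} (hx : x ∈ Cube.boundary N) : ¬ Neg0 (linF B x) := by
  rintro ⟨h, -⟩
  exact ctr_ne hx (Matrix.eq_zero_of_mulVec_eq_zero hB h)

theorem linF_ne (B : Matrix N N ℝ) (x : I^N) : linF B x ≠ 0 := by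
  intro h
  have := congrArg Prod.fst h
  simp [linF] at this

theorem linF_adm {B : Matrix N N ℝ} (hB : B.det ≠ 0) : Adm (linF B) :=
  ⟨by unfold linF; have := continuous_ctr (N := N); fun_prop, linF_ne B, fun _ hx => linF_bd hB hx⟩

theorem linF_path (C : ℝ → Matrix N N ℝ) (hC : Continuous C) (hd : ∀ t ∈ I, (C t).det ≠ 0) :
    cl (linF (C 0)) = cl (linF (C 1)) := by
  refine cl_homotopy' (fun t => linF (C t)) ?_ (fun _ => rfl) (fun _ => rfl) (fun t _ y => linF_ne _ y)
    (fun t ht y hy => linF_bd (hd t ht) hy)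
  unfold linF
  have := continuous_ctr (N := N)
  fun_prop

theorem linF_reflect (B : Matrix N N ℝ) (hB : B.det ≠ 0) (i : N) :
    cl (linF (B * diagonal (Function.update 1 i (-1)))) = (cl (linF B))⁻¹ := by
  rw [← cl_reflect i (linF_adm hB)]
  congr 1
  funext x
  unfold linF
  rw [← mulVec_mulVec]
  congr 2
  funext j
  rw [mulVec_diagonal]
  unfold ctr
  by_cases h : j = i
  · subst h; simp; ring
  · simp [h]

theorem linF_diag1 (B : Matrix N N ℝ) (hB : B.det ≠ 0) (i : N) (d : ℝ) (hd : d ≠ 0) :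
    cl (linF (B * diagonal (Function.update 1 i d))) = cl (linF B) ∨
    cl (linF (B * diagonal (Function.update 1 i d))) = (cl (linF B))⁻¹ := by
  have hdet : ∀ d : ℝ, (diagonal (Function.update (1 : N → ℝ) i d)).det = d := by
    intro d
    rw [det_diagonal, Finset.prod_update_of_mem (Finset.mem_univ i)]
    simp
  rcases lt_or_gt_of_ne hd with h | h
  · right
    rw [← linF_reflect B hB i]
    have := linF_path (fun t => B * diagonal (Function.update 1 i ((1 - t) * d + t * (-1)))) (by fun_prop) (by
      rintro t ⟨ht0, ht1⟩
      rw [det_mul, hdet]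
      refine mul_ne_zero hB (ne_of_lt ?_)
      rcases eq_or_lt_of_le ht1 with rfl | h1
      · norm_num
      · nlinarith)
    simpa using this
  · left
    have := linF_path (fun t => B * diagonal (Function.update 1 i ((1 - t) * d + t * 1))) (by fun_prop) (by
      rintro t ⟨ht0, ht1⟩
      rw [det_mul, hdet]
      refine mul_ne_zero hB (ne_of_gt ?_)
      rcases eq_or_lt_of_le ht1 with rfl | h1
      · norm_num
      · nlinarith)
    have e : Function.update (1 : N → ℝ) i 1 = 1 := by
      conv_lhs => rw [show (1 : ℝ) = (1 : N → ℝ) i from rfl]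
      exact Function.update_eq_self i _
    have e1 : diagonal (1 : N → ℝ) = 1 := diagonal_one
    simpa [e, e1] using this

theorem linF_class (M : Matrix N N ℝ) (hM : M.det ≠ 0) (B : Matrix N N ℝ) (hB : B.det ≠ 0) :
    cl (linF (B * M)) = cl (linF B) ∨ cl (linF (B * M)) = (cl (linF B))⁻¹ := by
  revert B
  refine Matrix.diagonal_transvection_induction_of_det_ne_zero (fun M => ∀ B : Matrix N N ℝ, B.det ≠ 0 →
     (cl (linF (B * M)) = cl (linF B) ∨ cl (linF (B * M)) = (cl (linF B))⁻¹)) M hM ?_ ?_ ?_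
  · intro D hD
    rw [det_diagonal, Finset.prod_ne_zero_iff] at hD
    suffices h : ∀ S : Finset N, ∀ B : Matrix N N ℝ, B.det ≠ 0 →
        (cl (linF (B * diagonal (fun i => if i ∈ S then D i else 1))) = cl (linF B) ∨
         cl (linF (B * diagonal (fun i => if i ∈ S then D i else 1))) = (cl (linF B))⁻¹) by
      simpa using h Finset.univ
    intro S
    induction S using Finset.induction_on with
    | empty =>
      intro B hB; left; simp
    | insert i S hi ih =>
      intro B hB
      have e : diagonal (fun j => if j ∈ insert i S then D j else 1) =
          diagonal (fun j => if j ∈ S then D j else 1) * diagonal (Function.update 1 i (D i)) := by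
        rw [diagonal_mul_diagonal]
        congr 1
        funext j
        by_cases h : j = i
        · subst h; simp [hi]
        · simp [h]
      rw [e, ← mul_assoc]
      have h2 := linF_diag1 (B * diagonal (fun j => if j ∈ S then D j else 1)) (by
        rw [det_mul, det_diagonal]
        refine mul_ne_zero hB (Finset.prod_ne_zero_iff.2 fun j _ => ?_)
        split_ifs
        · exact hD j (Finset.mem_univ j)
        · exact one_ne_zero) i (D i) (hD i (Finset.mem_univ i))
      rcases ih B hB with h | h <;> rw [h] at h2 <;> rcases h2 with h2 | h2 <;> simp [h2]
  · rintro ⟨i, j, hij, c⟩ B hB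
    left
    have := linF_path (fun t => B * transvection i j ((1 - t) * c)) (by
      have h : ∀ r : ℝ, transvection i j r = 1 + r • Matrix.single i j (1 : ℝ) := by
        intro r; simp [transvection, Matrix.smul_single]
      simp only [h]
      fun_prop) (by
      intro t _
      rw [det_mul, det_transvection_of_ne _ _ hij]
      simpa using hB)
    simpa [TransvectionStruct.toMatrix] using this
  · intro A A' hA hA' h h' B hB
    rw [← mul_assoc]
    have h2 := h' (B * A) (by rw [det_mul]; exact mul_ne_zero hB hA)
    rcases h B hB with h | h <;> rw [h] at h2 <;> rcases h2 with h2 | h2 <;> simp [h2]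

/-- the generator -/
def gg : HomotopyGroup N (WW (N → ℝ)) (wb (N → ℝ)) := cl (linF (1 : Matrix N N ℝ))

theorem linF_mem_zpowers (B : Matrix N N ℝ) (hB : B.det ≠ 0) :
    cl (linF B) ∈ Subgroup.zpowers (gg (N := N)) := by
  have := linF_class B hB 1 (by simp)
  rw [one_mul] at this
  rcases this with h | h <;> rw [h]
  · exact Subgroup.mem_zpowers _
  · exact Subgroup.inv_mem _ (Subgroup.mem_zpowers _)
end LINEAR

section CYCLIC
set_option linter.unusedSectionVars false
open Matrix Set

variable {N : Type*} [Fintype N] [Nonempty N] [DecidableEq N]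

/-- affine parametrisation of a box -/
def aff (a b : N → ℝ) (x : I^N) : N → ℝ := fun i => a i + (x i : ℝ) * (b i - a i)

theorem continuous_aff (a b : N → ℝ) : Continuous (aff a b) := by
  unfold aff; fun_prop

theorem aff_mem {a b : N → ℝ} (h : ∀ i, a i < b i) (x : I^N) : aff a b x ∈ Icc a b := by
  constructor <;> intro i <;> have := (x i).2.1 <;> have := (x i).2.2 <;> simp only [aff] <;> nlinarith [h i]

theorem aff_bd {a b : N → ℝ} {x : I^N} (hx : x ∈ Cube.boundary N) :
    ∃ i, aff a b x i = a i ∨ aff a b x i = b i := by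
  obtain ⟨i, hi⟩ := hx
  refine ⟨i, ?_⟩
  rcases hi with hi | hi <;> simp [aff, hi]

/-- good boxes -/
structure Good (f : (N → ℝ) → ℝ × (N → ℝ)) (a b : N → ℝ) : Prop where
  lt : ∀ i, a i < b i
  ne : ∀ y ∈ Icc a b, f y ≠ 0
  bd : ∀ y ∈ Icc a b, (∃ i, y i = a i ∨ y i = b i) → ¬ Neg0 (f y)

theorem Good.adm {f : (N → ℝ) → ℝ × (N → ℝ)} {a b : N → ℝ} (h : Good f a b) (hc : Continuous f) :
    Adm (fun x => f (aff a b x)) :=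
  ⟨hc.comp (continuous_aff a b), fun x => h.ne _ (aff_mem h.lt x), fun x hx => h.bd _ (aff_mem h.lt x) (aff_bd hx)⟩

theorem Good.split {f : (N → ℝ) → ℝ × (N → ℝ)} {a b : N → ℝ} (h : Good f a b) (hc : Continuous f)
    (i : N) (c : ℝ) (hac : a i < c) (hcb : c < b i) (hz : ∀ y ∈ Icc a b, y i = c → ¬ Neg0 (f y)) :
    Good f (Function.update a i c) b ∧ Good f a (Function.update b i c) ∧
    cl (fun x => f (aff a b x)) = cl (fun x => f (aff (Function.update a i c) b x)) *
      cl (fun x => f (aff a (Function.update b i c) x)) := by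
  have hab := h.lt i
  have hle1 : a ≤ Function.update a i c := by
    intro j; by_cases hj : j = i
    · subst hj; simp [hac.le]
    · simp [hj]
  have hle2 : Function.update b i c ≤ b := by
    intro j; by_cases hj : j = i
    · subst hj; simp [hcb.le]
    · simp [hj]
  refine ⟨⟨?_, ?_, ?_⟩, ⟨?_, ?_, ?_⟩, ?_⟩
  · intro j; by_cases hj : j = i
    · subst hj; simp [hcb]
    · simp [hj, h.lt j]
  · intro y hy; exact h.ne y ⟨hle1.trans hy.1, hy.2⟩
  · rintro y hy ⟨j, hj⟩
    have hy' : y ∈ Icc a b := ⟨hle1.trans hy.1, hy.2⟩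
    by_cases hji : j = i
    · subst hji
      rcases hj with hj | hj
      · exact hz y hy' (by simpa using hj)
      · exact h.bd y hy' ⟨j, Or.inr hj⟩
    · exact h.bd y hy' ⟨j, by simpa [hji] using hj⟩
  · intro j; by_cases hj : j = i
    · subst hj; simp [hac]
    · simp [hj, h.lt j]
  · intro y hy; exact h.ne y ⟨hy.1, hy.2.trans hle2⟩
  · rintro y hy ⟨j, hj⟩
    have hy' : y ∈ Icc a b := ⟨hy.1, hy.2.trans hle2⟩
    by_cases hji : j = i
    · subst hji
      rcases hj with hj | hj
      · exact h.bd y hy' ⟨j, Or.inl hj⟩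
      · exact hz y hy' (by simpa using hj)
    · exact h.bd y hy' ⟨j, by simpa [hji] using hj⟩
  · set s := (c - a i) / (b i - a i) with hs
    have hba : 0 < b i - a i := by linarith
    have hs0 : 0 < s := div_pos (by linarith) hba
    have hs1 : s < 1 := (div_lt_one hba).2 (by linarith)
    have hsc : s * (b i - a i) = c - a i := by rw [hs]; field_simp
    rw [cl_split i hs0 hs1 (h.adm hc) (by
      intro t ht
      apply hz _ (aff_mem h.lt t)
      simp only [aff, ht, hsc]; ring)]
    congr 2
    · funext t
      congr 1
      funext j
      by_cases hj : j = i
      · subst hj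
        have := (t j).2.1
        have := (t j).2.2
        simp only [aff, Function.update_self]
        rw [prI_coe (by nlinarith) (by nlinarith)]
        linear_combination (1 - (t j : ℝ)) * hsc
      · simp [aff, hj]
    · funext t
      congr 1
      funext j
      by_cases hj : j = i
      · subst hj
        have := (t j).2.1
        have := (t j).2.2
        simp only [aff, Function.update_self]
        rw [prI_coe (by nlinarith) (by nlinarith)]
        linear_combination (t j : ℝ) * hsc
      · simp [aff, hj]

theorem antilip (A : (N → ℝ) →L[ℝ] (N → ℝ)) (hA : ∀ v, A v = 0 → v = 0) :
    ∃ C : ℝ, 0 < C ∧ ∀ v, ‖v‖ ≤ C * ‖A v‖ := by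
  obtain ⟨K, hK0, hK⟩ := LinearMap.exists_antilipschitzWith (A : (N → ℝ) →ₗ[ℝ] (N → ℝ))
    (LinearMap.ker_eq_bot'.2 hA)
  refine ⟨K, by exact_mod_cast hK0, fun v => ?_⟩
  have := hK.le_mul_dist v 0
  simpa [dist_zero_right] using this

theorem Good.one_zero {f : (N → ℝ) → ℝ × (N → ℝ)} {a b z : N → ℝ} (h : Good f a b) (hc : Continuous f)
    (hz : z ∈ Icc a b) (hz0 : Neg0 (f z)) (huniq : ∀ y ∈ Icc a b, Neg0 (f y) → y = z)
    (A : (N → ℝ) →L[ℝ] (N → ℝ)) (hA : ∀ v, A v = 0 → v = 0) (hd : HasFDerivAt (fun y => (f y).2) A z) :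
    cl (fun x => f (aff a b x)) ∈ Subgroup.zpowers (gg (N := N)) := by
  have hza : ∀ i, a i < z i := fun i => lt_of_le_of_ne (hz.1 i) (fun he => h.bd z hz ⟨i, Or.inl he.symm⟩ hz0)
  have hzb : ∀ i, z i < b i := fun i => lt_of_le_of_ne (hz.2 i) (fun he => h.bd z hz ⟨i, Or.inr he⟩ hz0)
  obtain ⟨C, hC, hCA⟩ := antilip A hA
  have hlo := hd.isLittleO.def (show 0 < 1 / (2 * C) by positivity)
  have hnb : Icc a b ∈ 𝓝 z := by
    rw [← Set.pi_univ_Icc]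
    exact set_pi_mem_nhds finite_univ (fun i _ => Icc_mem_nhds (hza i) (hzb i))
  obtain ⟨δ, hδ, hball⟩ := Metric.nhds_basis_closedBall.mem_iff.1 (Filter.inter_mem hlo hnb)
  have hbox : Metric.closedBall z δ = Icc (z - fun _ => δ) (z + fun _ => δ) := by
    rw [closedBall_pi _ hδ.le]
    simp only [Real.closedBall_eq_Icc]
    rw [Set.pi_univ_Icc]; rfl
  have hmem : ∀ y ∈ Icc (z - fun _ => δ) (z + fun _ => δ), y ∈ Icc a b ∧
      ‖(f y).2 - A (y - z)‖ ≤ 1 / (2 * C) * ‖y - z‖ := by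
    intro y hy
    rw [← hbox] at hy
    have := hball hy
    refine ⟨this.2, ?_⟩
    have h1 := this.1
    simpa [hz0.1] using h1
  have hl : ∀ i, a i ≤ z i - δ := by
    intro i
    exact (hmem (z - fun _ => δ) ⟨le_rfl, fun j => by simp; linarith⟩).1.1 i
  have hr : ∀ i, z i + δ ≤ b i := by
    intro i
    exact (hmem (z + fun _ => δ) ⟨fun j => by simp; linarith, le_rfl⟩).1.2 i
  -- shrink
  have step1 : cl (fun x => f (aff a b x)) = cl (fun x => f (aff (z - fun _ => δ) (z + fun _ => δ) x)) := by
    have hin : ∀ t ∈ I, ∀ x : I^N, aff ((1 - t) • a + t • (z - fun _ => δ)) ((1 - t) • b + t • (z + fun _ => δ)) x ∈ Icc a b := by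
      rintro t ⟨ht0, ht1⟩ x
      constructor <;> intro i <;> have h1 := (x i).2.1 <;> have h2 := (x i).2.2 <;>
        have h3 := hl i <;> have h4 := hr i <;> have h5 := h.lt i <;> simp only [aff, Pi.add_apply, Pi.smul_apply, Pi.sub_apply, smul_eq_mul]
      · nlinarith [mul_nonneg ht0 (sub_nonneg.2 h3), mul_nonneg ht0 (sub_nonneg.2 h4), mul_nonneg (mul_nonneg ht0 (sub_nonneg.2 h3)) (sub_nonneg.2 h2),
          mul_nonneg (mul_nonneg h1 ht0) hδ.le, mul_nonneg h1 (mul_nonneg (sub_nonneg.2 ht1) (sub_nonneg.2 h5.le))]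
      · nlinarith [mul_nonneg ht0 (sub_nonneg.2 h4), mul_nonneg (mul_nonneg ht0 (sub_nonneg.2 h4)) h1,
          mul_nonneg (mul_nonneg (sub_nonneg.2 h2) ht0) hδ.le, mul_nonneg (sub_nonneg.2 h2) (mul_nonneg (sub_nonneg.2 ht1) (sub_nonneg.2 h5.le))]
    refine cl_homotopy' (fun t x => f (aff ((1 - t) • a + t • (z - fun _ => δ)) ((1 - t) • b + t • (z + fun _ => δ)) x))
      ?_ ?_ ?_ ?_ ?_
    · refine hc.comp ?_
      unfold aff
      simp only [Pi.add_apply, Pi.smul_apply, Pi.sub_apply, smul_eq_mul]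
      fun_prop
    · intro y; simp
    · intro y; simp
    · intro t ht x
      exact h.ne _ (hin t ht x)
    · intro t ht x hx hneg
      have he := huniq _ (hin t ht x) hneg
      obtain ⟨i, hi⟩ := aff_bd (a := ((1 - t) • a + t • (z - fun _ => δ))) (b := ((1 - t) • b + t • (z + fun _ => δ))) hx
      rw [he] at hi
      simp only [Pi.add_apply, Pi.smul_apply, Pi.sub_apply, smul_eq_mul] at hi
      obtain ⟨ht0, ht1⟩ := ht
      have h1 := hza i
      have h2 := hzb i
      rcases eq_or_lt_of_le ht1 with rfl | ht1
      · rcases hi with hi | hi <;> linarith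
      · rcases hi with hi | hi <;> nlinarith [mul_nonneg ht0 hδ.le, mul_pos (sub_pos.2 ht1) (sub_pos.2 h1), mul_pos (sub_pos.2 ht1) (sub_pos.2 h2)]
  have hzneg : (f z).1 < 0 := lt_of_le_of_ne hz0.2 (fun he => h.ne z hz (Prod.ext he hz0.1))
  have hlt' : ∀ i, (z - fun _ => δ : N → ℝ) i < (z + fun _ => δ : N → ℝ) i := by intro i; simp; linarith
  have key : ∀ t ∈ I, ∀ y ∈ Icc (z - fun _ => δ) (z + fun _ => δ), (1 - t) • (f y).2 + t • A (y - z) = 0 → y = z := by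
    rintro t ⟨ht0, ht1⟩ y hy he
    have h1 := (hmem y hy).2
    have h2 : A (y - z) = -((1 - t) • ((f y).2 - A (y - z))) := by
      rw [smul_sub, neg_sub, sub_smul _ _ (A (y - z)), one_smul]
      rw [eq_neg_of_add_eq_zero_left he]; abel
    have h3 := hCA (y - z)
    rw [h2, norm_neg, norm_smul, Real.norm_of_nonneg (by linarith)] at h3
    have h4 : (1 - t) * ‖(f y).2 - A (y - z)‖ ≤ 1 * (1 / (2 * C) * ‖y - z‖) := by gcongr; linarith
    have h5 : ‖y - z‖ ≤ C * (1 * (1 / (2 * C) * ‖y - z‖)) := h3.trans (by gcongr)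
    have h6 : C * (1 * (1 / (2 * C) * ‖y - z‖)) = ‖y - z‖ / 2 := by field_simp
    rw [h6] at h5
    have : ‖y - z‖ = 0 := le_antisymm (by linarith) (norm_nonneg _)
    exact sub_eq_zero.1 (norm_eq_zero.1 this)
  have step2 : cl (fun x => f (aff (z - fun _ => δ) (z + fun _ => δ) x)) =
      cl (linF ((2 * δ) • LinearMap.toMatrix' (A : (N → ℝ) →ₗ[ℝ] (N → ℝ)))) := by
    have hca := continuous_aff (z - fun _ => δ) (z + fun _ => δ)
    refine cl_homotopy' (fun t x => ((1 - t) * (f (aff (z - fun _ => δ) (z + fun _ => δ) x)).1 - t,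
      (1 - t) • (f (aff (z - fun _ => δ) (z + fun _ => δ) x)).2 + t • A (aff (z - fun _ => δ) (z + fun _ => δ) x - z)))
      (by fun_prop) ?_ ?_ ?_ ?_
    · intro x; simp
    · intro x
      simp only [linF, sub_self, zero_mul, zero_sub, zero_smul, zero_add, one_smul]
      rw [Matrix.smul_mulVec, LinearMap.toMatrix'_mulVec]
      rw [← map_smul, ContinuousLinearMap.coe_coe]
      have e : aff (z - fun _ => δ) (z + fun _ => δ) x - z = (2 * δ) • ctr x := by
        funext i
        simp [aff, ctr]; ring
      rw [e]
    · intro t ht x he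
      have e1 := congrArg Prod.fst he
      have e2 := key t ht _ (aff_mem hlt' x) (congrArg Prod.snd he)
      simp only [e2, Prod.fst_zero] at e1
      obtain ⟨ht0, ht1⟩ := ht
      rcases eq_or_lt_of_le ht1 with rfl | ht1
      · linarith
      · nlinarith
    · rintro t ht x hx ⟨e1, -⟩
      have e2 := key t ht _ (aff_mem hlt' x) e1
      obtain ⟨i, hi⟩ := aff_bd (a := z - fun _ => δ) (b := z + fun _ => δ) hx
      rw [e2] at hi
      simp only [Pi.sub_apply, Pi.add_apply] at hi
      rcases hi with hi | hi <;> linarith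
  rw [step1, step2]
  apply linF_mem_zpowers
  intro hdet
  obtain ⟨v, hv, hv0⟩ := Matrix.exists_mulVec_eq_zero_iff.2 hdet
  apply hv
  rw [Matrix.smul_mulVec, LinearMap.toMatrix'_mulVec] at hv0
  apply hA
  exact (smul_eq_zero.1 hv0).resolve_left (by positivity)

/-- the zeros in a box -/
def zer (f : (N → ℝ) → ℝ × (N → ℝ)) (a b : N → ℝ) : Set (N → ℝ) := {y | y ∈ Icc a b ∧ Neg0 (f y)}

theorem Good.induct {f : (N → ℝ) → ℝ × (N → ℝ)} (hc : Continuous f) (m : ℕ) :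
    ∀ a b : N → ℝ, Good f a b → (zer f a b).Finite → (zer f a b).ncard = m →
    (∀ z ∈ zer f a b, ∃ A : (N → ℝ) →L[ℝ] (N → ℝ), (∀ v, A v = 0 → v = 0) ∧ HasFDerivAt (fun y => (f y).2) A z) →
    cl (fun x => f (aff a b x)) ∈ Subgroup.zpowers (gg (N := N)) := by
  induction m using Nat.strong_induction_on with
  | _ m ih =>
  intro a b h hfin hcard hnd
  by_cases h0 : (zer f a b).Subsingleton
  · rcases h0.eq_empty_or_singleton with h0 | ⟨z, hz⟩
    · rw [cl_one (f := fun x => f (aff a b x)) (hc.comp (continuous_aff a b))]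
      · exact Subgroup.one_mem _
      · intro x hx
        have : aff a b x ∈ zer f a b := ⟨aff_mem h.lt x, hx⟩
        rw [h0] at this
        exact this
    · have hzz : z ∈ zer f a b := by rw [hz]; rfl
      obtain ⟨A, hA, hA'⟩ := hnd z hzz
      refine h.one_zero hc hzz.1 hzz.2 ?_ A hA hA'
      intro y hy hy0
      have : y ∈ zer f a b := ⟨hy, hy0⟩
      rw [hz] at this
      exact this
  · rw [Set.not_subsingleton_iff] at h0
    obtain ⟨z, hz, w, hw, hzw⟩ := h0
    have : ∃ i, z i ≠ w i := by
      by_contra hcon; push Not at hcon; exact hzw (funext hcon)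
    obtain ⟨i, hi⟩ := this
    wlog hlt : z i < w i generalizing z w
    · exact this w hw z hz hzw.symm hi.symm (lt_of_le_of_ne (not_lt.1 hlt) hi.symm)
    obtain ⟨c, ⟨hc1, hc2⟩, hc3⟩ := ((Ioo_infinite hlt).sdiff (hfin.image (fun y => y i))).nonempty
    have hac : a i < c := lt_of_le_of_lt (hz.1.1 i) hc1
    have hcb : c < b i := lt_of_lt_of_le hc2 (hw.1.2 i)
    obtain ⟨g1, g2, he⟩ := h.split hc i c hac hcb (fun y hy hyc hn => hc3 ⟨y, ⟨hy, hn⟩, hyc⟩)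
    rw [he]
    have hs1 : zer f (Function.update a i c) b ⊂ zer f a b := by
      refine ⟨?_, ?_⟩
      · rintro y ⟨⟨hy1, hy2⟩, hy3⟩
        refine ⟨⟨fun j => ?_, hy2⟩, hy3⟩
        by_cases hj : j = i
        · subst hj; have := hy1 j; simp at this; linarith
        · simpa [hj] using hy1 j
      · intro hcon
        have := (hcon hz).1.1 i
        simp at this; linarith
    have hs2 : zer f a (Function.update b i c) ⊂ zer f a b := by
      refine ⟨?_, ?_⟩
      · rintro y ⟨⟨hy1, hy2⟩, hy3⟩
        refine ⟨⟨hy1, fun j => ?_⟩, hy3⟩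
        by_cases hj : j = i
        · subst hj; have := hy2 j; simp at this; linarith
        · simpa [hj] using hy2 j
      · intro hcon
        have := (hcon hw).1.2 i
        simp at this; linarith
    refine Subgroup.mul_mem _ ?_ ?_
    · exact ih _ (by rw [← hcard]; exact Set.ncard_lt_ncard hs1 hfin) _ _ g1 (hfin.subset hs1.1) rfl
        (fun y hy => hnd y (hs1.1 hy))
    · exact ih _ (by rw [← hcard]; exact Set.ncard_lt_ncard hs2 hfin) _ _ g2 (hfin.subset hs2.1) rfl
        (fun y hy => hnd y (hs2.1 hy))

theorem Good.finite {f : (N → ℝ) → ℝ × (N → ℝ)} (hc : Continuous f) (a b : N → ℝ)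
    (hnd : ∀ z ∈ zer f a b, ∃ A : (N → ℝ) →L[ℝ] (N → ℝ), (∀ v, A v = 0 → v = 0) ∧ HasFDerivAt (fun y => (f y).2) A z) :
    (zer f a b).Finite := by
  have hcomp : IsCompact (zer f a b) := by
    have : zer f a b = Icc a b ∩ ({y | (f y).2 = 0} ∩ {y | (f y).1 ≤ 0}) := rfl
    rw [this]
    refine isCompact_Icc.inter_right (IsClosed.inter ?_ ?_)
    · exact isClosed_eq (by fun_prop) continuous_const
    · exact isClosed_le (by fun_prop) continuous_const
  refine hcomp.finite ?_
  rw [isDiscrete_iff_forall_mem_exists_isOpen]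
  intro z hz
  obtain ⟨A, hA, hA'⟩ := hnd z hz
  obtain ⟨C, -, hC⟩ := LinearMap.exists_antilipschitzWith (A : (N → ℝ) →ₗ[ℝ] (N → ℝ))
    (LinearMap.ker_eq_bot'.2 hA)
  have := hA'.eventually_ne (c := 0) ⟨C, hC⟩
  rw [eventually_nhdsWithin_iff] at this
  obtain ⟨U, hU, hUo, hzU⟩ := eventually_nhds_iff.1 this
  refine ⟨U, hUo, ?_⟩
  ext y
  constructor
  · rintro ⟨h1, h2⟩
    by_contra hne
    exact hU y h1 hne h2.2.1
  · rintro rfl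
    exact ⟨hzU, hz⟩
end CYCLIC

section CYCLIC2
set_option linter.unusedSectionVars false
open Matrix Set MeasureTheory
open scoped ContDiff

variable {N : Type*} [Fintype N] [Nonempty N] [DecidableEq N]

/-- Sard-type choice -/
theorem sard_choice {p : (N → ℝ) → ℝ} {q : (N → ℝ) → (N → ℝ)} (hp : Differentiable ℝ p) (hq : Differentiable ℝ q) :
    ∃ v : N → ℝ, ∀ y, p y < 0 → q y + p y • v = 0 →
      ∃ A : (N → ℝ) →L[ℝ] (N → ℝ), (∀ w, A w = 0 → w = 0) ∧ HasFDerivAt (fun y => q y + p y • v) A y := by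
  let U : (N → ℝ) → (N → ℝ) := fun y => (-p y)⁻¹ • q y
  let s : Set (N → ℝ) := {y | p y < 0 ∧ (fderiv ℝ U y).det = 0}
  have hU : ∀ y, p y < 0 → DifferentiableAt ℝ U y := by
    intro y hy
    exact DifferentiableAt.smul ((hp y).neg.inv (by simpa using hy.ne)) (hq y)
  have hnull : volume (U '' s) = 0 :=
    addHaar_image_eq_zero_of_det_fderivWithin_eq_zero volume (f' := fderiv ℝ U)
      (fun y hy => (hU y hy.1).hasFDerivAt.hasFDerivWithinAt) (fun y hy => hy.2)
  have : ∃ v, v ∉ U '' s := by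
    by_contra hcon
    push Not at hcon
    have : U '' s = univ := eq_univ_of_forall hcon
    rw [this] at hnull
    exact (isOpen_univ.measure_pos volume univ_nonempty).ne' hnull
  obtain ⟨v, hv⟩ := this
  refine ⟨v, fun y hy h0 => ?_⟩
  have hd : HasFDerivAt (fun y => q y + p y • v) (fderiv ℝ (fun y => q y + p y • v) y) y :=
    ((hq y).add ((hp y).smul_const v)).hasFDerivAt
  refine ⟨_, ?_, hd⟩
  have hpn : p y ≠ 0 := hy.ne
  have hUy : U y = v := by
    simp only [U]
    rw [eq_neg_of_add_eq_zero_left h0, ← smul_neg, smul_smul]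
    rw [← neg_smul_neg, neg_neg, ← neg_mul, ← inv_neg, neg_neg, inv_mul_cancel₀ hpn, one_smul]
  have hdet : (fderiv ℝ U y).det ≠ 0 := fun h => hv ⟨y, ⟨hy, h⟩, hUy⟩
  have hev : (fun y => (-p y)⁻¹ • (q y + p y • v) + v) =ᶠ[𝓝 y] U := by
    have : ∀ᶠ x in 𝓝 y, p x < 0 := (hp.continuous.continuousAt).eventually (gt_mem_nhds hy)
    filter_upwards [this] with x hx
    simp only [U]
    have : p x ≠ 0 := hx.ne
    rw [smul_add, smul_smul, inv_neg, neg_mul, inv_mul_cancel₀ this]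
    simp
  have hinv : HasFDerivAt (fun y => (-p y)⁻¹) (fderiv ℝ (fun y => (-p y)⁻¹) y) y :=
    ((hp y).neg.inv (by simpa using hpn)).hasFDerivAt
  have hform := ((hinv.smul hd).add_const v).congr_of_eventuallyEq hev.symm
  rw [h0] at hform
  intro w hw
  have hfd := hform.fderiv
  have hw0 : fderiv ℝ U y w = 0 := by
    rw [hfd]
    simp [hw]
  by_contra hne
  apply hdet
  rw [ContinuousLinearMap.det]
  by_contra hdet'
  have := LinearMap.bot_lt_ker_of_det_eq_zero (f := (fderiv ℝ U y : (N → ℝ) →ₗ[ℝ] (N → ℝ)))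
  have hu := (LinearMap.isUnit_iff_isUnit_det (f := (fderiv ℝ U y : (N → ℝ) →ₗ[ℝ] (N → ℝ)))).2 (isUnit_iff_ne_zero.2 hdet')
  have hker := (LinearMap.isUnit_iff_ker_eq_bot _).1 hu
  exact hne (LinearMap.ker_eq_bot'.1 hker w hw0)

/-- coordinates of the cube -/
def cubeCoe : C((I^N), (N → ℝ)) := ⟨fun x i => (x i : ℝ), by fun_prop⟩

theorem cubeCoe_inj : Function.Injective (cubeCoe (N := N)) := by
  intro x y h
  funext i
  exact Subtype.ext (congrFun h i)

theorem cyclic (c : HomotopyGroup N (WW (N → ℝ)) (wb (N → ℝ))) : c ∈ Subgroup.zpowers (gg (N := N)) := by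
  obtain ⟨f, hc, hb, rfl⟩ := piMk_surj c
  rw [cl_of_loop]
  -- minimal norm
  obtain ⟨x0, -, hx0⟩ := isCompact_univ.exists_isMinOn (univ_nonempty (α := I^N))
    (f := fun y => ‖(f y : ℝ × (N → ℝ))‖) (by fun_prop)
  set ε := min (1 / 2) ‖(f x0 : ℝ × (N → ℝ))‖ with hε
  have hε0 : 0 < ε := lt_min (by norm_num) (norm_pos_iff.2 (f x0).2)
  obtain ⟨P, hP, hPf⟩ := smooth_approx cubeCoe cubeCoe_inj (f := fun y => (f y : ℝ × (N → ℝ))) (by fun_prop) hε0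
  have hPc : Continuous P := hP.continuous
  have hPd : Differentiable ℝ P := hP.differentiable (by simp)
  have hline : ∀ t ∈ I, ∀ y, ‖((1 - t) • (f y : ℝ × (N → ℝ)) + t • P (cubeCoe y)) - f y‖ < ε := by
    rintro t ⟨ht0, ht1⟩ y
    have : ((1 - t) • (f y : ℝ × (N → ℝ)) + t • P (cubeCoe y)) - f y = t • (P (cubeCoe y) - f y) := by
      module
    rw [this, norm_smul, Real.norm_of_nonneg ht0]
    calc t * ‖P (cubeCoe y) - f y‖ ≤ 1 * ‖P (cubeCoe y) - f y‖ := by gcongr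
      _ < ε := by rw [one_mul]; exact hPf y
  have hne : ∀ t ∈ I, ∀ y, (1 - t) • (f y : ℝ × (N → ℝ)) + t • P (cubeCoe y) ≠ 0 := by
    intro t ht y h0
    have h1 := hline t ht y
    rw [h0, zero_sub, norm_neg] at h1
    have h2 := hx0 (mem_univ y)
    have h3 := min_le_right (1 / 2) ‖(f x0 : ℝ × (N → ℝ))‖
    simp only [mem_ofPred_eq] at h2
    linarith
  have hbd : ∀ t ∈ I, ∀ y ∈ Cube.boundary N, 0 < ((1 - t) • (f y : ℝ × (N → ℝ)) + t • P (cubeCoe y)).1 := by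
    intro t ht y hy
    have h1 := hline t ht y
    have h2 := (norm_fst_le _).trans_lt h1
    have h3 := min_le_left (1 / 2) ‖(f x0 : ℝ × (N → ℝ))‖
    rw [Prod.fst_sub, hb y hy, Real.norm_eq_abs, abs_lt] at h2
    rw [hb y hy]
    simp only [wb] at h2 ⊢
    linarith
  have hPbd : ∀ y ∈ Cube.boundary N, 0 < (P (cubeCoe y)).1 := fun y hy => by
    simpa using hbd 1 ⟨zero_le_one, le_rfl⟩ y hy
  have hPne : ∀ y, P (cubeCoe y) ≠ 0 := fun y => by
    simpa using hne 1 ⟨zero_le_one, le_rfl⟩ y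
  have s1 : cl (fun y => (f y : ℝ × (N → ℝ))) = cl (fun y => P (cubeCoe y)) := by
    refine cl_homotopy' (fun t y => (1 - t) • (f y : ℝ × (N → ℝ)) + t • P (cubeCoe y)) (by fun_prop) (by simp) (by simp) hne ?_
    intro t ht y hy h
    have := hbd t ht y hy
    exact absurd h.2 (not_le.2 this)
  obtain ⟨v, hv⟩ := sard_choice (p := fun y => (P y).1) (q := fun y => (P y).2) (by fun_prop) (by fun_prop)
  let Q : (N → ℝ) → ℝ × (N → ℝ) := fun y => ((P y).1, (P y).2 + (P y).1 • v)
  have hshear : ∀ (z : ℝ × (N → ℝ)) (t : ℝ), (z.1, z.2 + z.1 • t • v) = 0 → z = 0 := by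
    intro z t h
    have h1 := congrArg Prod.fst h
    have h2 := congrArg Prod.snd h
    simp only [Prod.fst_zero, Prod.snd_zero] at h1 h2
    rw [h1, zero_smul, add_zero] at h2
    exact Prod.ext h1 h2
  have s2 : cl (fun y => P (cubeCoe y)) = cl (fun y => Q (cubeCoe y)) := by
    refine cl_homotopy' (fun t y => ((P (cubeCoe y)).1, (P (cubeCoe y)).2 + (P (cubeCoe y)).1 • t • v)) (by fun_prop) (by simp) (by simp [Q]) ?_ ?_
    · intro t _ y h
      exact hPne y (hshear _ t h)
    · intro t ht y hy h
      exact absurd h.2 (not_le.2 (hPbd y hy))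
  have hQc : Continuous Q := by fun_prop
  have s3 : (fun y : I^N => Q (cubeCoe y)) = fun y => Q (aff 0 1 y) := by
    funext y
    congr 1
    funext i
    simp [cubeCoe, aff]
  have hlift : ∀ y ∈ Icc (0 : N → ℝ) 1, ∃ x : I^N, cubeCoe x = y := by
    intro y hy
    exact ⟨fun i => ⟨y i, hy.1 i, hy.2 i⟩, rfl⟩
  have hG : Good Q 0 1 := by
    refine ⟨by simp, ?_, ?_⟩
    · intro y hy h
      obtain ⟨x, rfl⟩ := hlift y hy
      refine hPne x (hshear _ 1 ?_)
      rw [one_smul]; exact h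
    · rintro y hy ⟨i, hi⟩ h
      obtain ⟨x, rfl⟩ := hlift y hy
      refine absurd h.2 (not_le.2 (hPbd x ⟨i, ?_⟩))
      rcases hi with hi | hi
      · left; exact Subtype.ext hi
      · right; exact Subtype.ext hi
  have hnd : ∀ z ∈ zer Q 0 1, ∃ A : (N → ℝ) →L[ℝ] (N → ℝ), (∀ v, A v = 0 → v = 0) ∧ HasFDerivAt (fun y => (Q y).2) A z := by
    rintro z ⟨hz, hz0⟩
    refine hv z ?_ hz0.1
    refine lt_of_le_of_ne hz0.2 (fun h => hG.ne z hz (Prod.ext h hz0.1))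
  rw [s1, s2, s3]
  exact Good.induct hQc _ 0 1 hG (Good.finite hQc 0 1 hnd) rfl hnd
end CYCLIC2

section DEGREE
set_option linter.unusedSectionVars false
open Matrix Set MeasureTheory

/-- determinant as a continuous multilinear map of the rows -/
def detC (m : ℕ) : ContinuousMultilinearMap ℝ (fun _ : Fin m => (Fin m → ℝ)) ℝ :=
  { toMultilinearMap := (Matrix.detRowAlternating (n := Fin m) (R := ℝ)).toMultilinearMap
    cont := Continuous.matrix_det (A := fun M : Matrix (Fin m) (Fin m) ℝ => M) continuous_id }

theorem detC_apply {m : ℕ} (r : Fin m → Fin m → ℝ) : detC m r = Matrix.det (Matrix.of r) := rfl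

variable {n : ℕ}

/-- gradients of the components -/
def grd (Q : (Fin (n + 1) → ℝ) → (Fin n → ℝ)) (z : Fin (n + 1) → ℝ) (l : Fin n) : Fin (n + 1) → ℝ :=
  fun j => fderiv ℝ Q z (Pi.single j 1) l

theorem grd_hasFDerivAt {Q : (Fin (n + 1) → ℝ) → (Fin n → ℝ)} (hQ : ContDiff ℝ 2 Q) (v z : Fin (n + 1) → ℝ) :
    ∃ R' : (Fin (n + 1) → ℝ) →L[ℝ] (Fin (n + 1) → Fin (n + 1) → ℝ),
      HasFDerivAt (fun z => (Fin.cons v (grd Q z) : Fin (n + 1) → Fin (n + 1) → ℝ)) R' z ∧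
      (∀ w, R' w 0 = 0) ∧ (∀ w l j, R' w (Fin.succ l) j = fderiv ℝ (fderiv ℝ Q) z w (Pi.single j 1) l) := by
  have hd : DifferentiableAt ℝ (fderiv ℝ Q) z :=
    ((hQ.fderiv_right (m := 1) (by norm_num)).differentiable (by simp)) z
  have hrow : ∀ i : Fin (n + 1), ∃ r' : (Fin (n + 1) → ℝ) →L[ℝ] (Fin (n + 1) → ℝ),
      HasFDerivAt (fun z => (Fin.cons v (grd Q z) : Fin (n + 1) → Fin (n + 1) → ℝ) i) r' z ∧
      (i = 0 → r' = 0) ∧ (∀ l, i = Fin.succ l → ∀ w j, r' w j = fderiv ℝ (fderiv ℝ Q) z w (Pi.single j 1) l) := by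
    intro i
    refine Fin.cases ?_ (fun l => ?_) i
    · refine ⟨0, ?_, fun _ => rfl, fun l h => absurd h.symm (Fin.succ_ne_zero l)⟩
      simp only [Fin.cons_zero]
      exact hasFDerivAt_const _ _
    · refine ⟨ContinuousLinearMap.pi fun j => (ContinuousLinearMap.proj l).comp
        (((fderiv ℝ (fderiv ℝ Q) z).flip (Pi.single j 1))), ?_, fun h => absurd h (Fin.succ_ne_zero l), ?_⟩
      · simp only [Fin.cons_succ]
        rw [hasFDerivAt_pi]
        intro j
        have h1 : HasFDerivAt (fun z => fderiv ℝ Q z (Pi.single j 1)) ((fderiv ℝ (fderiv ℝ Q) z).flip (Pi.single j 1)) z := by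
          have := hd.hasFDerivAt.clm_apply (hasFDerivAt_const (Pi.single j (1 : ℝ) : Fin (n + 1) → ℝ) z)
          simpa using this
        exact (hasFDerivAt_pi'.1 h1 l)
      · intro l' h w j
        rw [Fin.succ_inj.1 h]
        simp
  choose r' h1 h2 h3 using hrow
  refine ⟨ContinuousLinearMap.pi r', hasFDerivAt_pi.2 h1, fun w => ?_, fun w l j => ?_⟩
  · simp [h2 0 rfl]
  · simp [h3 _ l rfl]

theorem second_zero {Q : (Fin (n + 1) → ℝ) → (Fin n → ℝ)} (hQ : ContDiff ℝ 2 Q) (z : Fin (n + 1) → ℝ)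
    (g : Fin n → Fin (n + 1) → ℝ) (l : Fin n) :
    ∑ i : Fin (n + 1), detC (n + 1) (Function.update (Fin.cons (Pi.single i 1) g) (Fin.succ l)
      (fun j => fderiv ℝ (fderiv ℝ Q) z (Pi.single i 1) (Pi.single j 1) l)) = 0 := by
  set H : Fin (n + 1) → Fin (n + 1) → ℝ := fun i j => fderiv ℝ (fderiv ℝ Q) z (Pi.single i 1) (Pi.single j 1) l with hH
  have hsym : ∀ i j, H i j = H j i := by
    intro i j
    have := (hQ.contDiffAt (x := z)).isSymmSndFDerivAt (by simp)
    simp only [hH, this.eq (Pi.single i 1) (Pi.single j 1)]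
  let T : Fin (n + 1) → Fin (n + 1) → ℝ := fun i j =>
    detC (n + 1) (Function.update (Fin.cons (Pi.single i 1) g) (Fin.succ l) (Pi.single j 1))
  have hT : ∀ i j, T j i = - T i j := by
    intro i j
    have h1 := (Matrix.detRowAlternating (n := Fin (n + 1)) (R := ℝ)).map_swap
      (Function.update (Fin.cons (Pi.single i 1) g : Fin (n + 1) → Fin (n + 1) → ℝ) (Fin.succ l) (Pi.single j 1))
      (Fin.succ_ne_zero l).symm
    refine Eq.trans ?_ h1
    simp only [T]
    change Matrix.detRowAlternating _ = _
    congr 1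
    funext k
    refine Fin.cases ?_ (fun k => ?_) k
    · simp [Function.update_of_ne (Fin.succ_ne_zero l).symm]
    · by_cases hk : k = l
      · subst hk
        simp [Function.update_of_ne (Fin.succ_ne_zero k).symm]
      · have hk1 : k.succ ≠ l.succ := fun h => hk (Fin.succ_inj.1 h)
        simp [Function.update_of_ne hk1, Equiv.swap_apply_of_ne_of_ne (Fin.succ_ne_zero k) hk1]
  have hexp : ∀ i, detC (n + 1) (Function.update (Fin.cons (Pi.single i 1) g) (Fin.succ l) (H i)) =
      ∑ j, H i j * T i j := by
    intro i
    have h1 : H i = ∑ j, H i j • (Pi.single j 1 : Fin (n + 1) → ℝ) := by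
      funext k
      simp [Finset.sum_apply, Pi.single_apply]
    conv_lhs => rw [h1]
    change (detC (n + 1)).toMultilinearMap _ = _
    rw [MultilinearMap.map_update_sum]
    refine Finset.sum_congr rfl fun j _ => ?_
    rw [MultilinearMap.map_update_smul]
    rfl
  change ∑ i, detC (n + 1) (Function.update (Fin.cons (Pi.single i 1) g) (Fin.succ l) (H i)) = 0
  simp only [hexp]
  have h2 : ∑ i, ∑ j, H i j * T i j = - ∑ i, ∑ j, H i j * T i j := by
    conv_lhs => rw [Finset.sum_comm]
    rw [← Finset.sum_neg_distrib]
    refine Finset.sum_congr rfl fun i _ => ?_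
    rw [← Finset.sum_neg_distrib]
    refine Finset.sum_congr rfl fun j _ => ?_
    rw [hsym j i, hT i j]; ring
  linarith

theorem grad_zero {Q : (Fin (n + 1) → ℝ) → (Fin n → ℝ)} {z : Fin (n + 1) → ℝ}
    (L : (Fin n → ℝ) →L[ℝ] ℝ) :
    ∑ i : Fin (n + 1), L (fderiv ℝ Q z (Pi.single i 1)) * detC (n + 1) (Fin.cons (Pi.single i 1) (grd Q z)) = 0 := by
  let u : Fin (n + 1) → ℝ := fun i => L (fderiv ℝ Q z (Pi.single i 1))
  have hexp : ∀ (A : (Fin (n + 1) → ℝ) →L[ℝ] ℝ) w, ∑ j, A (Pi.single j 1) * w j = A w := by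
    intro A w
    conv_rhs => rw [show w = ∑ j, w j • (Pi.single j 1 : Fin (n + 1) → ℝ) by
      funext k; simp [Finset.sum_apply, Pi.single_apply]]
    rw [map_sum]
    refine Finset.sum_congr rfl fun j _ => ?_
    rw [map_smul, smul_eq_mul, mul_comm]
  have h1 : detC (n + 1) (Fin.cons u (grd Q z)) =
      ∑ i : Fin (n + 1), u i * detC (n + 1) (Fin.cons (Pi.single i 1) (grd Q z)) := by
    have h1 : u = ∑ j, u j • (Pi.single j 1 : Fin (n + 1) → ℝ) := by
      funext k
      simp [Finset.sum_apply, Pi.single_apply]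
    have e : ∀ v : Fin (n + 1) → ℝ, (Fin.cons v (grd Q z) : Fin (n + 1) → Fin (n + 1) → ℝ) =
        Function.update (Fin.cons 0 (grd Q z)) 0 v := by
      intro v; rw [Fin.update_cons_zero]
    rw [e u, Finset.sum_congr rfl (fun i _ => by rw [e (Pi.single i 1)])]
    conv_lhs => rw [h1]
    change (detC (n + 1)).toMultilinearMap _ = _
    rw [MultilinearMap.map_update_sum]
    refine Finset.sum_congr rfl fun j _ => ?_
    rw [MultilinearMap.map_update_smul]
    rfl
  change ∑ i, u i * _ = 0
  rw [← h1, detC_apply]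
  have hker := LinearMap.ker_ne_bot_of_finrank_lt (f := (fderiv ℝ Q z : (Fin (n + 1) → ℝ) →ₗ[ℝ] (Fin n → ℝ))) (by simp)
  obtain ⟨w, hw, hw0⟩ := (Submodule.ne_bot_iff _).1 hker
  have hw' : fderiv ℝ Q z w = 0 := hw
  refine Matrix.exists_mulVec_eq_zero_iff.1 ⟨w, hw0, ?_⟩
  funext k
  refine Fin.cases ?_ (fun l => ?_) k
  · have := hexp (L.comp (fderiv ℝ Q z)) w
    simp only [Matrix.mulVec, dotProduct, Matrix.of_apply, Fin.cons_zero, u]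
    simpa [hw'] using this
  · have := hexp ((ContinuousLinearMap.proj l).comp (fderiv ℝ Q z)) w
    simp only [Matrix.mulVec, dotProduct, Matrix.of_apply, Fin.cons_succ, grd]
    simpa [hw'] using this

/-- the minor equals the determinant of the derivative of the slice -/
theorem minor_eq {Q : (Fin (n + 1) → ℝ) → (Fin n → ℝ)} (hQ : Differentiable ℝ Q) (c : ℝ) (w : Fin n → ℝ) :
    detC (n + 1) (Fin.cons (Pi.single 0 1) (grd Q (Fin.cons c w))) =
      (fderiv ℝ (fun w : Fin n → ℝ => Q (Fin.cons c w)) w).det := by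
  have hcons : HasFDerivAt (fun w : Fin n → ℝ => (Fin.cons c w : Fin (n + 1) → ℝ))
      (ContinuousLinearMap.pi (fun i => Fin.cases 0 (fun l => ContinuousLinearMap.proj l) i :
        (i : Fin (n + 1)) → (Fin n → ℝ) →L[ℝ] ℝ)) w := by
    rw [hasFDerivAt_pi]
    intro i
    refine Fin.cases ?_ (fun l => ?_) i
    · simp only [Fin.cons_zero]; exact hasFDerivAt_const _ _
    · simp only [Fin.cons_succ]
      exact (ContinuousLinearMap.proj (R := ℝ) (φ := fun _ : Fin n => ℝ) l).hasFDerivAt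
  have h1 := ((hQ (Fin.cons c w)).hasFDerivAt.comp w hcons).fderiv
  have h2 : (fun w : Fin n → ℝ => Q (Fin.cons c w)) = Q ∘ (fun w : Fin n → ℝ => (Fin.cons c w : Fin (n + 1) → ℝ)) := rfl
  rw [h2, h1, ContinuousLinearMap.det, ← LinearMap.det_toMatrix', detC_apply, Matrix.det_succ_row_zero, Fin.sum_univ_succ]
  simp only [Matrix.of_apply, Fin.cons_zero, Pi.single_eq_same]
  rw [Finset.sum_eq_zero (by intro i _; simp)]
  simp only [Fin.val_zero, pow_zero, one_mul, add_zero]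
  congr 1
  ext l j
  simp only [Matrix.submatrix_apply, Matrix.of_apply, Fin.cons_succ, grd, LinearMap.toMatrix'_apply]
  simp only [ContinuousLinearMap.coe_coe, ContinuousLinearMap.comp_apply]
  refine congrArg (fun u => fderiv ℝ Q (Fin.cons c w) u l) ?_
  funext k
  refine Fin.cases ?_ (fun k => ?_) k
  · simp
  · simp [Pi.single_apply]

theorem degree_lemma {Q : (Fin (n + 1) → ℝ) → (Fin n → ℝ)} (hQ : ContDiff ℝ 2 Q) {ρ : (Fin n → ℝ) → ℝ} (hρ : ContDiff ℝ 1 ρ)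
    {a b : Fin (n + 1) → ℝ} (hab : a ≤ b)
    (hface : ∀ z ∈ Icc a b, ∀ i : Fin n, (z i.succ = a i.succ ∨ z i.succ = b i.succ) → ρ (Q z) = 0) :
    ∫ w in Icc (fun i : Fin n => a i.succ) (fun i => b i.succ), ρ (Q (Fin.cons (a 0) w)) *
      (fderiv ℝ (fun w : Fin n → ℝ => Q (Fin.cons (a 0) w)) w).det =
    ∫ w in Icc (fun i : Fin n => a i.succ) (fun i => b i.succ), ρ (Q (Fin.cons (b 0) w)) *
      (fderiv ℝ (fun w : Fin n → ℝ => Q (Fin.cons (b 0) w)) w).det := by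
  have hQd : Differentiable ℝ Q := hQ.differentiable (by simp)
  have hρd : Differentiable ℝ ρ := hρ.differentiable (by simp)
  choose R' hR hR0 hR1 using fun (i : Fin (n + 1)) z => grd_hasFDerivAt hQ (Pi.single i 1) z
  let V : Fin (n + 1) → (Fin (n + 1) → ℝ) → ℝ := fun i z =>
    ρ (Q z) * detC (n + 1) (Fin.cons (Pi.single i 1) (grd Q z))
  let V' : Fin (n + 1) → (Fin (n + 1) → ℝ) → (Fin (n + 1) → ℝ) →L[ℝ] ℝ := fun i z =>
    ρ (Q z) • ((detC (n + 1)).linearDeriv (Fin.cons (Pi.single i 1) (grd Q z))).comp (R' i z) +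
      detC (n + 1) (Fin.cons (Pi.single i 1) (grd Q z)) • (fderiv ℝ ρ (Q z)).comp (fderiv ℝ Q z)
  have hV : ∀ i z, HasFDerivAt (V i) (V' i z) z := by
    intro i z
    have h1 : HasFDerivAt (fun z => ρ (Q z)) ((fderiv ℝ ρ (Q z)).comp (fderiv ℝ Q z)) z :=
      (hρd (Q z)).hasFDerivAt.comp z (hQd z).hasFDerivAt
    have h2 := ((detC (n + 1)).hasFDerivAt (Fin.cons (Pi.single i 1) (grd Q z))).comp z (hR i z)
    exact h1.mul h2
  have hdiv : ∀ z, ∑ i, V' i z (Pi.single i 1) = 0 := by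
    intro z
    simp only [V', _root_.add_apply, _root_.smul_apply, ContinuousLinearMap.comp_apply,
      ContinuousMultilinearMap.linearDeriv_apply, smul_eq_mul]
    rw [Finset.sum_add_distrib]
    have e2 := grad_zero (Q := Q) (z := z) (fderiv ℝ ρ (Q z))
    rw [Finset.sum_congr rfl (fun i _ => mul_comm (detC (n + 1) (Fin.cons (Pi.single i 1) (grd Q z))) _), e2, add_zero,
      ← Finset.mul_sum, Finset.sum_comm, Fin.sum_univ_succ]
    have e3 : ∑ i, detC (n + 1) (Function.update (Fin.cons (Pi.single i 1) (grd Q z)) 0 (R' i z (Pi.single i 1) 0)) = 0 := by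
      refine Finset.sum_eq_zero fun i _ => ?_
      rw [hR0]
      exact (detC (n + 1)).map_coord_zero 0 (by simp)
    have e4 : ∀ l : Fin n, ∑ i, detC (n + 1) (Function.update (Fin.cons (Pi.single i 1) (grd Q z)) l.succ (R' i z (Pi.single i 1) l.succ)) = 0 := by
      intro l
      rw [← second_zero hQ z (grd Q z) l]
      refine Finset.sum_congr rfl fun i _ => ?_
      congr 2
      funext j
      exact hR1 i z _ l j
    rw [e3, Finset.sum_eq_zero (fun l _ => e4 l)]
    simp
  have hmain := integral_divergence_of_hasFDerivAt_off_countable' a b hab V V' ∅ countable_empty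
    (fun i => (continuous_iff_continuousAt.2 fun z => (hV i z).continuousAt).continuousOn)
    (fun z _ i => hV i z) (by simp only [hdiv]; exact integrableOn_zero)
  simp only [hdiv, integral_zero] at hmain
  rw [Fin.sum_univ_succ] at hmain
  have hrest : ∀ (l : Fin n) (c : ℝ), (c = a l.succ ∨ c = b l.succ) →
      ∫ x in Icc (a ∘ Fin.succAbove l.succ) (b ∘ Fin.succAbove l.succ), V l.succ (Fin.insertNth l.succ c x) = 0 := by
    intro l c hc
    have hcm : c ∈ Icc (a l.succ) (b l.succ) := by
      rcases hc with rfl | rfl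
      · exact ⟨le_rfl, hab _⟩
      · exact ⟨hab _, le_rfl⟩
    rw [setIntegral_congr_fun (g := fun _ => 0) measurableSet_Icc]
    · simp
    · intro x hx
      simp only [V]
      rw [hface _ ?_ l (by simpa using hc), zero_mul]
      exact Fin.insertNth_mem_Icc.2 ⟨hcm, hx⟩
  rw [Finset.sum_eq_zero (fun l _ => by rw [hrest l _ (Or.inr rfl), hrest l _ (Or.inl rfl), sub_zero]), add_zero] at hmain
  have hfin := (sub_eq_zero.1 hmain.symm).symm
  simp only [V, Fin.insertNth_zero'] at hfin
  simp only [minor_eq hQd] at hfin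
  exact hfin
end DEGREE

section ORDER
set_option linter.unusedSectionVars false
open Matrix Set MeasureTheory
open scoped ContDiff

/-- the cylinder coordinates -/
def cylCoe {N : Type*} [Fintype N] : C(I × (I^N), ℝ × (N → ℝ)) := ⟨fun z => ((z.1 : ℝ), cubeCoe z.2), by fun_prop⟩

theorem cylCoe_inj {N : Type*} [Fintype N] [Nonempty N] [DecidableEq N] : Function.Injective (cylCoe (N := N)) := by
  rintro ⟨t, x⟩ ⟨t', x'⟩ h
  have h1 := congrArg Prod.fst h
  have h2 := congrArg Prod.snd h
  exact Prod.ext (Subtype.ext h1) (cubeCoe_inj h2)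

/-- `ℝ × ℝ⁴ → ℝ⁵` -/
def e5 (y : ℝ × (Fin 4 → ℝ)) : Fin 5 → ℝ := Fin.cons y.1 y.2

theorem contDiff_e5 {D : Type*} [NormedAddCommGroup D] [NormedSpace ℝ D] {m : WithTop ℕ∞} {f : D → ℝ × (Fin 4 → ℝ)} (hf : ContDiff ℝ m f) :
    ContDiff ℝ m (fun y => e5 (f y)) := by
  rw [contDiff_pi]
  intro i
  refine Fin.cases ?_ (fun l => ?_) i
  · simp only [e5, Fin.cons_zero]; fun_prop
  · simp only [e5, Fin.cons_succ]; fun_prop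

/-- the cone over F -/
def cone5 (F : (Fin 4 → ℝ) → ℝ × (Fin 4 → ℝ)) (w : Fin 5 → ℝ) : Fin 5 → ℝ :=
  w 0 • e5 (F (fun i => w i.succ))

/-- the target point -/
def pt5 : Fin 5 → ℝ := Fin.cons (-1) 0

theorem smul_e5_eq {s : ℝ} {y : ℝ × (Fin 4 → ℝ)} (h : s • e5 y = pt5) : s * y.1 = -1 ∧ s • y.2 = 0 := by
  constructor
  · have := congrFun h 0
    simpa [e5, pt5] using this
  · funext l
    have := congrFun h l.succ
    simpa [e5, pt5] using this

theorem degree_zero {F : (Fin 4 → ℝ) → ℝ × (Fin 4 → ℝ)} (hF : ContDiff ℝ ∞ F)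
    {H : I × (I^(Fin 4)) → ℝ × (Fin 4 → ℝ)} (hH : Continuous H) (hne : ∀ z, H z ≠ 0)
    (hbd : ∀ t, ∀ y ∈ Cube.boundary (Fin 4), ¬ Neg0 (H (t, y)))
    (h0 : ∀ y, H (0, y) = F (cubeCoe y)) (h1 : ∀ y, H (1, y) = (1, 0)) :
    ∃ δ > 0, ∃ S > 1, ∀ ρ : (Fin 5 → ℝ) → ℝ, ContDiff ℝ 1 ρ → (∀ v, δ ≤ dist v pt5 → ρ v = 0) →
      ∫ w in Icc (0 : Fin 5 → ℝ) (Fin.cons S 1), ρ (cone5 F w) * (fderiv ℝ (cone5 F) w).det = 0 := by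
  obtain ⟨x0, -, hx0⟩ := isCompact_univ.exists_isMinOn (univ_nonempty (α := I × (I^(Fin 4))))
    (f := fun y => ‖H y‖) (by fun_prop)
  set m := ‖H x0‖ with hm
  have hm0 : 0 < m := norm_pos_iff.2 (hne x0)
  have hmin : ∀ z, m ≤ ‖H z‖ := fun z => hx0 (mem_univ z)
  have hm1 : m ≤ 1 := by
    have := hmin (1, fun _ => 0)
    rw [h1] at this
    simpa using this
  obtain ⟨R, hR0, hR⟩ := exists_R (K := univ ×ˢ Cube.boundary (Fin 4))
    (isCompact_univ.prod isCompact_boundary) hH (by rintro ⟨t, y⟩ ⟨-, hy⟩; exact hbd t y hy)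
  set ε := m / (4 * (1 + R)) with hε
  have hε0 : 0 < ε := by positivity
  have hεm : 4 * ε * (1 + R) = m := by rw [hε]; field_simp
  have hεm' : 4 * ε ≤ m := by nlinarith
  obtain ⟨P, hP, hPH⟩ := smooth_approx cylCoe cylCoe_inj hH hε0
  let G : ℝ × (Fin 4 → ℝ) → ℝ × (Fin 4 → ℝ) := fun z => P z + (1 - z.1) • (F z.2 - P (0, z.2))
  have hG : ContDiff ℝ ∞ G := by fun_prop
  have hGH : ∀ z, ‖G (cylCoe z) - H z‖ < 2 * ε := by
    rintro ⟨t, y⟩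
    have a1 := hPH (t, y)
    have a2 := hPH (0, y)
    rw [h0] at a2
    have e : G (cylCoe (t, y)) - H (t, y) = (P (cylCoe (t, y)) - H (t, y)) + (1 - (t : ℝ)) • (F (cubeCoe y) - P (cylCoe (0, y))) := by
      simp only [G, cylCoe, ContinuousMap.coe_mk, Set.Icc.coe_zero]; abel
    rw [e]
    refine (norm_add_le _ _).trans_lt ?_
    rw [norm_smul, Real.norm_of_nonneg (by linarith [t.2.2]), norm_sub_rev (F (cubeCoe y))]
    have : (1 - (t : ℝ)) * ‖P (cylCoe (0, y)) - F (cubeCoe y)‖ ≤ 1 * ‖P (cylCoe (0, y)) - F (cubeCoe y)‖ := by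
      gcongr; linarith [t.2.1]
    linarith
  have hGn : ∀ z, m / 2 ≤ ‖G (cylCoe z)‖ := by
    intro z
    have b1 := hGH z
    have b2 := hmin z
    have b3 := norm_sub_norm_le (H z) (G (cylCoe z))
    rw [norm_sub_rev] at b3
    linarith
  have hGb : ∀ t, ∀ y ∈ Cube.boundary (Fin 4), ¬ Neg0 (G (cylCoe (t, y))) := by
    rintro t y hy ⟨g1, g2⟩
    have b1 := hGH (t, y)
    have b2 := hmin (t, y)
    have b3 := hR (t, y) ⟨trivial, hy⟩
    have c1 := (norm_fst_le _).trans_lt b1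
    have c2 := (norm_snd_le _).trans_lt b1
    rw [Prod.fst_sub, Real.norm_eq_abs, abs_lt] at c1
    rw [Prod.snd_sub, g1, zero_sub, norm_neg] at c2
    have c3 : R * ‖(H (t, y)).2‖ ≤ R * (2 * ε) := by gcongr
    have c4 : ‖H (t, y)‖ < m := by
      rw [Prod.norm_def, max_lt_iff]
      constructor
      · rw [Real.norm_eq_abs, abs_lt]
        constructor <;> nlinarith
      · nlinarith
    linarith
  set S := 2 / m + 1 with hS
  have hS1 : 1 < S := by rw [hS]; have : 0 < 2 / m := by positivity
                         linarith
  have hSm : 1 < S * (m / 2) := by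
    have : S * (m / 2) = 1 + m / 2 := by rw [hS]; field_simp
    linarith
  let Q : (Fin 6 → ℝ) → (Fin 5 → ℝ) := fun z => z 1 • e5 (G (z 0, fun i => z i.succ.succ))
  have hQ : ContDiff ℝ ∞ Q := by
    have := contDiff_e5 (f := fun z : Fin 6 → ℝ => G (z 0, fun i => z i.succ.succ)) (hG.comp (by fun_prop))
    fun_prop
  let b : Fin 6 → ℝ := Fin.cons 1 (Fin.cons S 1)
  have hb0 : b 0 = 1 := rfl
  have hb1 : b 1 = S := rfl
  have hb2 : ∀ i : Fin 4, b i.succ.succ = 1 := fun i => rfl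
  have hab : (0 : Fin 6 → ℝ) ≤ b := by
    intro i
    refine Fin.cases ?_ (fun i => Fin.cases ?_ (fun i => ?_) i) i
    · rw [hb0]; simp
    · change 0 ≤ S; linarith
    · rw [hb2]; simp
  have hpar : ∀ z ∈ Icc (0 : Fin 6 → ℝ) b, ∃ (t : I) (y : I^(Fin 4)), (t : ℝ) = z 0 ∧
      (∀ i, (y i : ℝ) = z i.succ.succ) ∧ Q z = z 1 • e5 (G (cylCoe (t, y))) := by
    intro z hz
    refine ⟨⟨z 0, hz.1 0, hz.2 0⟩, fun i => ⟨z i.succ.succ, hz.1 _, hz.2 _⟩, rfl, fun _ => rfl, rfl⟩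
  have hfaceset : ∀ z ∈ Icc (0 : Fin 6 → ℝ) b, ∀ i : Fin 5, (z i.succ = 0 ∨ z i.succ = b i.succ) → Q z ≠ pt5 := by
    intro z hz i hi hQz
    obtain ⟨t, y, ht, hy, hq⟩ := hpar z hz
    rw [hq] at hQz
    obtain ⟨q1, q2⟩ := smul_e5_eq hQz
    have hz1 : 0 ≤ z 1 := hz.1 1
    have hz1' : 0 < z 1 := lt_of_le_of_ne hz1 (fun h => by rw [← h] at q1; norm_num at q1)
    have hg2 : (G (cylCoe (t, y))).2 = 0 := (smul_eq_zero.1 q2).resolve_left hz1'.ne'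
    have hg1 : (G (cylCoe (t, y))).1 < 0 := by
      by_contra hcon
      nlinarith [mul_nonneg hz1 (not_lt.1 hcon)]
    revert hi
    refine Fin.cases ?_ (fun l => ?_) i
    · intro hi
      change z 1 = 0 ∨ z 1 = S at hi
      rcases hi with hi | hi
      · exact hz1'.ne' hi
      · have := hGn (t, y)
        rw [Prod.norm_def, hg2, norm_zero, max_eq_left (norm_nonneg _), Real.norm_eq_abs, abs_of_neg hg1] at this
        rw [hi] at q1
        nlinarith
    · intro hi
      rw [hb2] at hi
      refine hGb t y ⟨l, ?_⟩ ⟨hg2, hg1.le⟩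
      rw [← hy l] at hi
      rcases hi with hi | hi
      · left; exact Subtype.ext hi
      · right; exact Subtype.ext hi
  have hδ : ∃ δ > 0, ∀ z ∈ Icc (0 : Fin 6 → ℝ) b, ∀ i : Fin 5, (z i.succ = 0 ∨ z i.succ = b i.succ) → δ ≤ dist (Q z) pt5 := by
    let K : Set (Fin 6 → ℝ) := Icc 0 b ∩ ⋃ i : Fin 5, ({z | z i.succ = 0} ∪ {z | z i.succ = b i.succ})
    have hK : IsCompact K := by
      refine isCompact_Icc.inter_right (isClosed_iUnion_of_finite fun i => IsClosed.union ?_ ?_)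
      · exact isClosed_eq (by fun_prop) (by fun_prop)
      · exact isClosed_eq (by fun_prop) (by fun_prop)
    have hKm : ∀ z ∈ Icc (0 : Fin 6 → ℝ) b, ∀ i : Fin 5, (z i.succ = 0 ∨ z i.succ = b i.succ) → z ∈ K :=
      fun z hz i hi => ⟨hz, mem_iUnion.2 ⟨i, hi⟩⟩
    have hKne : K.Nonempty := ⟨0, hKm 0 ⟨le_rfl, hab⟩ 0 (Or.inl rfl)⟩
    have hQc : Continuous Q := hQ.continuous
    obtain ⟨z0, hz0, hzm⟩ := hK.exists_isMinOn hKne (f := fun z => dist (Q z) pt5) (by fun_prop)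
    refine ⟨dist (Q z0) pt5, dist_pos.2 ?_, fun z hz i hi => hzm (hKm z hz i hi)⟩
    obtain ⟨i, hi⟩ := mem_iUnion.1 hz0.2
    exact hfaceset z0 hz0.1 i hi
  obtain ⟨δ, hδ0, hδ⟩ := hδ
  refine ⟨min δ 1, lt_min hδ0 one_pos, S, hS1, fun ρ hρ hsupp => ?_⟩
  have hdeg := degree_lemma (Q := Q) (contDiff_infty.1 hQ 2) hρ hab (by
    intro z hz i hi
    exact hsupp _ ((min_le_left _ _).trans (hδ z hz i hi)))
  have hQ0 : (fun w : Fin 5 → ℝ => Q (Fin.cons ((0 : Fin 6 → ℝ) 0) w)) = cone5 F := by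
    funext w
    simp only [Q, cone5, G]
    change w 0 • e5 (P (0, fun i => w i.succ) + (1 - (0:ℝ)) • (F (fun i => w i.succ) - P (0, fun i => w i.succ))) = _
    congr 2
    simp
  have hI : (Icc (fun i : Fin 5 => (0 : Fin 6 → ℝ) i.succ) (fun i => b i.succ)) = Icc (0 : Fin 5 → ℝ) (Fin.cons S 1) := rfl
  rw [hI] at hdeg
  have e : ∀ w : Fin 5 → ℝ, ρ (Q (Fin.cons ((0 : Fin 6 → ℝ) 0) w)) = ρ (cone5 F w) := by
    intro w; rw [← hQ0]
  rw [hQ0] at hdeg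
  simp only [e] at hdeg
  rw [hdeg, setIntegral_congr_fun (g := fun _ => 0) measurableSet_Icc]
  · simp
  · intro w hw
    simp only
    have hz : (Fin.cons (b 0) w : Fin 6 → ℝ) ∈ Icc (0 : Fin 6 → ℝ) b := by
      constructor
      · intro i
        refine Fin.cases ?_ (fun i => ?_) i
        · simp [hb0]
        · simpa using hw.1 i
      · intro i
        refine Fin.cases ?_ (fun i => ?_) i
        · simp
        · exact hw.2 i
    obtain ⟨t, y, ht, hy, hq⟩ := hpar _ hz
    have ht1 : t = 1 := Subtype.ext (by rw [ht]; simp [hb0])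
    rw [hsupp, zero_mul]
    refine (min_le_right _ _).trans ?_
    rw [hq]
    have b1 := hGH (t, y)
    rw [ht1, h1] at b1
    have c1 := (norm_fst_le _).trans_lt b1
    rw [Prod.fst_sub, Real.norm_eq_abs, abs_lt] at c1
    have c2 := dist_le_pi_dist ((Fin.cons (b 0) w : Fin 6 → ℝ) 1 • e5 (G (cylCoe (t, y)))) pt5 0
    refine le_trans ?_ c2
    rw [Real.dist_eq]
    have c3 : (0 : ℝ) ≤ (Fin.cons (b 0) w : Fin 6 → ℝ) 1 := hz.1 1
    simp only [Pi.smul_apply, e5, pt5, Fin.cons_zero, smul_eq_mul, ht1]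
    refine le_trans ?_ (le_abs_self _)
    have : 0 ≤ (G (cylCoe (1, y))).1 := by linarith
    nlinarith [mul_nonneg c3 this]
end ORDER

section INFORD
set_option linter.unusedSectionVars false
open Matrix Set MeasureTheory
open scoped ContDiff

/-- the winding maps -/
def wnd (c : ℝ) (y : Fin 4 → ℝ) : ℝ × (Fin 4 → ℝ) :=
  (Real.cos (c * y 0), ![Real.sin (c * y 0), y 1 - 1/2, y 2 - 1/2, y 3 - 1/2])

theorem contDiff_wnd (c : ℝ) : ContDiff ℝ ∞ (wnd c) := by
  unfold wnd
  refine ContDiff.prodMk ?_ ?_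
  · exact Real.contDiff_cos.comp (by fun_prop)
  · rw [contDiff_pi]
    intro i
    fin_cases i
    · exact Real.contDiff_sin.comp (by fun_prop)
    · change ContDiff ℝ ∞ fun y : Fin 4 → ℝ => y 1 - 1/2
      fun_prop
    · change ContDiff ℝ ∞ fun y : Fin 4 → ℝ => y 2 - 1/2
      fun_prop
    · change ContDiff ℝ ∞ fun y : Fin 4 → ℝ => y 3 - 1/2
      fun_prop

theorem wnd_ne (c : ℝ) (y : Fin 4 → ℝ) : wnd c y ≠ 0 := by
  intro h
  have h1 := congrArg Prod.fst h
  have h2 := congrFun (congrArg Prod.snd h) 0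
  simp [wnd] at h1 h2
  have := Real.sin_sq_add_cos_sq (c * y 0)
  rw [h1, h2] at this
  norm_num at this

theorem wnd_adm (k : ℕ) : Adm (fun y => wnd (2 * Real.pi * k) (cubeCoe y)) := by
  refine ⟨(contDiff_wnd _).continuous.comp cubeCoe.2, fun y => wnd_ne _ _, ?_⟩
  rintro y ⟨i, hi⟩ ⟨h2, h1⟩
  have e1 := congrFun h2 1
  have e2 := congrFun h2 2
  have e3 := congrFun h2 3
  simp [wnd, cubeCoe] at e1 e2 e3 h1
  fin_cases i
  · rcases hi with hi | hi
    · have : y 0 = 0 := hi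
      rw [this] at h1
      norm_num at h1
    · have : y 0 = 1 := hi
      rw [this] at h1
      have h3 : Real.cos (2 * Real.pi * k) = 1 := by
        rw [mul_comm]; exact Real.cos_nat_mul_two_pi k
      norm_num [h3] at h1
  · rcases hi with hi | hi
    · have : y 1 = 0 := hi
      rw [this] at e1
      norm_num at e1
    · have : y 1 = 1 := hi
      rw [this] at e1
      norm_num at e1
  · rcases hi with hi | hi
    · have : y 2 = 0 := hi
      rw [this] at e2
      norm_num at e2
    · have : y 2 = 1 := hi
      rw [this] at e2
      norm_num at e2
  · rcases hi with hi | hi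
    · have : y 3 = 0 := hi
      rw [this] at e3
      norm_num at e3
    · have : y 3 = 1 := hi
      rw [this] at e3
      norm_num at e3

/-- class of the winding map -/
def wcl (k : ℕ) : HomotopyGroup (Fin 4) (WW (Fin 4 → ℝ)) (wb (Fin 4 → ℝ)) :=
  cl (fun y => wnd (2 * Real.pi * k) (cubeCoe y))

theorem wcl_succ (k : ℕ) (hk : 1 ≤ k) : wcl (k + 1) = wcl k * wcl 1 := by
  have hk0 : (1 : ℝ) ≤ k := by exact_mod_cast hk
  have hpos : (0 : ℝ) < (k : ℝ) + 1 := by linarith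
  have hs0 : (0 : ℝ) < 1 / ((k : ℝ) + 1) := by positivity
  have hs1 : 1 / ((k : ℝ) + 1) < 1 := by
    rw [div_lt_one hpos]; linarith
  unfold wcl
  rw [cl_split (0 : Fin 4) hs0 hs1 (wnd_adm (k + 1))]
  · congr 2
    · funext t
      have ht0 := (t 0).2.1
      have ht1 := (t 0).2.2
      have : (prI (1 / ((k : ℝ) + 1) + (1 - 1 / ((k : ℝ) + 1)) * t 0) : ℝ) = 1 / ((k : ℝ) + 1) + (1 - 1 / ((k : ℝ) + 1)) * t 0 := by
        apply prI_coe
        · nlinarith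
        · nlinarith
      have e : 2 * Real.pi * ((k + 1 : ℕ) : ℝ) * (1 / ((k : ℝ) + 1) + (1 - 1 / ((k : ℝ) + 1)) * t 0) = 2 * Real.pi * k * t 0 + 2 * Real.pi := by
        push_cast
        field_simp
        ring
      simp only [wnd, cubeCoe, ContinuousMap.coe_mk, Function.update_self, this, e, Real.cos_add_two_pi, Real.sin_add_two_pi]
      simp
    · funext t
      have ht0 := (t 0).2.1
      have ht1 := (t 0).2.2
      have : (prI (1 / ((k : ℝ) + 1) * t 0) : ℝ) = 1 / ((k : ℝ) + 1) * t 0 := by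
        apply prI_coe
        · nlinarith
        · nlinarith
      have e : 2 * Real.pi * ((k + 1 : ℕ) : ℝ) * (1 / ((k : ℝ) + 1) * t 0) = 2 * Real.pi * (1 : ℕ) * t 0 := by
        push_cast
        field_simp
      simp only [wnd, cubeCoe, ContinuousMap.coe_mk, Function.update_self, this, e]
      simp
  · rintro t ht ⟨-, h1⟩
    simp only [wnd, cubeCoe, ContinuousMap.coe_mk, ht] at h1
    have e : 2 * Real.pi * ((k + 1 : ℕ) : ℝ) * (1 / ((k : ℝ) + 1)) = 2 * Real.pi := by
      push_cast
      field_simp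
    rw [e, Real.cos_two_pi] at h1
    norm_num at h1

theorem wcl_pow (k : ℕ) (hk : 1 ≤ k) : wcl k = wcl 1 ^ k := by
  induction k, hk using Nat.le_induction with
  | base => simp
  | succ k hk ih => rw [wcl_succ k hk, ih, pow_succ]

/-- the Jacobian -/
def wndJ (c : ℝ) (w : Fin 5 → ℝ) : Matrix (Fin 5) (Fin 5) ℝ :=
  !![Real.cos (c * w 1), -(c * w 0 * Real.sin (c * w 1)), 0, 0, 0;
     Real.sin (c * w 1), c * w 0 * Real.cos (c * w 1), 0, 0, 0;
     w 2 - 1/2, 0, w 0, 0, 0;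
     w 3 - 1/2, 0, 0, w 0, 0;
     w 4 - 1/2, 0, 0, 0, w 0]

theorem wndJ_det (c : ℝ) (w : Fin 5 → ℝ) : (wndJ c w).det = c * (w 0)^4 := by
  have := Real.sin_sq_add_cos_sq (c * w 1)
  simp [wndJ, Matrix.det_succ_row_zero, Fin.sum_univ_succ, Fin.succAbove]
  linear_combination (c * (w 0)^4) * this

theorem wnd_deriv (c : ℝ) (w : Fin 5 → ℝ) :
    HasFDerivAt (cone5 (wnd c)) (LinearMap.toContinuousLinearMap (Matrix.toLin' (wndJ c w))) w := by
  have hp : ∀ i : Fin 5, HasFDerivAt (fun w : Fin 5 → ℝ => w i) (ContinuousLinearMap.proj (R := ℝ) (φ := fun _ : Fin 5 => ℝ) i) w := fun i => hasFDerivAt_apply i w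
  rw [hasFDerivAt_pi']
  intro i
  fin_cases i
  · have := (hp 0).mul ((hp 1).const_mul c).cos
    refine this.congr_fderiv ?_
    ext v
    simp [wndJ, Matrix.vecHead, Matrix.vecTail]
    ring
  · have := (hp 0).mul ((hp 1).const_mul c).sin
    refine this.congr_fderiv ?_
    ext v
    simp [wndJ, Matrix.vecHead, Matrix.vecTail]
    ring
  · have := (hp 0).mul ((hp 2).sub_const (1/2))
    refine this.congr_fderiv ?_
    ext v
    simp [wndJ, Matrix.vecHead, Matrix.vecTail]
    ring
  · have := (hp 0).mul ((hp 3).sub_const (1/2))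
    refine this.congr_fderiv ?_
    ext v
    simp [wndJ, Matrix.vecHead, Matrix.vecTail]
    ring
  · have := (hp 0).mul ((hp 4).sub_const (1/2))
    refine this.congr_fderiv ?_
    ext v
    simp [wndJ, Matrix.vecHead, Matrix.vecTail]
    ring

theorem wnd_fderiv_det (c : ℝ) (w : Fin 5 → ℝ) : (fderiv ℝ (cone5 (wnd c)) w).det = c * (w 0)^4 := by
  rw [(wnd_deriv c w).fderiv, ContinuousLinearMap.det, ← wndJ_det]
  simp

end INFORD

section INFORD2
set_option linter.unusedSectionVars false
open Matrix Set MeasureTheory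
open scoped ContDiff

theorem wcl_ne_one (k : ℕ) (hk : 1 ≤ k) : wcl k ≠ 1 := by
  intro h1
  have hk0 : (1 : ℝ) ≤ k := by exact_mod_cast hk
  have hpi := Real.pi_pos
  set c := 2 * Real.pi * k with hc
  have hcpos : 0 < c := by positivity
  have hA := wnd_adm k
  obtain ⟨R, hR⟩ := hA.exists_RGood
  rw [wcl, cl_eq hA hR, piMk_one] at h1
  obtain ⟨H, hHc, hH0, hH1, hHb⟩ := piMk_exact h1
  set f : (I^(Fin 4)) → ℝ × (Fin 4 → ℝ) := fun y => wnd c (cubeCoe y) with hf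
  set HH : I × (I^(Fin 4)) → ℝ × (Fin 4 → ℝ) := fun z =>
    if (z.1 : ℝ) ≤ 1/2 then (1 - 2 * (z.1 : ℝ)) • f z.2 + (2 * (z.1:ℝ)) • kap R (f z.2)
    else (H (prI (2 * z.1 - 1), z.2) : ℝ × (Fin 4 → ℝ)) with hHH
  have hkc : Continuous fun z : I × (I^(Fin 4)) => kap R (f z.2) :=
    continuous_kap continuous_const (hA.cont.comp continuous_snd) (fun _ => hR.1) (fun z => hA.ne _)
  have hfc : Continuous fun z : I × (I^(Fin 4)) => f z.2 := hA.cont.comp continuous_snd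
  have hcp := continuous_prI
  have hHHc : Continuous HH := by
    refine Continuous.if_le ?_ ?_ (by fun_prop) (by fun_prop) ?_
    · exact Continuous.add (Continuous.smul (f := fun z : I × (I^(Fin 4)) => 1 - 2 * (z.1 : ℝ)) (by fun_prop) hfc) (Continuous.smul (f := fun z : I × (I^(Fin 4)) => 2 * (z.1 : ℝ)) (by fun_prop) hkc)
    · exact continuous_subtype_val.comp (hHc.comp (by fun_prop))
    · intro z hz
      rw [hz]
      norm_num
      rw [prI_zero, hH0]
      rfl
  obtain ⟨δ, hδ, S, hS, hdeg⟩ := degree_zero (contDiff_wnd c) (H := HH) hHHc (by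
      intro z
      simp only [hHH]
      split_ifs with hz
      · exact kap_line_ne_zero hR.1 (hA.ne _) _ (by linarith [z.1.2.1]) (by linarith)
      · exact (H _).2) (by
      intro t y hy
      simp only [hHH]
      split_ifs with hz
      · rw [kap_eq_base (hR.2 y hy)]
        rintro ⟨h2, h3⟩
        simp only [Prod.snd_add, Prod.smul_snd, smul_zero, add_zero, Prod.fst_add, Prod.smul_fst, smul_eq_mul, mul_one] at h2 h3
        rcases smul_eq_zero.1 h2 with h4 | h4
        · rw [h4] at h3; linarith
        · have hn := hA.bd y hy
          have : 0 < (f y).1 := by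
            by_contra hcon
            exact hn ⟨h4, not_lt.1 hcon⟩
          have := t.2.1
          have e1 : 0 ≤ (1 - 2 * (t:ℝ)) * (f y).1 := mul_nonneg (by linarith) (by linarith)
          have e2 : (t : ℝ) = 0 := by linarith
          rw [e2] at h3
          linarith
      · rw [hHb _ y hy]
        rintro ⟨h2, h3⟩
        simp only [wb] at h3
        linarith) (by
      intro y
      simp [hHH]
      rfl) (by
      intro y
      simp only [hHH]
      norm_num
      rw [prI_one, hH1]
      rfl)
  let B : ContDiffBump (pt5) := ⟨δ / 2, δ, by linarith, by linarith⟩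
  have hd := hdeg B (B.contDiff) (fun v hv => B.zero_of_le_dist hv)
  simp only [wnd_fderiv_det] at hd
  set J : (Fin 5 → ℝ) → ℝ := fun w => B (cone5 (wnd c) w) * (c * w 0 ^ 4) with hJ
  have hcone : Continuous (cone5 (wnd c)) := by
    rw [continuous_iff_continuousAt]
    exact fun w => (wnd_deriv c w).continuousAt
  have hJc : Continuous J := by
    have := B.continuous
    fun_prop
  have hJ0 : ∀ w, 0 ≤ J w := fun w => mul_nonneg B.nonneg (by positivity)
  have hkpos : (0 : ℝ) < k := by linarith
  set w0 : Fin 5 → ℝ := ![1, 1 / (2 * k), 1/2, 1/2, 1/2] with hw0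
  have hcw : cone5 (wnd c) w0 = pt5 := by
    have e : c * (1 / (2 * k)) = Real.pi := by rw [hc]; field_simp
    have e' : c * ((k : ℝ)⁻¹ * 2⁻¹) = Real.pi := by rw [hc]; field_simp
    funext i
    fin_cases i <;> simp [cone5, wnd, w0, e5, pt5, e']
    · rfl
    · rfl
    · rfl
  have hJw : 0 < J w0 := by
    simp only [hJ]
    rw [hcw]
    have : B pt5 = 1 := B.one_of_mem_closedBall (by simp only [Metric.mem_closedBall, dist_self, B]; linarith)
    rw [this]
    simp [w0, hcpos]
  have hmem : w0 ∈ interior (Icc (0 : Fin 5 → ℝ) (Fin.cons S 1)) := by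
    rw [← pi_univ_Icc, interior_pi_set finite_univ]
    intro i _
    change w0 i ∈ interior (Icc _ _)
    rw [interior_Icc]
    have h2k : 1 / (2 * (k:ℝ)) < 1 := by
      rw [div_lt_one (by positivity)]; linarith
    have h2k' : 0 < 1 / (2 * (k:ℝ)) := by positivity
    fin_cases i
    · exact ⟨by simp [w0], by simpa [w0] using hS⟩
    · exact ⟨h2k', h2k⟩
    · exact ⟨by change (0:ℝ) < 1/2; norm_num, by change (1/2:ℝ) < 1; norm_num⟩
    · exact ⟨by change (0:ℝ) < 1/2; norm_num, by change (1/2:ℝ) < 1; norm_num⟩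
    · exact ⟨by change (0:ℝ) < 1/2; norm_num, by change (1/2:ℝ) < 1; norm_num⟩
  have hJint : IntegrableOn J (Icc (0 : Fin 5 → ℝ) (Fin.cons S 1)) := hJc.continuousOn.integrableOn_compact isCompact_Icc
  have hpos : 0 < ∫ w in Icc (0 : Fin 5 → ℝ) (Fin.cons S 1), J w := by
    rw [setIntegral_pos_iff_support_of_nonneg_ae (Filter.Eventually.of_forall hJ0) hJint]
    have hop : IsOpen (Function.support J ∩ interior (Icc (0 : Fin 5 → ℝ) (Fin.cons S 1))) :=
      (hJc.isOpen_support).inter isOpen_interior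
    refine lt_of_lt_of_le (hop.measure_pos volume ⟨w0, hJw.ne', hmem⟩) (measure_mono ?_)
    exact inter_subset_inter_right _ interior_subset
  have hposne := hpos.ne'
  exact hposne hd

/-- `π₄` of the punctured `ℝ⁵` -/
theorem pi4_WW : Nonempty (HomotopyGroup (Fin 4) (WW (Fin 4 → ℝ)) (wb (Fin 4 → ℝ)) ≃* Multiplicative ℤ) := by
  have hcyc : ∀ c, c ∈ Subgroup.zpowers (gg (N := Fin 4)) := cyclic
  have hord : ∀ n : ℕ, 0 < n → gg (N := Fin 4) ^ n ≠ 1 := by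
    intro n hn h
    obtain ⟨m, hm⟩ := hcyc (wcl 1)
    apply wcl_ne_one n hn
    rw [wcl_pow n hn, ← hm]
    simp only
    rw [← _root_.zpow_natCast, ← _root_.zpow_mul, mul_comm, _root_.zpow_mul, _root_.zpow_natCast, h, _root_.one_zpow]
  have hinf : orderOf (gg (N := Fin 4)) = 0 := by
    rw [orderOf_eq_zero_iff']
    exact hord
  have hinj : Function.Injective (zpowersHom _ (gg (N := Fin 4))) := by
    intro a b hab
    have := injective_zpow_iff_not_isOfFinOrder.2 (orderOf_eq_zero_iff.1 hinf)
    exact this hab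
  refine ⟨(MulEquiv.ofBijective (zpowersHom _ (gg (N := Fin 4))) ⟨hinj, ?_⟩).symm⟩
  intro c
  obtain ⟨m, hm⟩ := hcyc c
  exact ⟨Multiplicative.ofAdd m, hm⟩

end INFORD2

section TT
set_option linter.unusedSectionVars false
open Matrix

theorem refl_unitary {n m R : Type*} [Fintype n] [DecidableEq n] [Fintype m] [DecidableEq m] [Ring R] [StarRing R]
    {w : Matrix n m R} {α β : Matrix m m R} (h1 : α * β = 1) (h2 : β * α = 1) (hw : wᴴ * w = β + βᴴ) :
    1 - w * α * wᴴ ∈ unitary (Matrix n n R) := by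
  have h1' : βᴴ * αᴴ = 1 := by rw [← conjTranspose_mul, h1, conjTranspose_one]
  have h2' : αᴴ * βᴴ = 1 := by rw [← conjTranspose_mul, h2, conjTranspose_one]
  have k1 : αᴴ * (wᴴ * w) * α = αᴴ + α := by
    rw [hw, mul_add, add_mul, mul_assoc, h2, mul_one, h2', one_mul]
  have k2 : α * (wᴴ * w) * αᴴ = αᴴ + α := by
    rw [hw, mul_add, add_mul, h1, one_mul, mul_assoc, h1', mul_one]
  have hs : star (1 - w * α * wᴴ) = 1 - w * αᴴ * wᴴ := by
    rw [star_eq_conjTranspose]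
    simp [conjTranspose_mul, Matrix.mul_assoc]
  have e1 : w * αᴴ * wᴴ * (w * α * wᴴ) = w * (αᴴ * (wᴴ * w) * α) * wᴴ := by
    simp only [Matrix.mul_assoc]
  have e2 : w * α * wᴴ * (w * αᴴ * wᴴ) = w * (α * (wᴴ * w) * αᴴ) * wᴴ := by
    simp only [Matrix.mul_assoc]
  rw [Unitary.mem_iff, hs]
  constructor
  · rw [sub_mul, one_mul, mul_sub, mul_one, e1, k1, Matrix.mul_add, Matrix.add_mul]
    abel
  · rw [sub_mul, one_mul, mul_sub, mul_one, e2, k2, Matrix.mul_add, Matrix.add_mul]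
    abel

instance starModQ : StarModule ℝ ℍ[ℝ] := ⟨fun r q => by ext <;> simp⟩

/-- quaternionic vectors -/
abbrev VH : Type := Fin 3 → ℍ[ℝ]

/-- column matrix -/
def colM (v : VH) : Matrix (Fin 3) (Fin 1) ℍ[ℝ] := Matrix.of fun i _ => v i

/-- unit vectors -/
def UnitV (v : VH) : Prop := ∑ i, ‖v i‖ ^ 2 = 1

theorem star_mul_norm (q : ℍ[ℝ]) : star q * q = ((‖q‖^2 : ℝ) : ℍ[ℝ]) := by
  rw [Quaternion.star_mul_self, Quaternion.normSq_eq_norm_mul_self, sq]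

theorem mul_star_norm (q : ℍ[ℝ]) : q * star q = ((‖q‖^2 : ℝ) : ℍ[ℝ]) := by
  rw [Quaternion.self_mul_star, Quaternion.normSq_eq_norm_mul_self, sq]

theorem colM_mul (a b : VH) : (colM a)ᴴ * colM b = Matrix.of fun _ _ => ∑ i, star (a i) * b i := by
  refine Matrix.ext fun i j => ?_
  simp [Matrix.mul_apply, colM]

theorem UnitV.col {v : VH} (h : UnitV v) : (colM v)ᴴ * colM v = 1 := by
  rw [colM_mul]
  have e : ∑ i, star (v i) * v i = 1 := by
    simp only [star_mul_norm]
    unfold UnitV at h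
    have := congrArg (fun r : ℝ => (r : ℍ[ℝ])) h
    simp only [Fin.sum_univ_three] at this ⊢
    push_cast at this ⊢
    exact this
  refine Matrix.ext fun i j => ?_
  rw [Matrix.of_apply, e, Subsingleton.elim i j, Matrix.one_apply_eq]

/-- the coefficient -/
def bet (a b : VH) : ℍ[ℝ] := 1 + ∑ i, star (a i) * b i

theorem bet_ne {a b : VH} (ha : UnitV a) (hb : UnitV b) (h : a ≠ -b) : bet a b ≠ 0 := by
  intro h0
  apply h
  have hre : (bet a b).re = 0 := by rw [h0]; rfl
  have key : ∑ i, ‖a i + b i‖^2 = 0 := by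
    have : ∀ i, ‖a i + b i‖^2 = ‖a i‖^2 + ‖b i‖^2 + 2 * (star (a i) * b i).re := by
      intro i
      simp only [sq, ← Quaternion.normSq_eq_norm_mul_self, Quaternion.normSq_def']
      simp [Quaternion.re_mul]
      ring
    simp only [this, Finset.sum_add_distrib, ← Finset.mul_sum]
    unfold UnitV at ha hb
    rw [ha, hb]
    have e : (bet a b).re = 1 + ∑ i, (star (a i) * b i).re := by
      simp [bet, Fin.sum_univ_three]
    rw [hre] at e
    linarith
  funext i
  have := (Finset.sum_eq_zero_iff_of_nonneg (fun i _ => by positivity)).1 key i (Finset.mem_univ i)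
  have h2 : a i + b i = 0 := by
    simpa using this
  exact eq_neg_of_add_eq_zero_left h2

/-- the rotation matrix -/
def Tm (a b : VH) : Matrix (Fin 3) (Fin 3) ℍ[ℝ] :=
  (1 - colM (a + b) * (Matrix.of fun _ _ => (bet a b)⁻¹ : Matrix (Fin 1) (Fin 1) ℍ[ℝ]) * (colM (a + b))ᴴ) *
  (1 - colM b * (2 : Matrix (Fin 1) (Fin 1) ℍ[ℝ]) * (colM b)ᴴ)

theorem of_mul1 (p q : ℍ[ℝ]) : (Matrix.of fun _ _ => p : Matrix (Fin 1) (Fin 1) ℍ[ℝ]) * (Matrix.of fun _ _ => q : Matrix (Fin 1) (Fin 1) ℍ[ℝ]) = Matrix.of fun _ _ => p * q := by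
  refine Matrix.ext fun i j => ?_
  simp [Matrix.mul_apply]

theorem of_one1 : (Matrix.of fun _ _ => 1 : Matrix (Fin 1) (Fin 1) ℍ[ℝ]) = 1 := by
  refine Matrix.ext fun i j => ?_
  rw [Matrix.of_apply, Subsingleton.elim i j, Matrix.one_apply_eq]

theorem colM_add (a b : VH) : colM (a + b) = colM a + colM b := rfl

theorem colw {a b : VH} (hb : UnitV b) :
    (colM (a + b))ᴴ * colM b = Matrix.of fun _ _ => bet a b := by
  rw [colM_add, conjTranspose_add, Matrix.add_mul, hb.col, colM_mul, ← of_one1]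
  refine Matrix.ext fun i j => ?_
  simp [bet, add_comm]

theorem colww {a b : VH} (ha : UnitV a) (hb : UnitV b) :
    (colM (a + b))ᴴ * colM (a + b) = (Matrix.of fun _ _ => bet a b) + (Matrix.of fun _ _ => bet a b)ᴴ := by
  rw [← colw hb]
  rw [conjTranspose_mul, conjTranspose_conjTranspose, colM_add, conjTranspose_add]
  simp only [Matrix.add_mul, Matrix.mul_add, ha.col, hb.col]
  abel

theorem half2 : ((2⁻¹ : ℝ) • (1 : Matrix (Fin 1) (Fin 1) ℍ[ℝ])) * 2 = 1 := by
  rw [smul_mul_assoc, one_mul]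
  have : (2 : Matrix (Fin 1) (Fin 1) ℍ[ℝ]) = (2 : ℝ) • 1 := by
    rw [two_smul]; norm_num
  rw [this, smul_smul]
  norm_num

theorem half2' : (2 : Matrix (Fin 1) (Fin 1) ℍ[ℝ]) * ((2⁻¹ : ℝ) • (1 : Matrix (Fin 1) (Fin 1) ℍ[ℝ])) = 1 := by
  rw [mul_smul_comm, mul_one]
  have : (2 : Matrix (Fin 1) (Fin 1) ℍ[ℝ]) = (2 : ℝ) • 1 := by
    rw [two_smul]; norm_num
  rw [this, smul_smul]
  norm_num

theorem refl2_mem {b : VH} (hb : UnitV b) :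
    (1 - colM b * (2 : Matrix (Fin 1) (Fin 1) ℍ[ℝ]) * (colM b)ᴴ) ∈ unitary (Matrix (Fin 3) (Fin 3) ℍ[ℝ]) := by
  refine refl_unitary half2' half2 ?_
  rw [hb.col, conjTranspose_smul, conjTranspose_one]
  simp only [star_trivial]
  rw [← add_smul]
  norm_num

theorem Tm_mem {a b : VH} (ha : UnitV a) (hb : UnitV b) (h : a ≠ -b) : Tm a b ∈ unitary (Matrix (Fin 3) (Fin 3) ℍ[ℝ]) := by
  have hbe := bet_ne ha hb h
  refine mul_mem (refl_unitary (β := Matrix.of fun _ _ => bet a b) ?_ ?_ (colww ha hb)) (refl2_mem hb)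
  · rw [of_mul1, inv_mul_cancel₀ hbe, of_one1]
  · rw [of_mul1, mul_inv_cancel₀ hbe, of_one1]

theorem Tm_col {a b : VH} (ha : UnitV a) (hb : UnitV b) (h : a ≠ -b) : Tm a b * colM b = colM a := by
  have hbe := bet_ne ha hb h
  have e1 : (1 - colM b * (2 : Matrix (Fin 1) (Fin 1) ℍ[ℝ]) * (colM b)ᴴ) * colM b = - colM b := by
    rw [Matrix.sub_mul, Matrix.one_mul, Matrix.mul_assoc, hb.col, Matrix.mul_one]
    have : colM b * (2 : Matrix (Fin 1) (Fin 1) ℍ[ℝ]) = colM b + colM b := by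
      rw [← one_add_one_eq_two, Matrix.mul_add, Matrix.mul_one]
    rw [this]; abel
  unfold Tm
  rw [Matrix.mul_assoc, e1, Matrix.mul_neg, Matrix.sub_mul, Matrix.one_mul, Matrix.mul_assoc, colw hb,
    Matrix.mul_assoc, of_mul1, inv_mul_cancel₀ hbe, of_one1, Matrix.mul_one, colM_add]
  abel

theorem Tm_self {a : VH} (ha : UnitV a) : Tm a a = 1 := by
  have hb : bet a a = 2 := by
    have := ha.col
    rw [colM_mul] at this
    have := congrFun (congrFun this 0) 0
    simp only [Matrix.of_apply, Matrix.one_apply_eq] at this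
    rw [bet, this]; norm_num
  have hw : (colM (a + a)) = (2 : ℝ) • colM a := by rw [two_smul]; rfl
  have h2 : (2 : Matrix (Fin 1) (Fin 1) ℍ[ℝ]) = (2 : ℝ) • 1 := by
    rw [two_smul]; norm_num
  have h3 : (Matrix.of fun _ _ => (bet a a)⁻¹ : Matrix (Fin 1) (Fin 1) ℍ[ℝ]) = (2⁻¹ : ℝ) • 1 := by
    rw [← of_one1]
    refine Matrix.ext fun i j => ?_
    rw [hb]
    have : (2 : ℍ[ℝ]) = (2 : ℝ) • 1 := by rw [two_smul]; norm_num
    have h20 : (2 : ℍ[ℝ]) ≠ 0 := by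
      rw [this]; exact smul_ne_zero two_ne_zero one_ne_zero
    simp only [Matrix.of_apply, Matrix.smul_apply]
    rw [← mul_one ((2:ℍ[ℝ])⁻¹), inv_mul_eq_iff_eq_mul₀ h20, mul_smul_comm, mul_one]
    rw [this, smul_smul]
    norm_num
  have hU := (Unitary.mem_iff.1 (refl2_mem ha)).1
  have hs : star (1 - colM a * (2 : Matrix (Fin 1) (Fin 1) ℍ[ℝ]) * (colM a)ᴴ) = 1 - colM a * (2 : Matrix (Fin 1) (Fin 1) ℍ[ℝ]) * (colM a)ᴴ := by
    rw [star_eq_conjTranspose, h2]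
    simp [conjTranspose_mul]
  rw [hs] at hU
  have : (1 - colM (a + a) * (Matrix.of fun _ _ => (bet a a)⁻¹ : Matrix (Fin 1) (Fin 1) ℍ[ℝ]) * (colM (a + a))ᴴ) = 
     1 - colM a * (2 : Matrix (Fin 1) (Fin 1) ℍ[ℝ]) * (colM a)ᴴ := by
    rw [h3, hw, h2, conjTranspose_smul]
    simp [smul_smul]
  unfold Tm
  rw [this, hU]

theorem continuous_colM : Continuous colM := by
  unfold colM
  exact continuous_matrix fun i j => continuous_apply i

theorem continuous_Tm {Z : Type*} [TopologicalSpace Z] {a b : Z → VH} (ha : Continuous a) (hb : Continuous b)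
    (h : ∀ z, bet (a z) (b z) ≠ 0) : Continuous fun z => Tm (a z) (b z) := by
  have hc := continuous_colM
  have hbe : Continuous fun z => bet (a z) (b z) := by
    unfold bet
    fun_prop
  have h1 : Continuous fun z => (Matrix.of fun _ _ => (bet (a z) (b z))⁻¹ : Matrix (Fin 1) (Fin 1) ℍ[ℝ]) :=
    continuous_matrix fun i j => hbe.inv₀ h
  have h2 : Continuous fun z => colM (a z + b z) := hc.comp (ha.add hb)
  have h3 : Continuous fun z => colM (b z) := hc.comp hb
  unfold Tm
  exact ((continuous_const.sub ((h2.matrix_mul h1).matrix_mul h2.matrix_conjTranspose))).mul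
    (continuous_const.sub ((h3.matrix_mul continuous_const).matrix_mul h3.matrix_conjTranspose))

end TT

section DEFORM
set_option linter.unusedSectionVars false
open Matrix

/-- Euclidean norm -/
def nv (v : VH) : ℝ := Real.sqrt (∑ i, ‖v i‖ ^ 2)

theorem nv_pos {v : VH} (h : v ≠ 0) : 0 < nv v := by
  apply Real.sqrt_pos.2
  obtain ⟨i, hi⟩ := Function.ne_iff.1 h
  refine Finset.sum_pos' (fun i _ => by positivity) ⟨i, Finset.mem_univ i, ?_⟩
  have : 0 < ‖v i‖ := norm_pos_iff.2 hi
  positivity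

/-- normalization -/
def nu (v : VH) : VH := (nv v)⁻¹ • v

theorem nu_unit {v : VH} (h : v ≠ 0) : UnitV (nu v) := by
  have h1 := nv_pos h
  have h2 : nv v ^ 2 = ∑ i, ‖v i‖ ^ 2 := Real.sq_sqrt (Finset.sum_nonneg fun i _ => by positivity)
  unfold UnitV nu
  simp only [Pi.smul_apply, norm_smul, mul_pow, ← Finset.mul_sum, ← h2]
  rw [norm_inv, Real.norm_of_nonneg h1.le]
  field_simp

theorem UnitV.ne {v : VH} (h : UnitV v) : v ≠ 0 := by
  rintro rfl
  simp [UnitV] at h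

theorem nu_smul {v : VH} (h : UnitV v) {r : ℝ} (hr : 0 < r) : nu (r • v) = v := by
  have : nv (r • v) = r := by
    unfold nv
    simp only [Pi.smul_apply, norm_smul, mul_pow, ← Finset.mul_sum]
    rw [h, mul_one, Real.norm_of_nonneg hr.le, Real.sqrt_sq hr.le]
  unfold nu
  rw [this, smul_smul, inv_mul_cancel₀ hr.ne', one_smul]

theorem nu_of_unit {v : VH} (h : UnitV v) : nu v = v := by
  have := nu_smul h one_pos
  rwa [one_smul] at this

theorem smul_nu {v : VH} (h : v ≠ 0) : nv v • nu v = v := by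
  unfold nu
  rw [smul_smul, mul_inv_cancel₀ (nv_pos h).ne', one_smul]

theorem continuous_nu {Z : Type*} [TopologicalSpace Z] {y : Z → VH} (hy : Continuous y) (h : ∀ z, y z ≠ 0) :
    Continuous fun z => nu (y z) := by
  have : Continuous fun z => nv (y z) := by unfold nv; fun_prop
  unfold nu
  exact (this.inv₀ fun z => (nv_pos (h z)).ne').smul hy

theorem TS_exists {Z : Type*} [TopologicalSpace Z] {y b : Z → VH} (hy : Continuous y) (hb : Continuous b)
    (hbu : ∀ z, UnitV (b z)) (hne : ∀ z, ∀ r : ℝ, 0 ≤ r → y z ≠ -(r • b z)) :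
    ∃ τ : Z → Sp3, Continuous τ ∧ (∀ z, (τ z).val *ᵥ b z = nu (y z)) ∧
      ∀ z, ∀ r : ℝ, 0 < r → y z = r • b z → τ z = 1 := by
  have hy0 : ∀ z, y z ≠ 0 := fun z h => hne z 0 le_rfl (by simp [h])
  have hu : ∀ z, UnitV (nu (y z)) := fun z => nu_unit (hy0 z)
  have hn : ∀ z, nu (y z) ≠ - b z := by
    intro z h
    refine hne z (nv (y z)) (nv_pos (hy0 z)).le ?_
    rw [← smul_neg, ← h, smul_nu (hy0 z)]
  refine ⟨fun z => ⟨Tm (nu (y z)) (b z), Tm_mem (hu z) (hbu z) (hn z)⟩, ?_, ?_, ?_⟩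
  · exact Continuous.subtype_mk (continuous_Tm (continuous_nu hy hy0) hb fun z => bet_ne (hu z) (hbu z) (hn z)) _
  · intro z
    have := Tm_col (hu z) (hbu z) (hn z)
    funext i
    exact congrFun (congrFun this i) 0
  · intro z r hr h
    apply Subtype.ext
    simp only [h, nu_smul (hbu z) hr, Tm_self (hbu z)]
    rfl

/-- the base vector -/
def e1 : VH := Pi.single 1 1

theorem e1_unit : UnitV e1 := by
  simp [UnitV, e1, Fin.sum_univ_three]

theorem HRel_equiv : Equivalence HRel := by
  refine ⟨?_, ?_, ?_⟩
  · intro g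
    refine ⟨1, ⟨1, 1, norm_one, norm_one, ?_⟩, (mul_one g).symm⟩
    change (1 : Matrix (Fin 3) (Fin 3) ℍ[ℝ]) = _
    rw [← Matrix.diagonal_one]
    congr 1
    funext i
    fin_cases i <;> rfl
  · rintro g g' ⟨h, ⟨q₁, q₂, h1, h2, hh⟩, rfl⟩
    refine ⟨h⁻¹, ⟨star q₁, star q₂, by simpa using h1, by simpa using h2, ?_⟩, by simp⟩
    change star h.val = _
    rw [hh, star_eq_conjTranspose, diagonal_conjTranspose]
    congr 1
    funext i
    fin_cases i <;> simp
  · rintro g g' g'' ⟨h, ⟨q₁, q₂, h1, h2, hh⟩, rfl⟩ ⟨h', ⟨q₁', q₂', h1', h2', hh'⟩, rfl⟩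
    refine ⟨h * h', ⟨q₁ * q₁', q₂ * q₂', by simp [h1, h1'], by simp [h2, h2'], ?_⟩, by simp [mul_assoc]⟩
    change h.val * h'.val = _
    rw [hh, hh', diagonal_mul_diagonal]
    congr 1
    funext i
    fin_cases i <;> simp

/-- the projection -/
def mkM (g : Sp3) : M₂ := Quot.mk HRel g

theorem mkM_eq {g g' : Sp3} : mkM g = mkM g' ↔ HRel g g' := HRel_equiv.quot_mk_eq_iff g g'

theorem mkM_surj : Function.Surjective mkM := Quot.mk_surjective

theorem continuous_mkM : Continuous mkM := continuous_quot_mk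

theorem mkM_open : IsOpenQuotientMap mkM := by
  refine ⟨mkM_surj, continuous_mkM, ?_⟩
  intro U hU
  have hq : Topology.IsQuotientMap mkM := isQuotientMap_quot_mk
  rw [← hq.isOpen_preimage]
  have : mkM ⁻¹' (mkM '' U) = ⋃ h : {h : Sp3 // ∃ q₁ q₂ : ℍ[ℝ], ‖q₁‖ = 1 ∧ ‖q₂‖ = 1 ∧
    h.val = Matrix.diagonal ![q₁, 1, q₂]}, (fun g => g * h.1) ⁻¹' U := by
    ext g
    simp only [Set.mem_preimage, Set.mem_image, Set.mem_iUnion]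
    constructor
    · rintro ⟨u, hu, huv⟩
      obtain ⟨h, hh, rfl⟩ := mkM_eq.1 huv.symm
      exact ⟨⟨h, hh⟩, hu⟩
    · rintro ⟨⟨h, hh⟩, hu⟩
      exact ⟨_, hu, (mkM_eq.2 ⟨h, hh, rfl⟩).symm⟩
  rw [this]
  exact isOpen_iUnion fun h => hU.preimage (continuous_mul_const h.1)

/-- the action -/
def act (g : Sp3) : M₂ → M₂ := Quot.map (fun g' => g * g') (by
  rintro a b ⟨h, hh, rfl⟩
  exact ⟨h, hh, by rw [mul_assoc]⟩)

theorem act_mk (g g' : Sp3) : act g (mkM g') = mkM (g * g') := rfl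

theorem act_one (m : M₂) : act 1 m = m := by
  obtain ⟨g, rfl⟩ := mkM_surj m
  rw [act_mk, one_mul]

theorem act_act (g g' : Sp3) (m : M₂) : act g (act g' m) = act (g * g') m := by
  obtain ⟨a, rfl⟩ := mkM_surj m
  rw [act_mk, act_mk, act_mk, mul_assoc]

theorem continuous_act' : Continuous fun z : Sp3 × M₂ => act z.1 z.2 := by
  have hq := ((IsOpenQuotientMap.id (X := Sp3)).prodMap mkM_open).isQuotientMap
  rw [hq.continuous_iff]
  have : (fun z : Sp3 × M₂ => act z.1 z.2) ∘ Prod.map id mkM = fun z => mkM (z.1 * z.2) := rfl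
  rw [this]
  exact continuous_mkM.comp continuous_mul

theorem continuous_act {Z : Type*} [TopologicalSpace Z] {τ : Z → Sp3} {f : Z → M₂} (hτ : Continuous τ) (hf : Continuous f) :
    Continuous fun z => act (τ z) (f z) := continuous_act'.comp (hτ.prodMk hf)

/-- second column -/
def pM : M₂ → VH := Quot.lift (fun g i => g.val i 1) (by
  rintro a b ⟨h, ⟨q₁, q₂, h1, h2, hh⟩, rfl⟩
  funext i
  change a.val i 1 = (a.val * h.val) i 1
  rw [hh, Matrix.mul_diagonal]
  simp)

theorem pM_mk (g : Sp3) (i : Fin 3) : pM (mkM g) i = g.val i 1 := rfl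

theorem continuous_entry (i j : Fin 3) : Continuous fun g : Sp3 => g.val i j :=
  continuous_subtype_val.matrix_elem i j

theorem continuous_pM : Continuous pM := by
  refine continuous_quot_lift _ ?_
  exact continuous_pi fun i => continuous_entry i 1

theorem pM_act (g : Sp3) (m : M₂) : pM (act g m) = g.val *ᵥ pM m := by
  obtain ⟨a, rfl⟩ := mkM_surj m
  funext i
  change (g.val * a.val) i 1 = _
  simp [Matrix.mul_apply, Matrix.mulVec, dotProduct, pM_mk]

theorem sp_unit (g : Sp3) (j : Fin 3) : ∑ i, ‖g.val i j‖ ^ 2 = 1 := by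
  have h := (Unitary.mem_iff.1 g.2).1
  have h2 := congrFun (congrFun h j) j
  rw [star_eq_conjTranspose, Matrix.mul_apply, Matrix.one_apply_eq] at h2
  simp only [Matrix.conjTranspose_apply, star_mul_norm] at h2
  have h3 : ((∑ i, ‖g.val i j‖ ^ 2 : ℝ) : ℍ[ℝ]) = ((1 : ℝ) : ℍ[ℝ]) := by
    rw [Quaternion.coe_one, ← h2]
    simp only [Fin.sum_univ_three]
    push_cast
    rfl
  exact Quaternion.coe_injective h3

theorem pM_unit (m : M₂) : UnitV (pM m) := by
  obtain ⟨a, rfl⟩ := mkM_surj m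
  exact sp_unit a 1

theorem UnitV.half_le {v : VH} (h : UnitV v) : 1 / 2 ≤ ‖v‖ := by
  by_contra hcon
  push Not at hcon
  have : ∀ i, ‖v i‖ ^ 2 ≤ 1 / 4 := by
    intro i
    have := norm_le_pi_norm v i
    have := norm_nonneg (v i)
    nlinarith
  have h1 := this 0
  have h2 := this 1
  have h3 := this 2
  unfold UnitV at h
  rw [Fin.sum_univ_three] at h
  linarith

theorem deform {K D : Type*} [TopologicalSpace K] [CompactSpace K] [NormedAddCommGroup D] [NormedSpace ℝ D]
    [FiniteDimensional ℝ D] (hdim : Module.finrank ℝ D < 11) (ι : C(K, D)) (hι : Function.Injective ι)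
    {f : K → M₂} (hf : Continuous f) : ∃ Γ : I × K → Sp3, Continuous Γ ∧ (∀ x, Γ (0, x) = 1) ∧
      (∀ x, pM (act (Γ (1, x)) (f x)) = e1) ∧ ∀ t x, pM (f x) = e1 → Γ (t, x) = 1 := by
  have hfr : Module.finrank ℝ VH = 12 := by
    rw [Module.finrank_pi_fintype]
    simp [Quaternion.finrank_eq_four]
  set g : K → VH := fun x => pM (f x) with hg
  have hgc : Continuous g := continuous_pM.comp hf
  have hgu : ∀ x, UnitV (g x) := fun x => pM_unit _
  obtain ⟨g', hg'c, hg'n, hg'e, hg'a⟩ := general_position (K := K) (by rw [hfr]; omega) ι hι hgc e1_unit.ne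
    (ε := 1 / 2) (by norm_num)
  have hg'0 : ∀ x, g' x ≠ 0 := fun x h => hg'a x 0 le_rfl (by simp [h])
  obtain ⟨τ1, h1c, h1b, h1r⟩ := TS_exists (Z := I × K) (y := fun z => (1 - (z.1 : ℝ)) • g z.2 + (z.1 : ℝ) • g' z.2)
    (b := fun z => g z.2) (by fun_prop) (by fun_prop) (fun z => hgu _) (by
      rintro ⟨t, x⟩ r hr h
      simp only at h
      have h1 : (1 + r) • g x = (t : ℝ) • (g x - g' x) := by
        have e : (1 - (t:ℝ)) • g x + (t : ℝ) • g' x + r • g x = 0 := by rw [h]; simp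
        have e2 : (1 + r) • g x - (t : ℝ) • (g x - g' x) = (1 - (t:ℝ)) • g x + (t : ℝ) • g' x + r • g x := by module
        rw [e] at e2
        exact sub_eq_zero.1 e2
      have h2 := congrArg norm h1
      rw [norm_smul, norm_smul, norm_sub_rev, Real.norm_of_nonneg (by linarith), Real.norm_of_nonneg t.2.1] at h2
      have h3 := hg'n x
      have h4 := (hgu x).half_le
      have := t.2.1
      have := t.2.2
      have := norm_nonneg (g' x - g x)
      nlinarith)
  obtain ⟨τ2, h2c, h2b, h2r⟩ := TS_exists (Z := I × K) (y := fun z => (1 - (z.1 : ℝ)) • g' z.2 + (z.1 : ℝ) • e1)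
    (b := fun z => nu (g' z.2)) (by fun_prop) (continuous_nu (by fun_prop) fun z => hg'0 _) (fun z => nu_unit (hg'0 _)) (by
      rintro ⟨t, x⟩ r hr h
      simp only [nu, smul_smul] at h
      have hn := nv_pos (hg'0 x)
      set μ := r * (nv (g' x))⁻¹ with hμ
      have hμ0 : 0 ≤ μ := by positivity
      have h1 : (t : ℝ) • e1 = -((1 - (t : ℝ) + μ) • g' x) := by
        have e : (1 - (t:ℝ)) • g' x + (t : ℝ) • e1 + μ • g' x = 0 := by rw [h]; simp
        have e2 : (t : ℝ) • e1 + ((1 - (t : ℝ) + μ) • g' x) = (1 - (t:ℝ)) • g' x + (t : ℝ) • e1 + μ • g' x := by module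
        rw [e] at e2
        exact eq_neg_of_add_eq_zero_left e2
      have ht0 := t.2.1
      have ht1 := t.2.2
      have hs0 : 0 ≤ 1 - (t : ℝ) + μ := by linarith
      rcases eq_or_lt_of_le hs0 with hs | hs
      · rw [← hs, zero_smul, neg_zero] at h1
        rcases smul_eq_zero.1 h1 with h2 | h2
        · rw [h2] at hs; linarith
        · exact e1_unit.ne h2
      · apply hg'a x ((t : ℝ) / (1 - (t : ℝ) + μ)) (by positivity)
        rw [div_eq_inv_mul, ← smul_smul, h1, smul_neg, neg_neg, smul_smul, inv_mul_cancel₀ hs.ne', one_smul])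
  refine ⟨fun z => τ2 z * τ1 z, h2c.mul h1c, ?_, ?_, ?_⟩
  · intro x
    have a1 : τ1 (0, x) = 1 := h1r _ 1 one_pos (by simp)
    have a2 : τ2 (0, x) = 1 := h2r _ (nv (g' x)) (nv_pos (hg'0 x)) (by simp [smul_nu (hg'0 x)])
    simp only [a1, a2, one_mul]
  · intro x
    have a1 := h1b (1, x)
    have a2 := h2b (1, x)
    simp only [Set.Icc.coe_one, sub_self, zero_smul, zero_add, one_smul] at a1 a2
    rw [pM_act]
    change ((τ2 (1, x)).val * (τ1 (1, x)).val) *ᵥ g x = e1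
    rw [← Matrix.mulVec_mulVec, a1, a2, nu_of_unit e1_unit]
  · intro t x hx
    have hx' : g x = e1 := hx
    have hx2 := hg'e x hx'
    have a1 : τ1 (t, x) = 1 := h1r _ 1 one_pos (by simp only [hx', hx2]; module)
    have a2 : τ2 (t, x) = 1 := h2r _ 1 one_pos (by simp only [hx2, nu_of_unit e1_unit]; module)
    simp only [a1, a2, one_mul]

end DEFORM

section FIBRE
set_option linter.unusedSectionVars false
open Matrix

/-- coordinates -/
def vec4 (q : ℍ[ℝ]) : Fin 4 → ℝ := ![q.re, q.imI, q.imJ, q.imK]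

theorem vec4_inj : Function.Injective vec4 := by
  intro a b h
  have h0 := congrFun h 0
  have h1 := congrFun h 1
  have h2 := congrFun h 2
  have h3 := congrFun h 3
  exact Quaternion.ext _ _ h0 h1 h2 h3

theorem vec4_sum (q : ℍ[ℝ]) : ∑ i, vec4 q i ^ 2 = ‖q‖ ^ 2 := by
  rw [sq ‖q‖, ← Quaternion.normSq_eq_norm_mul_self, Quaternion.normSq_def']
  simp [vec4, Fin.sum_univ_four]

theorem continuous_vec4 : Continuous vec4 := by
  refine continuous_pi fun i => ?_
  fin_cases i
  · exact Quaternion.continuous_re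
  · exact Quaternion.continuous_imI
  · exact Quaternion.continuous_imJ
  · exact Quaternion.continuous_imK

/-- the Hopf map on pairs -/
def hopf (a b : ℍ[ℝ]) : ℝ × (Fin 4 → ℝ) := (‖a‖^2 - ‖b‖^2, vec4 ((2 : ℝ) • (a * star b)))

theorem hopf_mul (a b q : ℍ[ℝ]) (hq : ‖q‖ = 1) : hopf (a * q) (b * q) = hopf a b := by
  unfold hopf
  have : a * q * star (b * q) = a * star b := by
    rw [star_mul, mul_assoc, ← mul_assoc q, mul_star_norm, hq]
    simp
  rw [this]
  simp [hq]

/-- squared Euclidean norm -/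
def n5 (u : ℝ × (Fin 4 → ℝ)) : ℝ := u.1 ^ 2 + ∑ i, u.2 i ^ 2

theorem hopf_n5 (a b : ℍ[ℝ]) : n5 (hopf a b) = (‖a‖^2 + ‖b‖^2)^2 := by
  unfold n5 hopf
  rw [vec4_sum, norm_smul, norm_mul, norm_star, Real.norm_of_nonneg zero_le_two]
  ring

theorem hopf_inj {a b a' b' : ℍ[ℝ]} (h : ‖a‖^2 + ‖b‖^2 = 1) (h' : ‖a'‖^2 + ‖b'‖^2 = 1) (e : hopf a b = hopf a' b') :
    ∃ q, a * q = a' ∧ b * q = b' := by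
  have e1 : ‖a‖^2 - ‖b‖^2 = ‖a'‖^2 - ‖b'‖^2 := congrArg Prod.fst e
  have e2 : (2 : ℝ) • (a * star b) = (2 : ℝ) • (a' * star b') := vec4_inj (congrArg Prod.snd e)
  have e3 : a * star b = a' * star b' := smul_right_injective _ two_ne_zero e2
  have e4 : b * star a = b' * star a' := by
    have := congrArg star e3
    simpa using this
  have ha : ‖a‖^2 = ‖a'‖^2 := by linarith
  have hb : ‖b‖^2 = ‖b'‖^2 := by linarith
  have hs : ((‖a'‖^2 : ℝ) : ℍ[ℝ]) + ((‖b'‖^2 : ℝ) : ℍ[ℝ]) = 1 := by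
    rw [← Quaternion.coe_add, h', Quaternion.coe_one]
  have hs' : ((‖a‖^2 : ℝ) : ℍ[ℝ]) + ((‖b‖^2 : ℝ) : ℍ[ℝ]) = 1 := by
    rw [← Quaternion.coe_add, h, Quaternion.coe_one]
  refine ⟨star a * a' + star b * b', ?_, ?_⟩
  · calc a * (star a * a' + star b * b') = (a * star a) * a' + (a * star b) * b' := by noncomm_ring
      _ = ((‖a'‖^2 : ℝ) : ℍ[ℝ]) * a' + a' * (star b' * b') := by rw [mul_star_norm, e3, ha, mul_assoc]
      _ = a' * (((‖a'‖^2 : ℝ) : ℍ[ℝ]) + ((‖b'‖^2 : ℝ) : ℍ[ℝ])) := by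
        rw [star_mul_norm, (Quaternion.coe_commutes _ _), mul_add]
      _ = a' := by rw [hs, mul_one]
  · calc b * (star a * a' + star b * b') = (b * star a) * a' + (b * star b) * b' := by noncomm_ring
      _ = b' * (star a' * a') + ((‖b'‖^2 : ℝ) : ℍ[ℝ]) * b' := by rw [mul_star_norm, e4, hb, mul_assoc]
      _ = b' * (((‖a'‖^2 : ℝ) : ℍ[ℝ]) + ((‖b'‖^2 : ℝ) : ℍ[ℝ])) := by
        rw [star_mul_norm, (Quaternion.coe_commutes _ b'), mul_add]
      _ = b' := by rw [hs, mul_one]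

/-- the map to `ℝ⁵` -/
def phiM : M₂ → ℝ × (Fin 4 → ℝ) := Quot.lift (fun g => hopf (g.val 0 0) (g.val 2 0)) (by
  rintro a b ⟨h, ⟨q₁, q₂, h1, h2, hh⟩, rfl⟩
  change hopf (a.val 0 0) (a.val 2 0) = hopf ((a.val * h.val) 0 0) ((a.val * h.val) 2 0)
  rw [hh, Matrix.mul_diagonal, Matrix.mul_diagonal]
  exact (hopf_mul _ _ _ h1).symm)

theorem phiM_mk (g : Sp3) : phiM (mkM g) = hopf (g.val 0 0) (g.val 2 0) := rfl

theorem continuous_phiM : Continuous phiM := by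
  refine continuous_quot_lift _ ?_
  have h0 := continuous_entry 0 0
  have h2 := continuous_entry 2 0
  have := continuous_vec4
  unfold hopf
  exact (Continuous.sub (h0.norm.pow 2) (h2.norm.pow 2)).prodMk
    (this.comp ((h0.mul h2.star).const_smul (2 : ℝ)))

theorem sp_entry (g : Sp3) (i j : Fin 3) : ∑ k, star (g.val k i) * g.val k j = if i = j then 1 else 0 := by
  have h := (Unitary.mem_iff.1 g.2).1
  have h2 := congrFun (congrFun h i) j
  rw [star_eq_conjTranspose, Matrix.mul_apply, Matrix.one_apply] at h2
  simpa only [Matrix.conjTranspose_apply] using h2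

theorem fib_cols {g : Sp3} (h : pM (mkM g) = e1) :
    g.val 0 1 = 0 ∧ g.val 1 1 = 1 ∧ g.val 2 1 = 0 ∧ g.val 1 0 = 0 ∧ g.val 1 2 = 0 := by
  have h0 : g.val 0 1 = 0 := (congrFun h 0).trans (by simp [e1])
  have h1 : g.val 1 1 = 1 := (congrFun h 1).trans (by simp [e1])
  have h2 : g.val 2 1 = 0 := (congrFun h 2).trans (by simp [e1])
  refine ⟨h0, h1, h2, ?_, ?_⟩
  · have := sp_entry g 0 1
    simp [Fin.sum_univ_three, h0, h1, h2] at this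
    exact this
  · have := sp_entry g 2 1
    simp [Fin.sum_univ_three, h0, h1, h2] at this
    exact this

theorem fib_norm {g : Sp3} (h : pM (mkM g) = e1) : ‖g.val 0 0‖^2 + ‖g.val 2 0‖^2 = 1 := by
  have := sp_unit g 0
  rw [Fin.sum_univ_three, (fib_cols h).2.2.2.1] at this
  simpa using this

theorem fib_inj {g g' : Sp3} (h : pM (mkM g) = e1) (h' : pM (mkM g') = e1) (e : phiM (mkM g) = phiM (mkM g')) :
    mkM g = mkM g' := by
  obtain ⟨q, hq0, hq2⟩ := hopf_inj (fib_norm h) (fib_norm h') e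
  have c := fib_cols h
  have c' := fib_cols h'
  rw [mkM_eq]
  set k : Sp3 := g⁻¹ * g' with hk
  have hkg : g' = g * k := by simp [hk]
  have hkv : ∀ i j, k.val i j = ∑ l, star (g.val l i) * g'.val l j := by
    intro i j
    change (star g.val * g'.val) i j = _
    rw [star_eq_conjTranspose, Matrix.mul_apply]
    rfl
  have k1 : pM (mkM k) = e1 := by
    have hh : pM (mkM g) = pM (mkM g') := by rw [h, h']
    funext i
    rw [pM_mk, hkv]
    have := sp_entry g i 1
    have e2 : ∀ l, g'.val l 1 = g.val l 1 := fun l => (congrFun hh l).symm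
    simp only [e2, this]
    fin_cases i <;> simp [e1]
  have ck := fib_cols k1
  have k20 : k.val 2 0 = 0 := by
    rw [hkv]
    have := sp_entry g 2 0
    rw [Fin.sum_univ_three] at this ⊢
    rw [c.2.2.2.1] at this
    rw [c'.2.2.2.1, ← hq0, ← hq2, ← mul_assoc, ← mul_assoc, mul_zero, add_zero, ← add_mul]
    simp at this
    rw [this, zero_mul]
  have n0 : ‖k.val 0 0‖ = 1 := by
    have := fib_norm k1
    rw [k20] at this
    have h0 := norm_nonneg (k.val 0 0)
    simp at this
    rcases this with h | h
    · exact h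
    · linarith
  have k02 : k.val 0 2 = 0 := by
    have := sp_entry k 0 2
    simp [Fin.sum_univ_three, k20, ck.2.2.2.1] at this
    rcases this with h | h
    · rw [h] at n0; simp at n0
    · exact h
  have n2 : ‖k.val 2 2‖ = 1 := by
    have := sp_unit k 2
    simp [Fin.sum_univ_three, k02, ck.2.2.2.2] at this
    have h0 := norm_nonneg (k.val 2 2)
    rcases this with h | h
    · exact h
    · linarith
  refine ⟨k, ⟨k.val 0 0, k.val 2 2, n0, n2, ?_⟩, hkg⟩
  refine Matrix.ext fun i j => ?_
  fin_cases i <;> fin_cases j <;> simp [k20, k02, ck]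

theorem fib_surj {u : ℝ × (Fin 4 → ℝ)} (hu : n5 u = 1) : ∃ g : Sp3, pM (mkM g) = e1 ∧ phiM (mkM g) = u := by
  have key : ∃ (r : ℝ) (b : ℍ[ℝ]), r^2 + ‖b‖^2 = 1 ∧ hopf (r : ℍ[ℝ]) b = u := by
    set q : ℍ[ℝ] := ⟨u.2 0, u.2 1, u.2 2, u.2 3⟩ with hq
    have hqv : vec4 q = u.2 := by
      funext i; fin_cases i <;> rfl
    have hqn : ‖q‖^2 = 1 - u.1^2 := by
      rw [← vec4_sum, hqv]
      unfold n5 at hu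
      linarith
    by_cases h : u.1 = -1
    · refine ⟨0, 1, by simp, ?_⟩
      rw [h] at hqn
      have hq0 : q = 0 := by simpa using hqn
      refine Prod.ext ?_ ?_
      · simp [hopf, h]
      · rw [← hqv, hq0]
        simp [hopf]
    · have hlt : -1 < u.1 := by
        have : u.1^2 ≤ 1 := by nlinarith [sq_nonneg ‖q‖]
        rcases lt_or_eq_of_le (show -1 ≤ u.1 by nlinarith) with h1 | h1
        · exact h1
        · exact absurd h1.symm h
      set r := Real.sqrt ((1 + u.1) / 2) with hr
      have hr0 : 0 < r := Real.sqrt_pos.2 (by linarith)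
      have hr2 : r^2 = (1 + u.1)/2 := Real.sq_sqrt (by linarith)
      have hb : ‖(2 * r)⁻¹ • star q‖^2 = (1 - u.1) / 2 := by
        rw [norm_smul, norm_star, mul_pow, hqn, norm_inv, inv_pow, Real.norm_of_nonneg (by positivity), mul_pow, hr2]
        have : (1 + u.1) ≠ 0 := by linarith
        field_simp
        ring
      refine ⟨r, (2 * r)⁻¹ • star q, by rw [hb, hr2]; ring, ?_⟩
      refine Prod.ext ?_ ?_
      · simp only [hopf]
        rw [hb, Quaternion.norm_coe, Real.norm_of_nonneg hr0.le, hr2]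
        ring
      · rw [← hqv]
        simp only [hopf]
        congr 1
        rw [star_smul, star_star, Quaternion.coe_mul_eq_smul, star_trivial, smul_smul, smul_smul]
        have : 2 * r * (2 * r)⁻¹ = 1 := by field_simp
        rw [this, one_smul]
  obtain ⟨r, b, hrb, hh⟩ := key
  have hd : ((r^2 : ℝ) : ℍ[ℝ]) + ((‖b‖^2 : ℝ) : ℍ[ℝ]) = 1 := by
    rw [← Quaternion.coe_add, hrb, Quaternion.coe_one]
  have hd' : ((‖b‖^2 : ℝ) : ℍ[ℝ]) + ((r^2 : ℝ) : ℍ[ℝ]) = 1 := by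
    rw [add_comm]; exact hd
  have hcomm : (r : ℍ[ℝ]) * b = b * r := Quaternion.coe_commutes _ _
  have hcomm' : (r : ℍ[ℝ]) * star b = star b * r := Quaternion.coe_commutes _ _
  let M : Matrix (Fin 3) (Fin 3) ℍ[ℝ] := !![(r : ℍ[ℝ]), 0, -star b; 0, 1, 0; b, 0, (r : ℍ[ℝ])]
  have hM : M ∈ unitary (Matrix (Fin 3) (Fin 3) ℍ[ℝ]) := by
    rw [Unitary.mem_iff, star_eq_conjTranspose]
    constructor
    · refine Matrix.ext fun i j => ?_
      fin_cases i <;> fin_cases j <;> simp [M, Matrix.mul_apply, Fin.sum_univ_three, star_mul_norm, mul_star_norm, -Quaternion.coe_pow, hd, hd', hcomm, hcomm']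
    · refine Matrix.ext fun i j => ?_
      fin_cases i <;> fin_cases j <;> simp [M, Matrix.mul_apply, Fin.sum_univ_three, star_mul_norm, mul_star_norm, -Quaternion.coe_pow, hd, hd', hcomm, hcomm']
  refine ⟨⟨M, hM⟩, ?_, ?_⟩
  · funext i
    rw [pM_mk]
    fin_cases i <;> simp [M, e1]
  · rw [phiM_mk, ← hh]
    rfl

end FIBRE

section ISO
set_option linter.unusedSectionVars false
open Matrix

instance compactSp3 : CompactSpace Sp3 := by
  suffices hc : IsCompact ((unitary (Matrix (Fin 3) (Fin 3) ℍ[ℝ]) : Set (Matrix (Fin 3) (Fin 3) ℍ[ℝ]))) from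
    isCompact_iff_compactSpace.1 hc
  have hsub : ((unitary (Matrix (Fin 3) (Fin 3) ℍ[ℝ]) : Set (Matrix (Fin 3) (Fin 3) ℍ[ℝ]))) ⊆
      {M : Matrix (Fin 3) (Fin 3) ℍ[ℝ] | ∀ i j, M i j ∈ Metric.closedBall (0 : ℍ[ℝ]) 1} := by
    intro M hM i j
    have := sp_unit ⟨M, hM⟩ j
    have h2 : ‖M i j‖^2 ≤ 1 := by
      rw [← this]
      exact Finset.single_le_sum (f := fun i => ‖M i j‖^2) (fun i _ => by positivity) (Finset.mem_univ i)
    rw [mem_closedBall_zero_iff]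
    have := norm_nonneg (M i j)
    nlinarith
  refine IsCompact.of_isClosed_subset ?_ ?_ hsub
  · have h1 : IsCompact {f : Fin 3 → ℍ[ℝ] | ∀ j, f j ∈ Metric.closedBall (0 : ℍ[ℝ]) 1} :=
      isCompact_pi_infinite fun j => isCompact_closedBall _ _
    exact isCompact_pi_infinite (X := fun _ : Fin 3 => Fin 3 → ℍ[ℝ]) (s := fun _ => {f : Fin 3 → ℍ[ℝ] | ∀ j, f j ∈ Metric.closedBall (0 : ℍ[ℝ]) 1}) fun i => h1
  · have : ((unitary (Matrix (Fin 3) (Fin 3) ℍ[ℝ]) : Set (Matrix (Fin 3) (Fin 3) ℍ[ℝ]))) =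
      {M | star M * M = 1} ∩ {M | M * star M = 1} := by
      ext M
      exact Unitary.mem_iff
    rw [this]
    refine IsClosed.inter ?_ ?_
    · exact isClosed_eq (continuous_star.mul continuous_id) continuous_const
    · exact isClosed_eq (continuous_id.mul continuous_star) continuous_const

/-- the fibre -/
abbrev FF : Type := {m : M₂ // pM m = e1}

/-- the round sphere -/
abbrev S4 : Type := {u : ℝ × (Fin 4 → ℝ) // n5 u = 1}

instance compactFF : CompactSpace FF := by
  have : CompactSpace M₂ := inferInstance
  have hc : IsCompact {m : M₂ | pM m = e1} := (isClosed_eq continuous_pM continuous_const).isCompact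
  exact isCompact_iff_compactSpace.1 hc

theorem phiM_n5 {m : M₂} (h : pM m = e1) : n5 (phiM m) = 1 := by
  obtain ⟨g, rfl⟩ := mkM_surj m
  rw [phiM_mk, hopf_n5, fib_norm h, one_pow]

/-- the bijection -/
def phiEquiv : FF ≃ S4 := Equiv.ofBijective (fun m => ⟨phiM m.1, phiM_n5 m.2⟩) (by
  constructor
  · rintro ⟨m, hm⟩ ⟨m', hm'⟩ h
    obtain ⟨g, rfl⟩ := mkM_surj m
    obtain ⟨g', rfl⟩ := mkM_surj m'
    exact Subtype.ext (fib_inj hm hm' (congrArg Subtype.val h))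
  · rintro ⟨u, hu⟩
    obtain ⟨g, hg, hgu⟩ := fib_surj hu
    exact ⟨⟨mkM g, hg⟩, Subtype.ext hgu⟩)

theorem continuous_phiEquiv : Continuous phiEquiv :=
  Continuous.subtype_mk (continuous_phiM.comp continuous_subtype_val) _

/-- the homeomorphism -/
def phiHomeo : FF ≃ₜ S4 := continuous_phiEquiv.homeoOfEquivCompactToT2

theorem phiHomeo_apply (m : FF) : (phiHomeo m).1 = phiM m.1 := rfl

theorem n5_pos {u : ℝ × (Fin 4 → ℝ)} (h : u ≠ 0) : 0 < n5 u := by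
  unfold n5
  by_cases h1 : u.1 = 0
  · have h2 : u.2 ≠ 0 := fun h2 => h (Prod.ext h1 h2)
    obtain ⟨i, hi⟩ := Function.ne_iff.1 h2
    have : 0 < ∑ i, u.2 i ^ 2 := by
      refine Finset.sum_pos' (fun i _ => by positivity) ⟨i, Finset.mem_univ i, ?_⟩
      have : u.2 i ≠ 0 := hi
      positivity
    positivity
  · have : 0 ≤ ∑ i, u.2 i ^ 2 := Finset.sum_nonneg fun i _ => by positivity
    positivity

/-- normalization -/
def nrm (u : ℝ × (Fin 4 → ℝ)) : ℝ × (Fin 4 → ℝ) := (Real.sqrt (n5 u))⁻¹ • u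

theorem nrm_n5 {u : ℝ × (Fin 4 → ℝ)} (h : u ≠ 0) : n5 (nrm u) = 1 := by
  have h1 := n5_pos h
  have h2 : ∀ r : ℝ, n5 (r • u) = r ^ 2 * n5 u := by
    intro r
    simp [n5, mul_pow, mul_add, Finset.mul_sum]
  rw [nrm, h2, inv_pow, Real.sq_sqrt h1.le, inv_mul_cancel₀ h1.ne']

theorem nrm_of {u : ℝ × (Fin 4 → ℝ)} (h : n5 u = 1) : nrm u = u := by
  simp [nrm, h]

theorem n5_ne {u : ℝ × (Fin 4 → ℝ)} (h : n5 u = 1) : u ≠ 0 := by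
  rintro rfl
  simp [n5] at h

theorem continuous_n5 : Continuous n5 := by
  unfold n5
  fun_prop

/-- inclusion of the fibre sphere -/
def jM (u : WW (Fin 4 → ℝ)) : M₂ := (phiHomeo.symm ⟨nrm u.1, nrm_n5 u.2⟩).1

theorem continuous_nrm : Continuous fun u : WW (Fin 4 → ℝ) => nrm u.1 := by
  have hs : Continuous fun u : WW (Fin 4 → ℝ) => Real.sqrt (n5 u.1) :=
    Real.continuous_sqrt.comp (continuous_n5.comp continuous_subtype_val)
  exact (hs.inv₀ fun u => (Real.sqrt_pos.2 (n5_pos u.2)).ne').smul continuous_subtype_val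

theorem continuous_jM : Continuous jM :=
  continuous_subtype_val.comp (phiHomeo.symm.continuous.comp (Continuous.subtype_mk continuous_nrm _))

theorem pM_jM (u) : pM (jM u) = e1 := (phiHomeo.symm _).2

theorem phiM_jM (u) : phiM (jM u) = nrm u.1 := by
  unfold jM
  rw [← phiHomeo_apply, Homeomorph.apply_symm_apply]

theorem jM_phiM {m : M₂} (h : pM m = e1) {h0 : phiM m ≠ 0} : jM ⟨phiM m, h0⟩ = m := by
  unfold jM
  have : (⟨nrm (phiM m), nrm_n5 h0⟩ : S4) = phiHomeo ⟨m, h⟩ := Subtype.ext (nrm_of (phiM_n5 h))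
  simp only
  rw [this, Homeomorph.symm_apply_apply]

theorem pM_base : pM (mkM 1) = e1 := by
  funext i
  rw [pM_mk]
  change (1 : Matrix (Fin 3) (Fin 3) ℍ[ℝ]) i 1 = _
  fin_cases i
  · simp [e1]
  · exact Matrix.one_apply_eq 1
  · simp [e1]

theorem phiM_base : phiM (mkM 1) = (1, 0) := by
  rw [phiM_mk]
  change hopf ((1 : Matrix (Fin 3) (Fin 3) ℍ[ℝ]) 0 0) ((1 : Matrix (Fin 3) (Fin 3) ℍ[ℝ]) 2 0) = _
  refine Prod.ext ?_ ?_
  · simp [hopf]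
  · funext i
    fin_cases i <;> simp [hopf, vec4]

theorem jM_base : jM (wb _) = mkM 1 := by
  have h0 : phiM (mkM 1) ≠ 0 := by rw [phiM_base]; simp
  rw [← jM_phiM pM_base (h0 := h0)]
  congr 1
  exact Subtype.ext phiM_base.symm

theorem pi_bij {N : Type*} [Fintype N] [Nonempty N] [DecidableEq N] (hN : Fintype.card N < 10) :
    Function.Bijective (piMap (N := N) jM continuous_jM jM_base) := by
  constructor
  · rw [injective_iff_map_eq_one]
    intro c hc
    obtain ⟨u, huc, hub, rfl⟩ := piMk_surj c
    rw [piMap_mk, piMk_one] at hc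
    obtain ⟨H, hHc, hH0, hH1, hHb⟩ := piMk_exact hc
    have hdim : Module.finrank ℝ (ℝ × (N → ℝ)) < 11 := by
      rw [Module.finrank_prod, Module.finrank_self, Module.finrank_pi]
      omega
    obtain ⟨Γ, hΓc, hΓ0, hΓ1, hΓe⟩ := deform hdim (cylCoe (N := N)) cylCoe_inj hHc
    have hne : ∀ z, phiM (act (Γ (1, z)) (H z)) ≠ 0 := fun z => n5_ne (phiM_n5 (hΓ1 z))
    have hfix : ∀ z, pM (H z) = e1 → act (Γ (1, z)) (H z) = H z := by
      intro z hz
      rw [hΓe 1 z hz, act_one]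
    have hcn : Continuous fun y => nrm (u y).1 := continuous_nrm.comp huc
    have hline : ∀ z : I × (I^N), (1 - (z.1 : ℝ)) • (u z.2).1 + (z.1 : ℝ) • nrm (u z.2).1 ≠ 0 := by
      intro z
      have h1 := Real.sqrt_pos.2 (n5_pos (u z.2).2)
      have h2 : 0 < (Real.sqrt (n5 (u z.2).1))⁻¹ := by positivity
      rw [nrm, smul_smul, ← add_smul]
      refine smul_ne_zero ?_ (u z.2).2
      have := z.1.2.1
      have := z.1.2.2
      rcases eq_or_lt_of_le z.1.2.1 with h0 | h0
      · rw [← h0]; simp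
      · have := mul_pos h0 h2
        linarith
    have hbn : ∀ y ∈ Cube.boundary N, nrm (u y).1 = (1, 0) := by
      intro y hy
      rw [hub y hy]
      exact nrm_of (by simp [wb, n5])
    have step1 : piMk (x := wb _) u huc hub = piMk (fun y => ⟨nrm (u y).1, n5_ne (nrm_n5 (u y).2)⟩)
        (Continuous.subtype_mk hcn _) (fun y hy => Subtype.ext (hbn y hy)) := by
      refine piMk_eq (fun z => ⟨_, hline z⟩) ?_ ?_ ?_ ?_
      · refine Continuous.subtype_mk ?_ _
        have := hcn.comp (continuous_snd (X := I) (Y := I^N))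
        exact Continuous.add (Continuous.smul (f := fun z : I × (I^N) => 1 - (z.1 : ℝ)) (by fun_prop) (continuous_subtype_val.comp (huc.comp continuous_snd)))
          (Continuous.smul (f := fun z : I × (I^N) => (z.1 : ℝ)) (by fun_prop) this)
      · intro y; apply Subtype.ext; simp
      · intro y; apply Subtype.ext; simp
      · intro t y hy
        apply Subtype.ext
        simp only
        rw [hbn y hy, hub y hy]
        simp [wb]
    rw [step1, piMk_one]
    refine piMk_eq (fun z => ⟨_, hne z⟩) ?_ ?_ ?_ ?_
    · refine Continuous.subtype_mk (continuous_phiM.comp (continuous_act (hΓc.comp (by fun_prop)) hHc)) _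
    · intro y
      apply Subtype.ext
      simp only
      rw [hfix _ (by rw [hH0]; exact pM_jM _), hH0, phiM_jM]
    · intro y
      apply Subtype.ext
      simp only
      rw [hfix _ (by rw [hH1]; exact pM_base), hH1, phiM_base]
      rfl
    · intro t y hy
      apply Subtype.ext
      simp only
      rw [hfix _ (by rw [hHb t y hy]; exact pM_base), hHb t y hy, phiM_base]
      rfl
  · intro c
    obtain ⟨f, hfc, hfb, rfl⟩ := piMk_surj c
    have hdim : Module.finrank ℝ (N → ℝ) < 11 := by
      rw [Module.finrank_pi]
      omega
    obtain ⟨Γ, hΓc, hΓ0, hΓ1, hΓe⟩ := deform hdim (cubeCoe (N := N)) cubeCoe_inj hfc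
    have hfix : ∀ t, ∀ y ∈ Cube.boundary N, act (Γ (t, y)) (f y) = mkM 1 := by
      intro t y hy
      rw [hΓe t y (by rw [hfb y hy]; exact pM_base), act_one, hfb y hy]
    have hne : ∀ z, phiM (act (Γ (1, z)) (f z)) ≠ 0 := fun z => n5_ne (phiM_n5 (hΓ1 z))
    have hc1 : Continuous fun y => act (Γ (1, y)) (f y) := continuous_act (hΓc.comp (by fun_prop)) hfc
    refine ⟨piMk (fun y => ⟨_, hne y⟩) (Continuous.subtype_mk (continuous_phiM.comp hc1) _) ?_, ?_⟩
    · intro y hy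
      apply Subtype.ext
      simp only
      rw [hfix 1 y hy, phiM_base]
      rfl
    · rw [piMap_mk]
      symm
      refine piMk_eq (fun z => act (Γ z) (f z.2)) (continuous_act hΓc (hfc.comp continuous_snd)) ?_ ?_ ?_
      · intro y
        simp only [hΓ0, act_one]
      · intro y
        exact (jM_phiM (hΓ1 y)).symm
      · intro t y hy
        exact hfix t y hy

theorem pi2_WW : Subsingleton (HomotopyGroup (Fin 2) (WW (Fin 4 → ℝ)) (wb (Fin 4 → ℝ))) := by
  refine subsingleton_of_forall_eq 1 fun c => ?_
  obtain ⟨f, hfc, hfb, rfl⟩ := piMk_surj c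
  rw [cl_of_loop]
  have hc : Continuous fun y => (f y).1 := by fun_prop
  obtain ⟨x0, -, hx0⟩ := isCompact_univ.exists_isMinOn (Set.univ_nonempty (α := (I^(Fin 2))))
    (f := fun y => ‖(f y).1‖) (by fun_prop)
  have hm0 : 0 < ‖(f x0).1‖ := norm_pos_iff.2 (f x0).2
  have hmin : ∀ z, ‖(f x0).1‖ ≤ ‖(f z).1‖ := fun z => hx0 (Set.mem_univ z)
  have hb : ((1, 0) : ℝ × (Fin 4 → ℝ)) ≠ 0 := by simp
  obtain ⟨f', hf'c, hf'n, hf'b, hf'a⟩ := general_position (D := Fin 2 → ℝ) (V := ℝ × (Fin 4 → ℝ))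
    (by simp) cubeCoe cubeCoe_inj hc hb hm0
  have h1 : cl f' = 1 := by
    refine cl_one hf'c ?_
    rintro y ⟨h2, h3⟩
    apply hf'a y (-(f' y).1) (by linarith)
    refine Prod.ext ?_ ?_
    · simp
    · simp [h2]
  rw [← h1]
  refine cl_homotopy' (fun t y => (1 - t) • (f y).1 + t • f' y) (by fun_prop) (by simp) (by simp) ?_ ?_
  · intro t ht y h
    have e : (f y).1 = -(t • (f' y - (f y).1)) := by
      have e2 : (f y).1 + (t • (f' y - (f y).1)) = (1 - t) • (f y).1 + t • f' y := by module
      rw [h] at e2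
      exact eq_neg_of_add_eq_zero_left e2
    have e3 := congrArg norm e
    rw [norm_neg, norm_smul, Real.norm_of_nonneg ht.1] at e3
    have := hf'n y
    have := hmin y
    have := ht.1
    have := ht.2
    nlinarith [norm_nonneg (f' y - (f y).1)]
  · intro t ht y hy
    have e : (f y).1 = (1, 0) := congrArg Subtype.val (hfb y hy)
    rw [hf'b y e, e]
    rintro ⟨-, h2⟩
    simp at h2
    linarith

/-- change of base point -/
def baseEquiv {N : Type*} [Nonempty N] [DecidableEq N] (g : Sp3) :
    HomotopyGroup N M₂ (mkM g) ≃* HomotopyGroup N M₂ (mkM 1) :=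
  MonoidHom.toMulEquiv
    (piMap (act g⁻¹) (continuous_act continuous_const continuous_id) (by rw [act_mk, inv_mul_cancel]))
    (piMap (act g) (continuous_act continuous_const continuous_id) (by rw [act_mk, mul_one]))
    (by
      refine MonoidHom.ext fun c => ?_
      obtain ⟨f, hfc, hfb, rfl⟩ := piMk_surj c
      rw [MonoidHom.comp_apply, piMap_mk, piMap_mk, MonoidHom.id_apply]
      congr 1
      funext y
      rw [act_act, mul_inv_cancel, act_one])
    (by
      refine MonoidHom.ext fun c => ?_
      obtain ⟨f, hfc, hfb, rfl⟩ := piMk_surj c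
      rw [MonoidHom.comp_apply, piMap_mk, piMap_mk, MonoidHom.id_apply]
      congr 1
      funext y
      rw [act_act, inv_mul_cancel, act_one])

end ISO

theorem statement12_aux (x : M₂) :
    Subsingleton (HomotopyGroup (Fin 2) M₂ x) ∧ Nonempty (HomotopyGroup (Fin 4) M₂ x ≃* Multiplicative ℤ) := by
  obtain ⟨g, rfl⟩ := mkM_surj x
  constructor
  · have e := MulEquiv.ofBijective _ (pi_bij (N := Fin 2) (by simp))
    have := pi2_WW
    exact ((baseEquiv g).trans e.symm).toEquiv.subsingleton
  · have e := MulEquiv.ofBijective _ (pi_bij (N := Fin 4) (by simp))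
    obtain ⟨isoZ⟩ := pi4_WW
    exact ⟨((baseEquiv g).trans e.symm).trans isoZ⟩

/-- `π₂(M₂)` is trivial and `π₄(M₂) ≅ ℤ` (for any basepoint). -/
theorem statement12 (x : M₂) :
    Subsingleton ((π_ 2) M₂ x) ∧ Nonempty ((π_ (3 + 1)) M₂ x ≃* Multiplicative ℤ) := by
  exact statement12_aux x
end
end
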